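/- For the two-user Gaussian interference channel with degraded message sets in which transmitter 2 knows both messages, if |a| ≤ 1 then the capacity region C^{T₂}_{GIFC} is exactly the set of all rate pairs (R₁,R₂) such that for some β ∈ [0,1]: R₁ ≤ ½ log( (1 + P₁ + 2|a|√((1−β)P₁P₂) + a²P₂) / (1 + a²βP₂) ) and R₂ ≤ ½ log(1 + βP₂). -/

import Mathlib

open scoped BigOperators
open MeasureTheory ProbabilityTheory

noncomputable section

/-- The law of `n` i.i.d. standard Gaussian noise samples. -/
def stdGaussN (n : ℕ) : Measure (Fin n → ℝ) :=
  Measure.pi fun _ => gaussianReal 0 1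

/-- Average probability that receiver 1 errs, for a code for the Gaussian IFC
`Y₁ = X₁ + a X₂ + Z₁`, `Y₂ = b X₁ + X₂ + Z₂` with degraded message sets
(transmitter 2 knows both messages), messages uniform and independent. -/
def peG1T2 (a : ℝ) (n M1 M2 : ℕ) (f1 : Fin M1 → Fin n → ℝ)
    (f2 : Fin M1 → Fin M2 → Fin n → ℝ) (g1 : (Fin n → ℝ) → Fin M1) : ℝ :=
  (1 / (M1 * M2) : ℝ) * ∑ w1 : Fin M1, ∑ w2 : Fin M2,
    (stdGaussN n {z | g1 (fun i => f1 w1 i + a * f2 w1 w2 i + z i) ≠ w1}).toReal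

/-- Average probability that receiver 2 errs (transmitter 2 informed). -/
def peG2T2 (b : ℝ) (n M1 M2 : ℕ) (f1 : Fin M1 → Fin n → ℝ)
    (f2 : Fin M1 → Fin M2 → Fin n → ℝ) (g2 : (Fin n → ℝ) → Fin M2) : ℝ :=
  (1 / (M1 * M2) : ℝ) * ∑ w1 : Fin M1, ∑ w2 : Fin M2,
    (stdGaussN n {z | g2 (fun i => b * f1 w1 i + f2 w1 w2 i + z i) ≠ w2}).toReal

/-- A rate pair is achievable for the Gaussian IFC with degraded message sets
(transmitter 2 knows both messages) under the average power constraints `P1`, `P2`. -/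
def AchievableGT2 (a b P1 P2 R1 R2 : ℝ) : Prop :=
  ∀ ε : ℝ, 0 < ε → ∃ (n M1 M2 : ℕ) (f1 : Fin M1 → Fin n → ℝ)
    (f2 : Fin M1 → Fin M2 → Fin n → ℝ) (g1 : (Fin n → ℝ) → Fin M1)
    (g2 : (Fin n → ℝ) → Fin M2),
    0 < n ∧ 0 < M1 ∧ 0 < M2 ∧
    (1 / M1 : ℝ) * ∑ w1 : Fin M1, ((1 / n : ℝ) * ∑ i, (f1 w1 i) ^ 2) ≤ P1 ∧
    (1 / (M1 * M2) : ℝ) * ∑ w1 : Fin M1, ∑ w2 : Fin M2,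
      ((1 / n : ℝ) * ∑ i, (f2 w1 w2 i) ^ 2) ≤ P2 ∧
    R1 - ε ≤ Real.logb 2 M1 / n ∧ R2 - ε ≤ Real.logb 2 M2 / n ∧
    peG1T2 a n M1 M2 f1 f2 g1 ≤ ε ∧ peG2T2 b n M1 M2 f1 f2 g2 ≤ ε

/-- The capacity region `C^{T₂}_{GIFC}` of the Gaussian IFC with degraded message sets
in which transmitter 2 knows both messages. -/
def CapacityGT2 (a b P1 P2 : ℝ) : Set (ℝ × ℝ) :=
  closure {R : ℝ × ℝ | AchievableGT2 a b P1 P2 R.1 R.2}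


section
open scoped BigOperators
open MeasureTheory ProbabilityTheory
noncomputable section

instance stdGaussN_prob (n : ℕ) : IsProbabilityMeasure (stdGaussN n) := by
  unfold stdGaussN; infer_instance

lemma exists_angle (α β : ℝ) (h : α ^ 2 + β ^ 2 = 1) :
    ∃ θ : ℝ, Real.cos θ = α ∧ Real.sin θ = β := by
  have hn : ‖(⟨α, β⟩ : ℂ)‖ = 1 := by
    rw [Complex.norm_eq_sqrt_sq_add_sq]; simp [h]
  refine ⟨Complex.arg ⟨α, β⟩, ?_, ?_⟩
  · rw [Complex.cos_arg]
    · simp [hn]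
    · intro h0; rw [h0] at hn; simp at hn
  · rw [Complex.sin_arg]; simp [hn]

lemma gauss_rot (α β : ℝ) (h : α ^ 2 + β ^ 2 = 1) :
    MeasurePreserving (fun p : ℝ × ℝ => (α * p.1 + β * p.2, -β * p.1 + α * p.2))
      ((gaussianReal 0 1).prod (gaussianReal 0 1)) ((gaussianReal 0 1).prod (gaussianReal 0 1)) := by
  obtain ⟨θ, rfl, rfl⟩ := exists_angle α β h
  have key := IsGaussian.map_rotation_eq_self_of_forall_strongDual_eq_zero (μ := gaussianReal 0 1) (by
    intro L
    rw [integral_continuousLinearMap_gaussianReal]; simp) θ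
  refine ⟨by fun_prop, ?_⟩
  rw [← key]; congr 1

lemma stdGaussN_rot (n : ℕ) (α β : ℝ) (h : α ^ 2 + β ^ 2 = 1) :
    MeasurePreserving (fun p : (Fin n → ℝ) × (Fin n → ℝ) =>
      (α • p.1 + β • p.2, -β • p.1 + α • p.2))
      ((stdGaussN n).prod (stdGaussN n)) ((stdGaussN n).prod (stdGaussN n)) := by
  have h1 := measurePreserving_arrowProdEquivProdArrow ℝ ℝ (Fin n)
    (fun _ => gaussianReal 0 1) (fun _ => gaussianReal 0 1)
  have h2 := measurePreserving_pi (fun _ : Fin n => (gaussianReal 0 1).prod (gaussianReal 0 1))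
    (fun _ : Fin n => (gaussianReal 0 1).prod (gaussianReal 0 1)) (fun _ => gauss_rot α β h)
  exact (h1.comp h2).comp h1.symm

lemma stdGaussN_lc (n : ℕ) (α β : ℝ) (h : α ^ 2 + β ^ 2 = 1) :
    MeasurePreserving (fun p : (Fin n → ℝ) × (Fin n → ℝ) => α • p.1 + β • p.2)
      ((stdGaussN n).prod (stdGaussN n)) (stdGaussN n) :=
  measurePreserving_fst.comp (stdGaussN_rot n α β h)

lemma stdGaussN_neg (n : ℕ) :
    MeasurePreserving (fun z : Fin n → ℝ => -z) (stdGaussN n) (stdGaussN n) := by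
  have := measurePreserving_pi (fun _ : Fin n => gaussianReal 0 1) (fun _ : Fin n => gaussianReal 0 1)
    (f := fun _ x => -x) (fun i => ⟨by fun_prop, by rw [gaussianReal_map_neg]; simp⟩)
  exact this

/-- Chebyshev for the chi-square. -/
lemma chi_conc : ∃ K : ℝ, 0 ≤ K ∧ ∀ (n : ℕ), 0 < n → ∀ δ : ℝ, 0 < δ →
    stdGaussN n {z | δ * n ≤ |∑ i, z i ^ 2 - n|} ≤ ENNReal.ofReal (K / (n * δ ^ 2)) := by
  refine ⟨Var[fun x : ℝ => x ^ 2; gaussianReal 0 1], variance_nonneg _ _, fun n hn δ hδ => ?_⟩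
  have hm : MemLp (fun x : ℝ => x ^ 2) 2 (gaussianReal 0 1) := by
    have h4 : MemLp (id : ℝ → ℝ) 4 (gaussianReal 0 1) := memLp_id_gaussianReal' 4 (by simp)
    have : MemLp (fun x : ℝ => x * x) 2 (gaussianReal 0 1) := by
      have := h4.mul (q := 4) (r := 2) h4 (hpqr := ⟨by
        rw [show (4:ENNReal) = 2 * 2 by norm_num, ENNReal.mul_inv (by simp) (by simp), ← two_mul, ← mul_assoc,
          ENNReal.mul_inv_cancel (by simp) (by simp), one_mul]⟩)
      exact this
    simpa [sq] using this
  have hm2 : ∫ x, x ^ 2 ∂(gaussianReal 0 1) = 1 := by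
    have := variance_fun_id_gaussianReal (μ := 0) (v := 1)
    rw [variance_of_integral_eq_zero (by fun_prop) (by simp)] at this
    simpa using this
  have hsum := variance_sum_pi (μ := fun _ : Fin n => gaussianReal 0 1) (X := fun _ x => x ^ 2) (fun _ => hm)
  have hmem : ∀ i : Fin n, MemLp (fun z : Fin n → ℝ => z i ^ 2) 2 (stdGaussN n) := fun i =>
    hm.comp_measurePreserving (measurePreserving_eval (fun _ : Fin n => gaussianReal 0 1) i)
  have hE : ∫ z, (∑ i : Fin n, fun z : Fin n → ℝ => z i ^ 2) z ∂(stdGaussN n) = n := by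
    simp only [Finset.sum_apply]
    rw [integral_finsetSum _ (fun i _ => (hmem i).integrable (by simp))]
    have : ∀ i : Fin n, ∫ z : Fin n → ℝ, z i ^ 2 ∂(stdGaussN n) = 1 := fun i => by
      have := integral_comp_eval (μ := fun _ : Fin n => gaussianReal 0 1) (i := i) (f := fun x : ℝ => x ^ 2) (by fun_prop)
      unfold stdGaussN
      rw [this, hm2]
    simp [this]
  have hn' : (0:ℝ) < n := by exact_mod_cast hn
  have := meas_ge_le_variance_div_sq (μ := stdGaussN n) (X := ∑ i : Fin n, fun z : Fin n → ℝ => z i ^ 2)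
    (memLp_finsetSum' _ (fun i _ => hmem i)) (c := δ * n) (by positivity)
  rw [hE] at this
  simp only [Finset.sum_apply] at this
  refine this.trans (le_of_eq ?_)
  congr 1
  rw [show Var[∑ i : Fin n, fun z : Fin n → ℝ => z i ^ 2; stdGaussN n] = _ from hsum]
  simp
  field_simp

end
end

section
open scoped BigOperators
open MeasureTheory ProbabilityTheory
noncomputable section

/-- one-dimensional reverse-channel density ratio -/
def gd1 (k τ x y : ℝ) : ℝ :=
  Real.exp (-(1/2) * Real.log τ - (x - k * y) ^ 2 / (2 * τ) + x ^ 2 / 2)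

/-- `n`-dimensional reverse-channel density ratio -/
def gD (n : ℕ) (k τ : ℝ) (x y : Fin n → ℝ) : ENNReal :=
  ∏ i, ENNReal.ofReal (gd1 k τ (x i) (y i))

lemma measurable_gd1 (k τ : ℝ) : Measurable (fun p : ℝ × ℝ => gd1 k τ p.1 p.2) := by
  unfold gd1; fun_prop

lemma measurable_gD (n : ℕ) (k τ : ℝ) :
    Measurable (fun p : (Fin n → ℝ) × (Fin n → ℝ) => gD n k τ p.1 p.2) := by
  unfold gD gd1
  fun_prop

lemma measurable_gd1_left (k τ y : ℝ) : Measurable (fun x : ℝ => ENNReal.ofReal (gd1 k τ x y)) := by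
  unfold gd1; fun_prop

lemma measurable_gD_left (n : ℕ) (k τ : ℝ) (y : Fin n → ℝ) :
    Measurable (fun x : (Fin n → ℝ) => gD n k τ x y) := by
  unfold gD gd1
  fun_prop

lemma gD_eq (n : ℕ) (k τ : ℝ) (x y : Fin n → ℝ) :
    gD n k τ x y = ENNReal.ofReal (Real.exp (-(n/2) * Real.log τ
      - (∑ i, (x i - k * y i) ^ 2) / (2 * τ) + (∑ i, x i ^ 2) / 2)) := by
  unfold gD gd1
  rw [← ENNReal.ofReal_prod_of_nonneg (fun i _ => (Real.exp_pos _).le), ← Real.exp_sum]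
  congr 2
  rw [Finset.sum_add_distrib, Finset.sum_sub_distrib, Finset.sum_div, Finset.sum_div]
  simp
  ring

lemma gauss_map_density1 (k τ y : ℝ) (hτ : 0 < τ) :
    (gaussianReal 0 1).withDensity (fun x => ENNReal.ofReal (gd1 k τ x y))
      = (gaussianReal 0 1).map (fun g => k * y + Real.sqrt τ * g) := by
  have h1 : (gaussianReal 0 1).map (fun g => k * y + Real.sqrt τ * g)
      = gaussianReal (k * y) ⟨τ, hτ.le⟩ := by
    rw [show (fun g => k * y + Real.sqrt τ * g) = (fun g => k * y + g) ∘ (fun g => Real.sqrt τ * g) from rfl,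
      ← Measure.map_map (by fun_prop) (by fun_prop), gaussianReal_map_const_mul,
      gaussianReal_map_const_add]
    congr 1
    · ring
    · ext; simp [Real.sq_sqrt hτ.le]; rfl
  have hne : (⟨τ, hτ.le⟩ : NNReal) ≠ 0 := fun h => hτ.ne' (congrArg NNReal.toReal h)
  rw [h1, gaussianReal_of_var_ne_zero _ hne, gaussianReal_of_var_ne_zero _ one_ne_zero,
    ← withDensity_mul _ (by fun_prop) (measurable_gd1_left k τ y)]
  congr 1
  ext x
  simp only [Pi.mul_apply, gaussianPDF]
  rw [← ENNReal.ofReal_mul (gaussianPDFReal_nonneg _ _ _)]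
  congr 1
  simp only [gaussianPDFReal, gd1]
  have e1 : Real.exp (-(1/2) * Real.log τ) = (Real.sqrt τ)⁻¹ := by
    rw [Real.sqrt_eq_rpow, ← Real.rpow_neg hτ.le, Real.rpow_def_of_pos hτ]; congr 1; ring
  rw [show -(1/2) * Real.log τ - (x - k * y) ^ 2 / (2 * τ) + x ^ 2 / 2
    = (-(1/2) * Real.log τ) + (- (x - k * y) ^ 2 / (2 * τ) + x ^ 2 / 2) by ring, Real.exp_add, e1, Real.exp_add]
  have e2 : Real.exp (- (x - 0) ^ 2 / (2 * ((1:NNReal):ℝ))) * Real.exp (x ^ 2 / 2) = 1 := by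
    rw [← Real.exp_add, ← Real.exp_zero]; congr 1; simp; ring
  have e3 : Real.sqrt (2 * Real.pi * τ) = Real.sqrt (2 * Real.pi) * Real.sqrt τ := Real.sqrt_mul (by positivity) _
  change _ = (Real.sqrt (2 * Real.pi * τ))⁻¹ * Real.exp (-(x - k * y) ^ 2 / (2 * τ))
  rw [e3, mul_inv, NNReal.coe_one, mul_one]
  simp only [NNReal.coe_one, mul_one] at e2
  rw [sub_zero] at e2 ⊢
  rw [mul_one (2:ℝ)]
  change (Real.sqrt (2 * Real.pi))⁻¹ * Real.exp (-x ^ 2 / 2) * ((Real.sqrt τ)⁻¹ *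
    (Real.exp (-(x - k * y) ^ 2 / (2 * τ)) * Real.exp (x ^ 2 / 2))) = _
  generalize Real.exp (-x ^ 2 / 2) = A at *
  generalize Real.exp (x ^ 2 / 2) = B at *
  linear_combination ((Real.sqrt (2 * Real.pi))⁻¹ * (Real.sqrt τ)⁻¹ * Real.exp (-(x - k * y) ^ 2 / (2 * τ))) * e2

lemma gD_map (n : ℕ) (k τ : ℝ) (y : Fin n → ℝ) (hτ : 0 < τ) :
    (stdGaussN n).withDensity (fun x => gD n k τ x y)
      = (stdGaussN n).map (fun g => k • y + Real.sqrt τ • g) := by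
  have hm : ∀ y : ℝ, Measurable fun x => ENNReal.ofReal (gd1 k τ x y) :=
    fun y => measurable_gd1_left k τ y
  have hR : (stdGaussN n).map (fun g => k • y + Real.sqrt τ • g)
      = Measure.pi (fun i => (gaussianReal 0 1).map (fun g => k * y i + Real.sqrt τ * g)) := by
    have : ∀ i, IsProbabilityMeasure ((gaussianReal 0 1).map (fun g => k * y i + Real.sqrt τ * g)) :=
      fun i => Measure.isProbabilityMeasure_map (by fun_prop)
    exact (measurePreserving_pi (fun _ : Fin n => gaussianReal 0 1)
      (fun i => (gaussianReal 0 1).map (fun g => k * y i + Real.sqrt τ * g))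
      (f := fun i g => k * y i + Real.sqrt τ * g) (fun i => ⟨by fun_prop, rfl⟩)).map_eq
  rw [hR]
  have : ∀ i, IsProbabilityMeasure ((gaussianReal 0 1).map (fun g => k * y i + Real.sqrt τ * g)) :=
      fun i => Measure.isProbabilityMeasure_map (by fun_prop)
  symm
  refine Measure.pi_eq fun s hs => ?_
  rw [withDensity_apply _ (MeasurableSet.univ_pi hs), ← lintegral_indicator (MeasurableSet.univ_pi hs)]
  have h1 : ∀ x : Fin n → ℝ, (Set.univ.pi s).indicator (fun x => gD n k τ x y) x
      = ∏ i, (s i).indicator (fun x => ENNReal.ofReal (gd1 k τ x (y i))) (x i) := by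
    intro x
    by_cases hx : x ∈ Set.univ.pi s
    · rw [Set.indicator_of_mem hx]
      refine Finset.prod_congr rfl fun i _ => ?_
      rw [Set.indicator_of_mem (hx i trivial)]
    · rw [Set.indicator_of_notMem hx]
      simp only [Set.mem_pi, Set.mem_univ, forall_const, not_forall] at hx
      obtain ⟨i, hi⟩ := hx
      rw [Finset.prod_eq_zero (Finset.mem_univ i)]
      rw [Set.indicator_of_notMem hi]
  simp_rw [h1]
  have hmi : ∀ i, Measurable ((s i).indicator (fun x => ENNReal.ofReal (gd1 k τ x (y i)))) :=
    fun i => (hm _).indicator (hs i)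
  have hind := iIndepFun_pi (μ := fun _ : Fin n => gaussianReal 0 1)
    (X := fun i => (s i).indicator (fun x => ENNReal.ofReal (gd1 k τ x (y i)))) (fun i => (hmi i).aemeasurable)
  have := lintegral_prod_eq_prod_lintegral_of_indepFun Finset.univ _ hind
    (fun i => (hmi i).comp (measurable_pi_apply i))
  unfold stdGaussN
  rw [this]
  refine Finset.prod_congr rfl fun i _ => ?_
  rw [(measurePreserving_eval (fun _ : Fin n => gaussianReal 0 1) i).lintegral_comp (hmi i),
    lintegral_indicator (hs i), ← gauss_map_density1 k τ (y i) hτ, withDensity_apply _ (hs i)]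

lemma gD_lintegral_mul (n : ℕ) (k τ : ℝ) (y : Fin n → ℝ) (hτ : 0 < τ)
    (h : (Fin n → ℝ) → ENNReal) (hh : Measurable h) :
    ∫⁻ x, gD n k τ x y * h x ∂(stdGaussN n)
      = ∫⁻ g, h (k • y + Real.sqrt τ • g) ∂(stdGaussN n) := by
  have hm : Measurable (fun x => gD n k τ x y) := measurable_gD_left n k τ y
  rw [← lintegral_map hh (by fun_prop), ← gD_map n k τ y hτ,
    lintegral_withDensity_eq_lintegral_mul _ hm hh]
  rfl

lemma gD_lintegral (n : ℕ) (k τ : ℝ) (y : Fin n → ℝ) (hτ : 0 < τ) :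
    ∫⁻ x, gD n k τ x y ∂(stdGaussN n) = 1 := by
  have := gD_lintegral_mul n k τ y hτ (fun _ => 1) measurable_const
  simpa using this

end
end

section
open scoped BigOperators ENNReal
open MeasureTheory ProbabilityTheory
noncomputable section

lemma lintegral_resample {ι : Type*} [Fintype ι] [DecidableEq ι] {Z : ι → Type*}
    [∀ i, MeasurableSpace (Z i)] (μ : ∀ i, Measure (Z i)) [∀ i, IsProbabilityMeasure (μ i)]
    (f : (∀ i, Z i) → ℝ≥0∞) (hf : Measurable f) (i : ι) :
    ∫⁻ x, f x ∂(Measure.pi μ) = ∫⁻ x, ∫⁻ t, f (Function.update x i t) ∂(μ i) ∂(Measure.pi μ) := by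
  classical
  have h1 : ∀ x, ∫⁻ t, f (Function.update x i t) ∂(μ i) = (∫⋯∫⁻_{i}, f ∂μ) x := fun x =>
    (congrFun (lmarginal_singleton f i) x).symm
  simp_rw [h1]
  have h2 : (∫⋯∫⁻_{i}, f ∂μ) = (∫⋯∫⁻_{i}, (∫⋯∫⁻_{i}, f ∂μ) ∂μ) := by
    funext x
    rw [lmarginal_singleton, lmarginal_singleton]
    simp
  refine lintegral_eq_of_lmarginal_eq {i} hf (hf.lmarginal μ) h2

lemma cover_real (g p x : ℝ) (L : ℕ) (hg0 : 0 ≤ g) (hg1 : g ≤ 1) (hp0 : 0 ≤ p) (hp1 : p ≤ 1)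
    (hx : x * p ≤ L * g) : (1 - g) ^ L ≤ (1 - p) + Real.exp (-x) := by
  have h1 : (1 - g) ^ L ≤ Real.exp (-(L * g)) := by
    have : 1 - g ≤ Real.exp (-g) := by have := Real.add_one_le_exp (-g); linarith
    calc (1 - g) ^ L ≤ (Real.exp (-g)) ^ L := by gcongr
      _ = _ := by rw [← Real.exp_nat_mul]; congr 1; ring
  have h2 : Real.exp (-(L * g)) ≤ Real.exp (-(x * p)) := Real.exp_le_exp.2 (by linarith)
  have h3 : Real.exp (-(x * p)) ≤ (1 - p) * Real.exp 0 + p * Real.exp (-x) := by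
    have := convexOn_exp.2 (Set.mem_univ (0:ℝ)) (Set.mem_univ (-x)) (show 0 ≤ 1 - p by linarith) hp0 (by ring)
    simp only [smul_eq_mul] at this
    refine le_trans (le_of_eq ?_) this
    congr 1; ring
  have h4 : p * Real.exp (-x) ≤ Real.exp (-x) := by
    have := Real.exp_pos (-x); nlinarith
  simp at h3
  linarith

lemma cover_meas {X : Type*} [MeasurableSpace X] (μ : Measure X) [IsProbabilityMeasure μ]
    (r : X → ℝ≥0∞) (hr : ∫⁻ u, r u ∂μ = 1) (G : Set X) (hG : MeasurableSet G)
    (T : ℝ) (hT : 0 < T) (hrT : ∀ u ∈ G, r u ≤ ENNReal.ofReal T) (L : ℕ) :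
    (μ Gᶜ) ^ L ≤ ∫⁻ u in Gᶜ, r u ∂μ + ENNReal.ofReal (Real.exp (-(L / T))) := by
  have hsplit := lintegral_add_compl r hG (μ := μ)
  rw [hr] at hsplit
  have hp : ∫⁻ u in G, r u ∂μ ≤ 1 := hsplit ▸ le_self_add
  have hq : ∫⁻ u in Gᶜ, r u ∂μ ≤ 1 := hsplit ▸ le_add_self
  have hpg : ∫⁻ u in G, r u ∂μ ≤ ENNReal.ofReal T * μ G := by
    rw [← setLIntegral_const]
    exact setLIntegral_mono measurable_const hrT
  have hpf := ne_top_of_le_ne_top ENNReal.one_ne_top hp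
  have hqf := ne_top_of_le_ne_top ENNReal.one_ne_top hq
  have hcompl : μ Gᶜ = ENNReal.ofReal (1 - (μ G).toReal) := by
    rw [prob_compl_eq_one_sub hG, ENNReal.ofReal_sub _ ENNReal.toReal_nonneg, ENNReal.ofReal_toReal (measure_ne_top _ _)]; simp
  have hg1 : (μ G).toReal ≤ 1 := by
    have := ENNReal.toReal_mono ENNReal.one_ne_top (prob_le_one (μ := μ) (s := G)); simpa using this
  have hq' : ∫⁻ u in Gᶜ, r u ∂μ = ENNReal.ofReal (1 - (∫⁻ u in G, r u ∂μ).toReal) := by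
    rw [← ENNReal.ofReal_toReal hqf]; congr 1
    have := congrArg ENNReal.toReal hsplit
    rw [ENNReal.toReal_add hpf hqf] at this
    simp at this; linarith
  have hp1 : (∫⁻ u in G, r u ∂μ).toReal ≤ 1 := by
    have := ENNReal.toReal_mono ENNReal.one_ne_top hp; simpa using this
  rw [hq', hcompl, ← ENNReal.ofReal_pow (by linarith), ← ENNReal.ofReal_add (by linarith) (Real.exp_pos _).le]
  apply ENNReal.ofReal_le_ofReal
  refine cover_real _ _ _ _ ENNReal.toReal_nonneg hg1 ENNReal.toReal_nonneg hp1 ?_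
  have h := ENNReal.toReal_mono (ENNReal.mul_ne_top ENNReal.ofReal_ne_top (measure_ne_top _ _)) hpg
  rw [ENNReal.toReal_mul, ENNReal.toReal_ofReal hT.le] at h
  rw [div_mul_eq_mul_div, div_le_iff₀ hT]
  nlinarith [Nat.cast_nonneg (α := ℝ) L]

section oneshot
variable {X : Type*} [MeasurableSpace X]

/-- ideal single-user error terms -/
def osA (μ : Measure X) (Y1 Y2 : X → X → X → X) (q1 q2 : X → X → ℝ≥0∞) (B : Set (X × X))
    (t1 t2 : ℝ≥0∞) (s u : X) : ℝ≥0∞ :=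
  B.indicator 1 (s, u) + μ {z | q1 s (Y1 s u z) < t1} + μ {z | q2 u (Y2 s u z) < t2}

/-- confusion probability -/
def osK (μ : Measure X) (Y : X → X → X → X) (q : X → X → ℝ≥0∞) (t : ℝ≥0∞) (x s u : X) : ℝ≥0∞ :=
  μ {z | t ≤ q x (Y s u z)}

/-- total error bound for a message pair when `u` is used -/
def osErr (μ : Measure X) (Y1 Y2 : X → X → X → X) (q1 q2 : X → X → ℝ≥0∞) (B : Set (X × X))
    (t1 t2 : ℝ≥0∞) {M1 M2 L : ℕ} (w1 : Fin M1) (w2 : Fin M2) (S : Fin M1 → X)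
    (U : Fin M2 → Fin L → X) (u : X) : ℝ≥0∞ :=
  osA μ Y1 Y2 q1 q2 B t1 t2 (S w1) u
    + ∑ w ∈ Finset.univ.erase w1, osK μ Y1 q1 t1 (S w) (S w1) u
    + ∑ w ∈ Finset.univ.erase w2, ∑ l, osK μ Y2 q2 t2 (U w l) (S w1) u

lemma measurable_osK (μ : Measure X) [IsProbabilityMeasure μ] (Y : X → X → X → X) (q : X → X → ℝ≥0∞)
    (t : ℝ≥0∞) (hY : Measurable fun p : X × X × X => Y p.1 p.2.1 p.2.2)
    (hq : Measurable fun p : X × X => q p.1 p.2) :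
    Measurable fun p : X × X × X => osK μ Y q t p.1 p.2.1 p.2.2 := by
  unfold osK
  have hs : MeasurableSet {p : (X × X × X) × X | t ≤ q p.1.1 (Y p.1.2.1 p.1.2.2 p.2)} := by
    refine measurableSet_le measurable_const ?_
    exact hq.comp (f := fun p : (X × X × X) × X => (p.1.1, Y p.1.2.1 p.1.2.2 p.2))
      (measurable_fst.fst.prodMk
        (hY.comp (f := fun p : (X × X × X) × X => (p.1.2.1, p.1.2.2, p.2)) (by fun_prop)))
  exact measurable_measure_prodMk_left hs

lemma measurable_osA (μ : Measure X) [IsProbabilityMeasure μ] (Y1 Y2 : X → X → X → X) (q1 q2 : X → X → ℝ≥0∞)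
    (B : Set (X × X)) (t1 t2 : ℝ≥0∞) (hY1 : Measurable fun p : X × X × X => Y1 p.1 p.2.1 p.2.2)
    (hY2 : Measurable fun p : X × X × X => Y2 p.1 p.2.1 p.2.2)
    (hq1 : Measurable fun p : X × X => q1 p.1 p.2) (hq2 : Measurable fun p : X × X => q2 p.1 p.2)
    (hB : MeasurableSet B) :
    Measurable fun p : X × X => osA μ Y1 Y2 q1 q2 B t1 t2 p.1 p.2 := by
  unfold osA
  refine ((measurable_one.indicator hB).add ?_).add ?_
  · have hs : MeasurableSet {p : (X × X) × X | q1 p.1.1 (Y1 p.1.1 p.1.2 p.2) < t1} := by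
      refine measurableSet_lt ?_ measurable_const
      exact hq1.comp (f := fun p : (X × X) × X => (p.1.1, Y1 p.1.1 p.1.2 p.2))
        (measurable_fst.fst.prodMk
          (hY1.comp (f := fun p : (X × X) × X => (p.1.1, p.1.2, p.2)) (by fun_prop)))
    exact measurable_measure_prodMk_left hs
  · have hs : MeasurableSet {p : (X × X) × X | q2 p.1.2 (Y2 p.1.1 p.1.2 p.2) < t2} := by
      refine measurableSet_lt ?_ measurable_const
      exact hq2.comp (f := fun p : (X × X) × X => (p.1.2, Y2 p.1.1 p.1.2 p.2))
        (measurable_fst.snd.prodMk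
          (hY2.comp (f := fun p : (X × X) × X => (p.1.1, p.1.2, p.2)) (by fun_prop)))
    exact measurable_measure_prodMk_left hs

lemma osK_lintegral (μ : Measure X) [IsProbabilityMeasure μ] (Y : X → X → X → X) (q : X → X → ℝ≥0∞)
    (t : ℝ≥0∞) (ht0 : t ≠ 0) (ht : t ≠ ∞) (hY : Measurable fun p : X × X × X => Y p.1 p.2.1 p.2.2)
    (hq : Measurable fun p : X × X => q p.1 p.2) (hq1 : ∀ y, ∫⁻ x, q x y ∂μ ≤ 1) (s u : X) :
    ∫⁻ x, osK μ Y q t x s u ∂μ ≤ t⁻¹ := by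
  unfold osK
  have hYz : Measurable fun z => Y s u z := hY.comp (f := fun z => (s, u, z)) (by fun_prop)
  have hqz : Measurable fun p : X × X => q p.1 (Y s u p.2) :=
    hq.comp (f := fun p : X × X => (p.1, Y s u p.2)) (by fun_prop)
  calc ∫⁻ x, μ {z | t ≤ q x (Y s u z)} ∂μ ≤ ∫⁻ x, ∫⁻ z, t⁻¹ * q x (Y s u z) ∂μ ∂μ := by
        refine lintegral_mono fun x => ?_
        have hm : Measurable fun z => q x (Y s u z) := hqz.comp (f := fun z => (x, z)) (by fun_prop)
        rw [lintegral_const_mul _ hm]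
        have := meas_ge_le_lintegral_div (μ := μ) hm.aemeasurable ht0 ht
        rwa [ENNReal.div_eq_inv_mul] at this
    _ = ∫⁻ z, ∫⁻ x, t⁻¹ * q x (Y s u z) ∂μ ∂μ := by
        rw [lintegral_lintegral_swap]
        exact (hqz.const_mul _).aemeasurable
    _ ≤ ∫⁻ z, t⁻¹ ∂μ := by
        refine lintegral_mono fun z => ?_
        have hm : Measurable fun x => q x (Y s u z) := hqz.comp (f := fun x => (x, z)) (by fun_prop)
        dsimp only
        rw [lintegral_const_mul _ hm]
        calc _ ≤ t⁻¹ * 1 := by gcongr; exact hq1 _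
          _ = _ := mul_one _
    _ = t⁻¹ := by simp

end oneshot
end
end

section
open scoped BigOperators ENNReal
open MeasureTheory ProbabilityTheory
noncomputable section
section oneshot
variable {X : Type*} [MeasurableSpace X]

lemma measurable_osErr (μ : Measure X) [IsProbabilityMeasure μ] (Y1 Y2 : X → X → X → X) (q1 q2 : X → X → ℝ≥0∞)
    (B : Set (X × X)) (t1 t2 : ℝ≥0∞) (hY1 : Measurable fun p : X × X × X => Y1 p.1 p.2.1 p.2.2)
    (hY2 : Measurable fun p : X × X × X => Y2 p.1 p.2.1 p.2.2)
    (hq1 : Measurable fun p : X × X => q1 p.1 p.2) (hq2 : Measurable fun p : X × X => q2 p.1 p.2)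
    (hB : MeasurableSet B) {M1 M2 L : ℕ} (w1 : Fin M1) (w2 : Fin M2) :
    Measurable fun p : (Fin M1 → X) × (Fin M2 → Fin L → X) × X =>
      osErr μ Y1 Y2 q1 q2 B t1 t2 w1 w2 p.1 p.2.1 p.2.2 := by
  unfold osErr
  refine (Measurable.add ?_ ?_).add ?_
  · exact (measurable_osA μ Y1 Y2 q1 q2 B t1 t2 hY1 hY2 hq1 hq2 hB).comp
      (f := fun p : (Fin M1 → X) × (Fin M2 → Fin L → X) × X => (p.1 w1, p.2.2)) (by fun_prop)
  · refine Finset.measurable_sum _ fun w _ => ?_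
    exact (measurable_osK μ Y1 q1 t1 hY1 hq1).comp
      (f := fun p : (Fin M1 → X) × (Fin M2 → Fin L → X) × X => (p.1 w, p.1 w1, p.2.2)) (by fun_prop)
  · refine Finset.measurable_sum _ fun w _ => Finset.measurable_sum _ fun l _ => ?_
    exact (measurable_osK μ Y2 q2 t2 hY2 hq2).comp
      (f := fun p : (Fin M1 → X) × (Fin M2 → Fin L → X) × X => (p.2.1 w l, p.1 w1, p.2.2)) (by fun_prop)

/-- total bound of the one-shot lemma -/
def osTot (μ : Measure X) (Y1 Y2 : X → X → X → X) (q1 q2 r : X → X → ℝ≥0∞) (B : Set (X × X))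
    (t1 t2 δ : ℝ≥0∞) (T : ℝ) (M1 M2 L : ℕ) : ℝ≥0∞ :=
  (∫⁻ s, ∫⁻ u, r u s * ({p : X × X | ENNReal.ofReal T < r p.2 p.1}.indicator 1 (s, u)
    + δ⁻¹ * osA μ Y1 Y2 q1 q2 B t1 t2 s u) ∂μ ∂μ)
    + δ⁻¹ * (((M1 - 1 : ℕ) : ℝ≥0∞) * t1⁻¹ + ((M2 - 1 : ℕ) : ℝ≥0∞) * (L * t2⁻¹))
    + ENNReal.ofReal (Real.exp (-(L / T)))

lemma os_bad (μ : Measure X) [IsProbabilityMeasure μ] (Y1 Y2 : X → X → X → X) (q1 q2 r : X → X → ℝ≥0∞)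
    (B : Set (X × X)) (t1 t2 δ : ℝ≥0∞) (T : ℝ) (hY1 : Measurable fun p : X × X × X => Y1 p.1 p.2.1 p.2.2)
    (hY2 : Measurable fun p : X × X × X => Y2 p.1 p.2.1 p.2.2)
    (hq1 : Measurable fun p : X × X => q1 p.1 p.2) (hq2 : Measurable fun p : X × X => q2 p.1 p.2)
    (hr : Measurable fun p : X × X => r p.1 p.2)
    (hB : MeasurableSet B) (ht1 : t1 ≠ 0) (ht1' : t1 ≠ ∞) (ht2 : t2 ≠ 0) (ht2' : t2 ≠ ∞)
    (hδ : δ ≠ 0) (hδ' : δ ≠ ∞) (hT : 0 < T)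
    (iq1 : ∀ y, ∫⁻ x, q1 x y ∂μ ≤ 1) (iq2 : ∀ y, ∫⁻ x, q2 x y ∂μ ≤ 1) (ir : ∀ s, ∫⁻ u, r u s ∂μ = 1)
    {M1 M2 L : ℕ} (w1 : Fin M1) (w2 : Fin M2) :
    ∫⁻ S, ∫⁻ U, {p : (Fin M1 → X) × (Fin M2 → Fin L → X) | ∀ l, ¬ (r (p.2 w2 l) (p.1 w1) ≤ ENNReal.ofReal T ∧
        osErr μ Y1 Y2 q1 q2 B t1 t2 w1 w2 p.1 p.2 (p.2 w2 l) ≤ δ)}.indicator 1 (S, U)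
        ∂(Measure.pi fun _ : Fin M2 => Measure.pi fun _ : Fin L => μ) ∂(Measure.pi fun _ : Fin M1 => μ)
      ≤ osTot μ Y1 Y2 q1 q2 r B t1 t2 δ T M1 M2 L := by
  set πL := Measure.pi fun _ : Fin L => μ with hπL
  set πU := Measure.pi fun _ : Fin M2 => πL with hπU
  set πS := Measure.pi fun _ : Fin M1 => μ with hπS
  have mErr := measurable_osErr μ Y1 Y2 q1 q2 B t1 t2 hY1 hY2 hq1 hq2 hB (L := L) w1 w2
  have mA := measurable_osA μ Y1 Y2 q1 q2 B t1 t2 hY1 hY2 hq1 hq2 hB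
  have mK1 := measurable_osK μ Y1 q1 t1 hY1 hq1
  have mK2 := measurable_osK μ Y2 q2 t2 hY2 hq2
  have mG : MeasurableSet {p : (Fin M1 → X) × (Fin M2 → Fin L → X) × X |
      r p.2.2 (p.1 w1) ≤ ENNReal.ofReal T ∧ osErr μ Y1 Y2 q1 q2 B t1 t2 w1 w2 p.1 p.2.1 p.2.2 ≤ δ} := by
    have e1 : Measurable fun p : (Fin M1 → X) × (Fin M2 → Fin L → X) × X => r p.2.2 (p.1 w1) :=
      hr.comp (f := fun p : (Fin M1 → X) × (Fin M2 → Fin L → X) × X => (p.2.2, p.1 w1)) (by fun_prop)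
    have e2 := (measurableSet_le e1 (measurable_const (a := ENNReal.ofReal T))).inter
      (measurableSet_le mErr (measurable_const (a := δ)))
    exact e2
  have mI : MeasurableSet {p : X × X | ENNReal.ofReal T < r p.2 p.1} :=
    measurableSet_lt measurable_const (hr.comp measurable_swap)
  have mbad : MeasurableSet {p : (Fin M1 → X) × (Fin M2 → Fin L → X) | ∀ l, ¬ (r (p.2 w2 l) (p.1 w1) ≤ ENNReal.ofReal T ∧
        osErr μ Y1 Y2 q1 q2 B t1 t2 w1 w2 p.1 p.2 (p.2 w2 l) ≤ δ)} := by
    rw [Set.ofPred_forall]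
    refine MeasurableSet.iInter fun l => ?_
    have : Measurable fun p : (Fin M1 → X) × (Fin M2 → Fin L → X) => (p.1, p.2, p.2 w2 l) := by fun_prop
    exact (this mG).compl
  -- step 1 : inner covering bound
  have step1 : ∀ S, ∫⁻ U, {p : (Fin M1 → X) × (Fin M2 → Fin L → X) | ∀ l, ¬ (r (p.2 w2 l) (p.1 w1) ≤ ENNReal.ofReal T ∧
        osErr μ Y1 Y2 q1 q2 B t1 t2 w1 w2 p.1 p.2 (p.2 w2 l) ≤ δ)}.indicator 1 (S, U) ∂πU
      ≤ ∫⁻ U, ((∫⁻ u, r u (S w1) * ({p : X × X | ENNReal.ofReal T < r p.2 p.1}.indicator 1 (S w1, u)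
          + δ⁻¹ * osErr μ Y1 Y2 q1 q2 B t1 t2 w1 w2 S U u) ∂μ) + ENNReal.ofReal (Real.exp (-(L / T)))) ∂πU := by
    intro S
    have mfS : Measurable (fun U : Fin M2 → Fin L → X => {p : (Fin M1 → X) × (Fin M2 → Fin L → X) | ∀ l, ¬ (r (p.2 w2 l) (p.1 w1) ≤ ENNReal.ofReal T ∧
        osErr μ Y1 Y2 q1 q2 B t1 t2 w1 w2 p.1 p.2 (p.2 w2 l) ≤ δ)}.indicator
        (1 : (Fin M1 → X) × (Fin M2 → Fin L → X) → ℝ≥0∞) (S, U)) :=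
      (measurable_one.indicator mbad).comp (f := fun U : Fin M2 → Fin L → X => (S, U)) (by fun_prop)
    have hres := lintegral_resample (fun _ : Fin M2 => πL) _ mfS w2
    rw [← hπU] at hres
    rw [hres]
    refine lintegral_mono fun U => ?_
    set G : Set X := {u | r u (S w1) ≤ ENNReal.ofReal T ∧ osErr μ Y1 Y2 q1 q2 B t1 t2 w1 w2 S U u ≤ δ} with hG
    have mG' : MeasurableSet G := by
      have : Measurable fun u : X => (S, U, u) := by fun_prop
      exact this mG
    have hup : ∀ x u, osErr μ Y1 Y2 q1 q2 B t1 t2 w1 w2 S (Function.update U w2 x) u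
        = osErr μ Y1 Y2 q1 q2 B t1 t2 w1 w2 S U u := by
      intro x u
      unfold osErr
      congr 1
      refine Finset.sum_congr rfl fun w hw => ?_
      rw [Function.update_of_ne (Finset.ne_of_mem_erase hw)]
    have h1 : ∀ x : Fin L → X, {p : (Fin M1 → X) × (Fin M2 → Fin L → X) | ∀ l, ¬ (r (p.2 w2 l) (p.1 w1) ≤ ENNReal.ofReal T ∧
        osErr μ Y1 Y2 q1 q2 B t1 t2 w1 w2 p.1 p.2 (p.2 w2 l) ≤ δ)}.indicator (1 : (Fin M1 → X) × (Fin M2 → Fin L → X) → ℝ≥0∞) (S, Function.update U w2 x)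
        = (Set.univ.pi fun _ : Fin L => Gᶜ).indicator 1 x := by
      intro x
      by_cases hx : x ∈ (Set.univ.pi fun _ : Fin L => Gᶜ)
      · rw [Set.indicator_of_mem hx, Set.indicator_of_mem]; · rfl
        intro l
        simp only [Function.update_self, hup]
        exact hx l trivial
      · rw [Set.indicator_of_notMem hx, Set.indicator_of_notMem]
        intro h; apply hx; intro l _
        have := h l
        simp only [Function.update_self, hup] at this
        exact this
    simp_rw [h1]
    rw [lintegral_indicator_one (MeasurableSet.univ_pi fun _ => mG'.compl), hπL, Measure.pi_pi]
    simp only [Finset.prod_const, Finset.card_univ, Fintype.card_fin]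
    refine (cover_meas μ (fun u => r u (S w1)) (ir _) G mG' T hT (fun u hu => hu.1) L).trans ?_
    refine add_le_add ?_ le_rfl
    rw [← lintegral_indicator mG'.compl]
    refine lintegral_mono fun u => ?_
    by_cases hu : u ∈ G
    · rw [Set.indicator_of_notMem (by simpa using hu)]; exact bot_le
    · rw [Set.indicator_of_mem (by simpa using hu)]
      conv_lhs => rw [← mul_one (r u (S w1))]
      gcongr
      by_cases hT' : ENNReal.ofReal T < r u (S w1)
      · rw [Set.indicator_of_mem (by exact hT')]; exact le_self_add
      · have : δ < osErr μ Y1 Y2 q1 q2 B t1 t2 w1 w2 S U u := by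
          by_contra hc; exact hu ⟨not_lt.1 hT', not_lt.1 hc⟩
        refine le_add_left ?_
        calc (1:ℝ≥0∞) = δ⁻¹ * δ := (ENNReal.inv_mul_cancel hδ hδ').symm
          _ ≤ _ := by gcongr
  refine (lintegral_mono step1).trans ?_
  -- step 2: expand
  have mr1 : Measurable fun p : (Fin M1 → X) × (Fin M2 → Fin L → X) × X => r p.2.2 (p.1 w1) :=
    hr.comp (f := fun p : (Fin M1 → X) × (Fin M2 → Fin L → X) × X => (p.2.2, p.1 w1)) (by fun_prop)
  have hspl : ∀ (S : Fin M1 → X) (U : Fin M2 → Fin L → X), (∫⁻ u, r u (S w1) * ({p : X × X | ENNReal.ofReal T < r p.2 p.1}.indicator 1 (S w1, u)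
          + δ⁻¹ * osErr μ Y1 Y2 q1 q2 B t1 t2 w1 w2 S U u) ∂μ)
      = (∫⁻ u, r u (S w1) * ({p : X × X | ENNReal.ofReal T < r p.2 p.1}.indicator 1 (S w1, u)
          + δ⁻¹ * osA μ Y1 Y2 q1 q2 B t1 t2 (S w1) u) ∂μ)
        + δ⁻¹ * (∑ w ∈ Finset.univ.erase w1, (∫⁻ u, r u (S w1) * osK μ Y1 q1 t1 (S w) (S w1) u ∂μ)
        + ∑ w ∈ Finset.univ.erase w2, ∑ l, ∫⁻ u, r u (S w1) * osK μ Y2 q2 t2 (U w l) (S w1) u ∂μ) := by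
    intro S U
    have mr : Measurable fun u => r u (S w1) := hr.comp (f := fun u => (u, S w1)) (by fun_prop)
    have m1 : ∀ s s' , Measurable fun u => osK μ Y1 q1 t1 s s' u := fun s s' =>
      mK1.comp (f := fun u => (s, s', u)) (by fun_prop)
    have m2 : ∀ s s' , Measurable fun u => osK μ Y2 q2 t2 s s' u := fun s s' =>
      mK2.comp (f := fun u => (s, s', u)) (by fun_prop)
    have n1 : ∀ w, Measurable fun u => r u (S w1) * osK μ Y1 q1 t1 (S w) (S w1) u := fun w => mr.mul (m1 _ _)
    have n2 : ∀ w l, Measurable fun u => r u (S w1) * osK μ Y2 q2 t2 (U w l) (S w1) u := fun w l => mr.mul (m2 _ _)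
    have n3 : Measurable fun u => ∑ w ∈ Finset.univ.erase w1, r u (S w1) * osK μ Y1 q1 t1 (S w) (S w1) u :=
      Finset.measurable_sum _ fun w _ => n1 w
    have n4 : ∀ w, Measurable fun u => ∑ l, r u (S w1) * osK μ Y2 q2 t2 (U w l) (S w1) u := fun w =>
      Finset.measurable_sum _ fun l _ => n2 w l
    have n5 : Measurable fun u => ∑ w ∈ Finset.univ.erase w2, ∑ l, r u (S w1) * osK μ Y2 q2 t2 (U w l) (S w1) u :=
      Finset.measurable_sum _ fun w _ => n4 w
    have n6 : Measurable fun u => r u (S w1) * ({p : X × X | ENNReal.ofReal T < r p.2 p.1}.indicator 1 (S w1, u)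
          + δ⁻¹ * osA μ Y1 Y2 q1 q2 B t1 t2 (S w1) u) := by
      refine mr.mul (Measurable.add ?_ (Measurable.const_mul ?_ _))
      · exact (measurable_one.indicator mI).comp (g := ({p : X × X | ENNReal.ofReal T < r p.2 p.1}.indicator 1)) (f := fun u => (S w1, u)) (by fun_prop)
      · exact mA.comp (f := fun u => (S w1, u)) (by fun_prop)
    have n7 : Measurable fun u => (∑ w ∈ Finset.univ.erase w1, r u (S w1) * osK μ Y1 q1 t1 (S w) (S w1) u) +
        ∑ w ∈ Finset.univ.erase w2, ∑ l, r u (S w1) * osK μ Y2 q2 t2 (U w l) (S w1) u := n3.add n5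
    calc _ = ∫⁻ u, (r u (S w1) * ({p : X × X | ENNReal.ofReal T < r p.2 p.1}.indicator 1 (S w1, u)
          + δ⁻¹ * osA μ Y1 Y2 q1 q2 B t1 t2 (S w1) u) + δ⁻¹ * ((∑ w ∈ Finset.univ.erase w1, r u (S w1) * osK μ Y1 q1 t1 (S w) (S w1) u) +
        ∑ w ∈ Finset.univ.erase w2, ∑ l, r u (S w1) * osK μ Y2 q2 t2 (U w l) (S w1) u)) ∂μ := by
          refine lintegral_congr fun u => ?_
          unfold osErr
          simp_rw [← Finset.mul_sum]
          ring
      _ = _ := by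
          rw [lintegral_add_left n6, lintegral_const_mul _ n7, lintegral_add_left n3,
            lintegral_finsetSum _ (fun w _ => n1 w), lintegral_finsetSum _ (fun w _ => n4 w)]
          congr 3
          refine Finset.sum_congr rfl fun w _ => ?_
          rw [lintegral_finsetSum _ (fun l _ => n2 w l)]
  simp_rw [hspl]
  have mr3 : Measurable fun p : ((Fin M1 → X) × (Fin M2 → Fin L → X)) × X => r p.2 (p.1.1 w1) :=
    hr.comp (f := fun p : ((Fin M1 → X) × (Fin M2 → Fin L → X)) × X => (p.2, p.1.1 w1)) (by fun_prop)
  -- measurability of pieces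
  set F0 : X → ℝ≥0∞ := fun s => ∫⁻ u, r u s * ({p : X × X | ENNReal.ofReal T < r p.2 p.1}.indicator 1 (s, u)
          + δ⁻¹ * osA μ Y1 Y2 q1 q2 B t1 t2 s u) ∂μ with hF0
  have mF0 : Measurable F0 := by
    refine Measurable.lintegral_prod_right ?_
    refine (hr.comp measurable_swap).mul (Measurable.add ?_ (Measurable.const_mul ?_ _))
    · exact measurable_one.indicator mI
    · exact mA
  set F1 : X → X → ℝ≥0∞ := fun x s => ∫⁻ u, r u s * osK μ Y1 q1 t1 x s u ∂μ with hF1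
  set F2 : X → X → ℝ≥0∞ := fun x s => ∫⁻ u, r u s * osK μ Y2 q2 t2 x s u ∂μ with hF2
  have mF1 : Measurable fun p : X × X => F1 p.1 p.2 := by
    refine Measurable.lintegral_prod_right' (f := fun q : (X × X) × X => r q.2 q.1.2 * osK μ Y1 q1 t1 q.1.1 q.1.2 q.2) ?_
    refine (hr.comp (f := fun q : (X × X) × X => (q.2, q.1.2)) (by fun_prop)).mul ?_
    exact mK1.comp (f := fun q : (X × X) × X => (q.1.1, q.1.2, q.2)) (by fun_prop)
  have mF2 : Measurable fun p : X × X => F2 p.1 p.2 := by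
    refine Measurable.lintegral_prod_right' (f := fun q : (X × X) × X => r q.2 q.1.2 * osK μ Y2 q2 t2 q.1.1 q.1.2 q.2) ?_
    refine (hr.comp (f := fun q : (X × X) × X => (q.2, q.1.2)) (by fun_prop)).mul ?_
    exact mK2.comp (f := fun q : (X × X) × X => (q.1.1, q.1.2, q.2)) (by fun_prop)
  have iF : ∀ (Y : X → X → X → X) (q : X → X → ℝ≥0∞) (t : ℝ≥0∞), t ≠ 0 → t ≠ ∞ →
      (Measurable fun p : X × X × X => Y p.1 p.2.1 p.2.2) → (Measurable fun p : X × X => q p.1 p.2) →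
      (∀ y, ∫⁻ x, q x y ∂μ ≤ 1) → ∀ s, ∫⁻ x, ∫⁻ u, r u s * osK μ Y q t x s u ∂μ ∂μ ≤ t⁻¹ := by
    intro Y q t h0 ht hY hq hi s
    have mK := measurable_osK μ Y q t hY hq
    have mr : Measurable fun u => r u s := hr.comp (f := fun u => (u, s)) (by fun_prop)
    rw [lintegral_lintegral_swap]
    · calc ∫⁻ u, ∫⁻ x, r u s * osK μ Y q t x s u ∂μ ∂μ ≤ ∫⁻ u, r u s * t⁻¹ ∂μ := by
            refine lintegral_mono fun u => ?_
            dsimp only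
            have mKx : Measurable fun x => osK μ Y q t x s u := mK.comp (f := fun x => (x, s, u)) (by fun_prop)
            rw [lintegral_const_mul _ mKx]
            gcongr
            exact osK_lintegral μ Y q t h0 ht hY hq hi s u
        _ = t⁻¹ := by rw [lintegral_mul_const _ mr, ir, one_mul]
    · exact ((mr.comp measurable_snd).mul (mK.comp (f := fun q : X × X => (q.1, s, q.2)) (by fun_prop))).aemeasurable
  -- inner integral over U
  have inner : ∀ S : Fin M1 → X, ∫⁻ U, (F0 (S w1) + δ⁻¹ * (∑ w ∈ Finset.univ.erase w1, F1 (S w) (S w1)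
        + ∑ w ∈ Finset.univ.erase w2, ∑ l, F2 (U w l) (S w1)) + ENNReal.ofReal (Real.exp (-(L / T)))) ∂πU
      ≤ F0 (S w1) + δ⁻¹ * (∑ w ∈ Finset.univ.erase w1, F1 (S w) (S w1)
        + ((M2 - 1 : ℕ) : ℝ≥0∞) * (L * t2⁻¹)) + ENNReal.ofReal (Real.exp (-(L / T))) := by
    intro S
    have m2 : Measurable fun x => F2 x (S w1) := mF2.comp (f := fun x => (x, S w1)) (by fun_prop)
    have m3 : ∀ w l, Measurable fun U : Fin M2 → Fin L → X => F2 (U w l) (S w1) := fun w l =>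
      m2.comp (f := fun U : Fin M2 → Fin L → X => U w l) (by fun_prop)
    have m4 : Measurable fun U : Fin M2 → Fin L → X => ∑ w ∈ Finset.univ.erase w2, ∑ l, F2 (U w l) (S w1) :=
      Finset.measurable_sum _ fun w _ => Finset.measurable_sum _ fun l _ => m3 w l
    have m5 : Measurable fun U : Fin M2 → Fin L → X => ∑ w ∈ Finset.univ.erase w1, F1 (S w) (S w1)
        + ∑ w ∈ Finset.univ.erase w2, ∑ l, F2 (U w l) (S w1) := measurable_const.add m4
    rw [lintegral_add_right _ measurable_const, lintegral_add_left measurable_const,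
      lintegral_const_mul _ m5, lintegral_add_left measurable_const,
      lintegral_finsetSum _ (fun w _ => Finset.measurable_sum _ fun l _ => m3 w l)]
    simp_rw [lintegral_finsetSum _ (fun l _ => m3 _ l)]
    simp only [lintegral_const, measure_univ, mul_one]
    gcongr
    calc _ ≤ ∑ w ∈ Finset.univ.erase w2, ∑ l : Fin L, t2⁻¹ := by
          refine Finset.sum_le_sum fun w _ => Finset.sum_le_sum fun l _ => ?_
          have e1 := (measurePreserving_eval (fun _ : Fin L => μ) l).comp (measurePreserving_eval (fun _ : Fin M2 => πL) w)
          have := e1.lintegral_comp m2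
          simp only [Function.comp_def, Function.eval] at this
          rw [this]
          exact iF Y2 q2 t2 ht2 ht2' hY2 hq2 iq2 (S w1)
      _ = _ := by simp
  refine (lintegral_mono inner).trans ?_
  have m1 : ∀ w, Measurable fun S : Fin M1 → X => F1 (S w) (S w1) := fun w =>
      mF1.comp (f := fun S : Fin M1 → X => (S w, S w1)) (by fun_prop)
  have m4 : Measurable fun S : Fin M1 → X => ∑ w ∈ Finset.univ.erase w1, F1 (S w) (S w1) :=
      Finset.measurable_sum _ fun w _ => m1 w
  have m5 : Measurable fun S : Fin M1 → X => ∑ w ∈ Finset.univ.erase w1, F1 (S w) (S w1)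
        + ((M2 - 1 : ℕ) : ℝ≥0∞) * (L * t2⁻¹) := m4.add measurable_const
  have m6 : Measurable fun S : Fin M1 → X => δ⁻¹ * (∑ w ∈ Finset.univ.erase w1, F1 (S w) (S w1)
        + ((M2 - 1 : ℕ) : ℝ≥0∞) * (L * t2⁻¹)) := m5.const_mul _
  rw [lintegral_add_right _ measurable_const, lintegral_add_right _ m6,
      lintegral_const_mul _ m5, lintegral_add_right _ measurable_const,
      lintegral_finsetSum _ (fun w _ => m1 w)]
  simp only [lintegral_const, measure_univ, mul_one]
  unfold osTot
  gcongr
  · have := (measurePreserving_eval (fun _ : Fin M1 => μ) w1).lintegral_comp mF0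
    exact this.le
  · calc _ ≤ ∑ w ∈ Finset.univ.erase w1, t1⁻¹ := by
          refine Finset.sum_le_sum fun w hw => ?_
          rw [lintegral_resample _ _ (m1 w) w]
          calc _ ≤ ∫⁻ S : Fin M1 → X, t1⁻¹ ∂πS := by
                refine lintegral_mono fun S => ?_
                simp only [Function.update_self, Function.update_of_ne (Finset.ne_of_mem_erase hw).symm]
                exact iF Y1 q1 t1 ht1 ht1' hY1 hq1 iq1 (S w1)
            _ = t1⁻¹ := by simp
      _ = _ := by simp

lemma os_main (μ : Measure X) [IsProbabilityMeasure μ] (Y1 Y2 : X → X → X → X) (q1 q2 r : X → X → ℝ≥0∞)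
    (B : Set (X × X)) (t1 t2 δ : ℝ≥0∞) (T : ℝ) (hY1 : Measurable fun p : X × X × X => Y1 p.1 p.2.1 p.2.2)
    (hY2 : Measurable fun p : X × X × X => Y2 p.1 p.2.1 p.2.2)
    (hq1 : Measurable fun p : X × X => q1 p.1 p.2) (hq2 : Measurable fun p : X × X => q2 p.1 p.2)
    (hr : Measurable fun p : X × X => r p.1 p.2)
    (hB : MeasurableSet B) (ht1 : t1 ≠ 0) (ht1' : t1 ≠ ∞) (ht2 : t2 ≠ 0) (ht2' : t2 ≠ ∞)
    (hδ : δ ≠ 0) (hδ' : δ ≠ ∞) (hT : 0 < T)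
    (iq1 : ∀ y, ∫⁻ x, q1 x y ∂μ ≤ 1) (iq2 : ∀ y, ∫⁻ x, q2 x y ∂μ ≤ 1) (ir : ∀ s, ∫⁻ u, r u s ∂μ = 1)
    (M1 M2 L : ℕ) :
    ∃ (S : Fin M1 → X) (U : Fin M2 → Fin L → X),
      ∑ w1, ∑ w2, {p : Fin M1 × Fin M2 | ¬ ∃ l,
        osErr μ Y1 Y2 q1 q2 B t1 t2 p.1 p.2 S U (U p.2 l) ≤ δ}.indicator (1 : Fin M1 × Fin M2 → ℝ≥0∞) (w1, w2)
      ≤ M1 * M2 * osTot μ Y1 Y2 q1 q2 r B t1 t2 δ T M1 M2 L := by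
  set πL := Measure.pi fun _ : Fin L => μ with hπL
  set πU := Measure.pi fun _ : Fin M2 => πL with hπU
  set πS := Measure.pi fun _ : Fin M1 => μ with hπS
  have mErr := fun w1 w2 => measurable_osErr μ Y1 Y2 q1 q2 B t1 t2 hY1 hY2 hq1 hq2 hB (L := L) (M1 := M1) (M2 := M2) w1 w2
  have mbad : ∀ w1 w2, MeasurableSet {p : (Fin M1 → X) × (Fin M2 → Fin L → X) | ∀ l, ¬ (r (p.2 w2 l) (p.1 w1) ≤ ENNReal.ofReal T ∧
        osErr μ Y1 Y2 q1 q2 B t1 t2 w1 w2 p.1 p.2 (p.2 w2 l) ≤ δ)} := by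
    intro w1 w2
    rw [Set.ofPred_forall]
    refine MeasurableSet.iInter fun l => ?_
    have e1 : Measurable fun p : (Fin M1 → X) × (Fin M2 → Fin L → X) => r (p.2 w2 l) (p.1 w1) :=
      hr.comp (f := fun p : (Fin M1 → X) × (Fin M2 → Fin L → X) => (p.2 w2 l, p.1 w1)) (by fun_prop)
    have e2 : Measurable fun p : (Fin M1 → X) × (Fin M2 → Fin L → X) =>
        osErr μ Y1 Y2 q1 q2 B t1 t2 w1 w2 p.1 p.2 (p.2 w2 l) :=
      (mErr w1 w2).comp (f := fun p : (Fin M1 → X) × (Fin M2 → Fin L → X) => (p.1, p.2, p.2 w2 l)) (by fun_prop)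
    have e3 := ((measurableSet_le e1 (measurable_const (a := ENNReal.ofReal T))).inter
      (measurableSet_le e2 (measurable_const (a := δ)))).compl
    exact e3
  set f : (Fin M1 → X) × (Fin M2 → Fin L → X) → ℝ≥0∞ := fun p => ∑ w1, ∑ w2,
    {p : (Fin M1 → X) × (Fin M2 → Fin L → X) | ∀ l, ¬ (r (p.2 w2 l) (p.1 w1) ≤ ENNReal.ofReal T ∧
        osErr μ Y1 Y2 q1 q2 B t1 t2 w1 w2 p.1 p.2 (p.2 w2 l) ≤ δ)}.indicator 1 p with hf
  have mf1 : ∀ w1 w2, Measurable ({p : (Fin M1 → X) × (Fin M2 → Fin L → X) | ∀ l, ¬ (r (p.2 w2 l) (p.1 w1) ≤ ENNReal.ofReal T ∧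
        osErr μ Y1 Y2 q1 q2 B t1 t2 w1 w2 p.1 p.2 (p.2 w2 l) ≤ δ)}.indicator (1 : (Fin M1 → X) × (Fin M2 → Fin L → X) → ℝ≥0∞)) :=
    fun w1 w2 => measurable_one.indicator (mbad w1 w2)
  have mf : Measurable f := Finset.measurable_sum _ fun w1 _ => Finset.measurable_sum _ fun w2 _ => mf1 w1 w2
  obtain ⟨⟨S, U⟩, h⟩ := exists_le_lintegral (μ := πS.prod πU) mf.aemeasurable
  refine ⟨S, U, ?_⟩
  have h1 : ∫⁻ p, f p ∂(πS.prod πU) ≤ M1 * M2 * osTot μ Y1 Y2 q1 q2 r B t1 t2 δ T M1 M2 L := by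
    rw [hf, lintegral_finsetSum _ (fun w1 _ => Finset.measurable_sum _ fun w2 _ => mf1 w1 w2)]
    simp_rw [lintegral_finsetSum _ (fun w2 _ => mf1 _ w2)]
    calc _ ≤ ∑ w1 : Fin M1, ∑ w2 : Fin M2, osTot μ Y1 Y2 q1 q2 r B t1 t2 δ T M1 M2 L := by
          refine Finset.sum_le_sum fun w1 _ => Finset.sum_le_sum fun w2 _ => ?_
          rw [lintegral_prod _ (mf1 w1 w2).aemeasurable]
          exact os_bad μ Y1 Y2 q1 q2 r B t1 t2 δ T hY1 hY2 hq1 hq2 hr hB ht1 ht1' ht2 ht2' hδ hδ' hT iq1 iq2 ir w1 w2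
      _ = _ := by simp [mul_assoc]
  refine le_trans ?_ (h.trans h1)
  refine Finset.sum_le_sum fun w1 _ => Finset.sum_le_sum fun w2 _ => ?_
  by_cases hb : ∃ l, osErr μ Y1 Y2 q1 q2 B t1 t2 w1 w2 S U (U w2 l) ≤ δ
  · rw [Set.indicator_of_notMem (by simpa using hb)]; exact bot_le
  · rw [Set.indicator_of_mem (by simpa using hb), Set.indicator_of_mem]; · rfl
    intro l hl; exact hb ⟨l, hl.2⟩

end oneshot
end
end

section
open scoped BigOperators ENNReal
open MeasureTheory ProbabilityTheory
noncomputable section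

lemma os_dec {X : Type*} [MeasurableSpace X] (μ : Measure X) {M L : ℕ} (hM : 0 < M) (q : X → X → ℝ≥0∞) (t : ℝ≥0∞)
    (U : Fin M → Fin L → X) : ∃ g : X → Fin M, ∀ (Y : X → X) (w : Fin M) (l : Fin L),
      μ {z | g (Y z) ≠ w} ≤ μ {z | q (U w l) (Y z) < t} +
        ∑ w' ∈ Finset.univ.erase w, ∑ l', μ {z | t ≤ q (U w' l') (Y z)} := by
  classical
  refine ⟨fun y => if h : ∃ w, ∃ l, t ≤ q (U w l) y then h.choose else ⟨0, hM⟩, fun Y w l => ?_⟩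
  have hsub : {z | (if h : ∃ w, ∃ l, t ≤ q (U w l) (Y z) then h.choose else ⟨0, hM⟩) ≠ w}
      ⊆ {z | q (U w l) (Y z) < t} ∪ ⋃ w' ∈ Finset.univ.erase w, ⋃ l' ∈ (Finset.univ : Finset (Fin L)), {z | t ≤ q (U w' l') (Y z)} := by
    intro z hz
    by_cases h : ∃ w, ∃ l, t ≤ q (U w l) (Y z)
    · simp only [Set.mem_setOf_eq, dif_pos h] at hz
      right
      obtain ⟨l', hl'⟩ := h.choose_spec
      simp only [Set.mem_iUnion]
      exact ⟨h.choose, Finset.mem_erase.2 ⟨hz, Finset.mem_univ _⟩, l', Finset.mem_univ _, hl'⟩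
    · left
      by_contra hc
      exact h ⟨w, l, not_lt.1 hc⟩
  refine (measure_mono hsub).trans ((measure_union_le _ _).trans ?_)
  gcongr
  refine (measure_biUnion_finset_le _ _).trans ?_
  gcongr
  exact measure_biUnion_finset_le _ _

lemma os_avg {M1 M2 : ℕ} (h1 : 0 < M1) (h2 : 0 < M2) (e ind : Fin M1 → Fin M2 → ℝ≥0∞) (δ τ : ℝ≥0∞) (hδ : δ ≠ ∞) (hτ : τ ≠ ∞)
    (he : ∀ w1 w2, e w1 w2 ≤ δ + ind w1 w2) (hi : ∑ w1, ∑ w2, ind w1 w2 ≤ M1 * M2 * τ) :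
    (1 / (M1 * M2) : ℝ) * ∑ w1, ∑ w2, (e w1 w2).toReal ≤ (δ + τ).toReal := by
  have hfin : (M1:ℝ≥0∞) * M2 * τ ≠ ∞ := ENNReal.mul_ne_top (ENNReal.mul_ne_top (by simp) (by simp)) hτ
  have hif : ∀ w1 w2, ind w1 w2 ≠ ∞ := by
    intro w1 w2
    refine ne_top_of_le_ne_top hfin (le_trans ?_ hi)
    exact (Finset.single_le_sum (f := fun w2 => ind w1 w2) (fun _ _ => bot_le) (Finset.mem_univ w2)).trans
      (Finset.single_le_sum (f := fun w1 => ∑ w2, ind w1 w2) (fun _ _ => bot_le) (Finset.mem_univ w1))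
  have hef : ∀ w1 w2, e w1 w2 ≠ ∞ := fun w1 w2 =>
    ne_top_of_le_ne_top (ENNReal.add_ne_top.2 ⟨hδ, hif w1 w2⟩) (he w1 w2)
  have hs : ∑ w1, ∑ w2, e w1 w2 ≤ M1 * M2 * (δ + τ) := by
    calc ∑ w1, ∑ w2, e w1 w2 ≤ ∑ w1, ∑ w2, (δ + ind w1 w2) :=
          Finset.sum_le_sum fun w1 _ => Finset.sum_le_sum fun w2 _ => he w1 w2
      _ = M1 * M2 * δ + ∑ w1, ∑ w2, ind w1 w2 := by
          simp [Finset.sum_add_distrib, mul_assoc]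
      _ ≤ _ := by rw [mul_add]; gcongr
  have e1 : ∑ w1, ∑ w2, (e w1 w2).toReal = (∑ w1, ∑ w2, e w1 w2).toReal := by
    rw [ENNReal.toReal_sum]
    · refine Finset.sum_congr rfl fun w1 _ => ?_
      rw [ENNReal.toReal_sum (fun w2 _ => hef w1 w2)]
    · intro w1 _; exact ENNReal.sum_ne_top.2 fun w2 _ => hef w1 w2
  rw [e1]
  have h3 := ENNReal.toReal_mono (ENNReal.mul_ne_top (ENNReal.mul_ne_top (by simp) (by simp)) (ENNReal.add_ne_top.2 ⟨hδ, hτ⟩)) hs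
  rw [ENNReal.toReal_mul, ENNReal.toReal_mul, ENNReal.toReal_natCast, ENNReal.toReal_natCast] at h3
  have : (0:ℝ) < M1 * M2 := by positivity
  rw [one_div, inv_mul_le_iff₀ this]
  exact h3

lemma os_code (a b P1 P2 : ℝ) (hP1 : 0 ≤ P1) (hP2 : 0 ≤ P2) (n M1 M2 L : ℕ) (hn : 0 < n) (h1 : 0 < M1) (h2 : 0 < M2)
    (x1 : (Fin n → ℝ) → Fin n → ℝ) (x2 : (Fin n → ℝ) → (Fin n → ℝ) → Fin n → ℝ)
    (q1 q2 : (Fin n → ℝ) → (Fin n → ℝ) → ℝ≥0∞) (t1 t2 δ τ : ℝ≥0∞) (hδ : δ < 1) (hτ : τ ≠ ∞)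
    (S : Fin M1 → Fin n → ℝ) (U : Fin M2 → Fin L → Fin n → ℝ)
    (hb : ∑ w1, ∑ w2, {p : Fin M1 × Fin M2 | ¬ ∃ l,
        osErr (stdGaussN n) (fun s u z i => x1 s i + a * x2 s u i + z i) (fun s u z i => b * x1 s i + x2 s u i + z i) q1 q2
          {p | n * P1 < ∑ i, (x1 p.1 i) ^ 2 ∨ n * P2 < ∑ i, (x2 p.1 p.2 i) ^ 2}
          t1 t2 p.1 p.2 S U (U p.2 l) ≤ δ}.indicator (1 : Fin M1 × Fin M2 → ℝ≥0∞) (w1, w2)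
      ≤ M1 * M2 * τ) :
    ∃ (f1 : Fin M1 → Fin n → ℝ) (f2 : Fin M1 → Fin M2 → Fin n → ℝ) (g1 : (Fin n → ℝ) → Fin M1)
    (g2 : (Fin n → ℝ) → Fin M2),
    (1 / M1 : ℝ) * ∑ w1 : Fin M1, ((1 / n : ℝ) * ∑ i, (f1 w1 i) ^ 2) ≤ P1 ∧
    (1 / (M1 * M2) : ℝ) * ∑ w1 : Fin M1, ∑ w2 : Fin M2,
      ((1 / n : ℝ) * ∑ i, (f2 w1 w2 i) ^ 2) ≤ P2 ∧
    peG1T2 a n M1 M2 f1 f2 g1 ≤ (δ + τ).toReal ∧ peG2T2 b n M1 M2 f1 f2 g2 ≤ (δ + τ).toReal := by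
  classical
  set μ := stdGaussN n with hμ
  set B : Set ((Fin n → ℝ) × (Fin n → ℝ)) := {p | n * P1 < ∑ i, (x1 p.1 i) ^ 2 ∨ n * P2 < ∑ i, (x2 p.1 p.2 i) ^ 2} with hB
  set Y1 : (Fin n → ℝ) → (Fin n → ℝ) → (Fin n → ℝ) → (Fin n → ℝ) := (fun s u z i => x1 s i + a * x2 s u i + z i) with hY1
  set Y2 : (Fin n → ℝ) → (Fin n → ℝ) → (Fin n → ℝ) → (Fin n → ℝ) := (fun s u z i => b * x1 s i + x2 s u i + z i) with hY2
  set good : Fin M1 → Fin M2 → Fin L → Prop := fun w1 w2 l => osErr μ Y1 Y2 q1 q2 B t1 t2 w1 w2 S U (U w2 l) ≤ δ with hgood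
  have goodB : ∀ w1 w2 l, good w1 w2 l → (S w1, U w2 l) ∉ B := by
    intro w1 w2 l h hc
    have : (1:ℝ≥0∞) ≤ osErr μ Y1 Y2 q1 q2 B t1 t2 w1 w2 S U (U w2 l) := by
      unfold osErr osA
      rw [Set.indicator_of_mem hc]
      simp only [add_assoc]
      exact le_self_add
    exact absurd (this.trans h) (not_le.2 hδ)
  set f1 : Fin M1 → Fin n → ℝ := fun w1 => if ∑ i, (x1 (S w1) i) ^ 2 ≤ n * P1 then x1 (S w1) else 0 with hf1
  set f2 : Fin M1 → Fin M2 → Fin n → ℝ := fun w1 w2 => if h : ∃ l, good w1 w2 l then x2 (S w1) (U w2 h.choose) else 0 with hf2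
  obtain ⟨g1, hg1⟩ := os_dec μ h1 q1 t1 (fun w (_ : Fin 1) => S w)
  obtain ⟨g2, hg2⟩ := os_dec μ h2 q2 t2 U
  have hn' : (0:ℝ) < n := by exact_mod_cast hn
  have hM1 : (0:ℝ) < M1 := by exact_mod_cast h1
  have hM2 : (0:ℝ) < M2 := by exact_mod_cast h2
  have pw1 : ∀ w1, (1 / n : ℝ) * ∑ i, (f1 w1 i) ^ 2 ≤ P1 := by
    intro w1
    rw [one_div, inv_mul_le_iff₀ hn']
    by_cases h : ∑ i, (x1 (S w1) i) ^ 2 ≤ n * P1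
    · simp only [hf1, if_pos h]; exact h
    · simp only [hf1, if_neg h]; simp; positivity
  have pw2 : ∀ w1 w2, (1 / n : ℝ) * ∑ i, (f2 w1 w2 i) ^ 2 ≤ P2 := by
    intro w1 w2
    rw [one_div, inv_mul_le_iff₀ hn']
    by_cases h : ∃ l, good w1 w2 l
    · simp only [hf2, dif_pos h]
      have := goodB _ _ _ h.choose_spec
      by_contra hc
      exact this (Or.inr (not_le.1 hc))
    · simp only [hf2, dif_neg h]; simp; positivity
  have key1 : ∀ w1 w2, μ {z | g1 (fun i => f1 w1 i + a * f2 w1 w2 i + z i) ≠ w1} ≤ δ +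
      {p : Fin M1 × Fin M2 | ¬ ∃ l, osErr μ Y1 Y2 q1 q2 B t1 t2 p.1 p.2 S U (U p.2 l) ≤ δ}.indicator (1 : Fin M1 × Fin M2 → ℝ≥0∞) (w1, w2) := by
    intro w1 w2
    by_cases h : ∃ l, good w1 w2 l
    · have hs := h.choose_spec
      have hnB := goodB _ _ _ hs
      have hle : ∑ i, (x1 (S w1) i) ^ 2 ≤ n * P1 := by
        by_contra hc; exact hnB (Or.inl (not_le.1 hc))
      refine le_trans ?_ le_self_add
      refine le_trans ?_ hs
      simp only [hf2, dif_pos h, hf1, if_pos hle]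
      refine (hg1 (Y1 (S w1) (U w2 h.choose)) w1 0).trans ?_
      unfold osErr osA osK
      simp only [Finset.univ_unique, Finset.sum_const, Finset.card_singleton, one_smul]
      refine le_trans (add_le_add ?_ le_rfl) le_self_add
      refine le_trans le_add_self le_self_add
    · rw [Set.indicator_of_mem (by exact h)]
      exact prob_le_one.trans le_add_self
  have key2 : ∀ w1 w2, μ {z | g2 (fun i => b * f1 w1 i + f2 w1 w2 i + z i) ≠ w2} ≤ δ +
      {p : Fin M1 × Fin M2 | ¬ ∃ l, osErr μ Y1 Y2 q1 q2 B t1 t2 p.1 p.2 S U (U p.2 l) ≤ δ}.indicator (1 : Fin M1 × Fin M2 → ℝ≥0∞) (w1, w2) := by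
    intro w1 w2
    by_cases h : ∃ l, good w1 w2 l
    · have hs := h.choose_spec
      have hnB := goodB _ _ _ hs
      have hle : ∑ i, (x1 (S w1) i) ^ 2 ≤ n * P1 := by
        by_contra hc; exact hnB (Or.inl (not_le.1 hc))
      refine le_trans ?_ le_self_add
      refine le_trans ?_ hs
      simp only [hf2, dif_pos h, hf1, if_pos hle]
      refine (hg2 (Y2 (S w1) (U w2 h.choose)) w2 h.choose).trans ?_
      unfold osErr osA osK
      refine add_le_add ?_ le_rfl
      refine le_trans le_add_self le_self_add
    · rw [Set.indicator_of_mem (by exact h)]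
      exact prob_le_one.trans le_add_self
  refine ⟨f1, f2, g1, g2, ?_, ?_, ?_, ?_⟩
  · rw [one_div, inv_mul_le_iff₀ hM1]
    calc _ ≤ ∑ w1 : Fin M1, P1 := Finset.sum_le_sum fun w1 _ => pw1 w1
      _ = _ := by simp
  · rw [one_div, inv_mul_le_iff₀ (by positivity)]
    calc _ ≤ ∑ w1 : Fin M1, ∑ w2 : Fin M2, P2 := Finset.sum_le_sum fun w1 _ => Finset.sum_le_sum fun w2 _ => pw2 w1 w2
      _ = _ := by simp [mul_assoc]
  · exact os_avg h1 h2 _ _ δ τ hδ.ne_top hτ key1 hb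
  · exact os_avg h1 h2 _ _ δ τ hδ.ne_top hτ key2 hb
end
end

section
open scoped BigOperators ENNReal
open MeasureTheory ProbabilityTheory
noncomputable section

/-- law of three independent standard vectors -/
def g3 (n : ℕ) : Measure ((Fin n → ℝ) × (Fin n → ℝ) × (Fin n → ℝ)) :=
  (stdGaussN n).prod ((stdGaussN n).prod (stdGaussN n))

instance g3_prob (n : ℕ) : IsProbabilityMeasure (g3 n) := by unfold g3; infer_instance

lemma g3_lc (n : ℕ) (c1 c2 c3 : ℝ) (h : c1 ^ 2 + c2 ^ 2 + c3 ^ 2 = 1) :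
    MeasurePreserving (fun p : (Fin n → ℝ) × (Fin n → ℝ) × (Fin n → ℝ) => c1 • p.1 + (c2 • p.2.1 + c3 • p.2.2))
      (g3 n) (stdGaussN n) := by
  obtain ⟨R, d2, d3, hR, h2, h3, hd⟩ : ∃ R d2 d3 : ℝ, c1 ^ 2 + R ^ 2 = 1 ∧ c2 = R * d2 ∧ c3 = R * d3 ∧ d2 ^ 2 + d3 ^ 2 = 1 := by
    by_cases h0 : c2 ^ 2 + c3 ^ 2 = 0
    · refine ⟨0, 1, 0, by nlinarith, ?_, ?_, by norm_num⟩ <;> nlinarith [sq_nonneg c2, sq_nonneg c3]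
    · have hp : 0 < c2 ^ 2 + c3 ^ 2 := lt_of_le_of_ne (by positivity) (Ne.symm h0)
      have hs := Real.sq_sqrt hp.le
      have hs0 := Real.sqrt_pos.2 hp
      refine ⟨Real.sqrt (c2 ^ 2 + c3 ^ 2), c2 / Real.sqrt (c2 ^ 2 + c3 ^ 2), c3 / Real.sqrt (c2 ^ 2 + c3 ^ 2),
        by rw [hs]; linarith, by field_simp, by field_simp, ?_⟩
      rw [div_pow, div_pow, hs, ← add_div, div_self h0]
  have e1 := (MeasurePreserving.id (stdGaussN n)).prod (stdGaussN_lc n d2 d3 hd)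
  have e2 := (stdGaussN_lc n c1 R hR).comp e1
  unfold g3
  convert e2 using 1
  funext p
  simp only [Function.comp, Prod.map, id, smul_add, smul_smul, h2, h3]

lemma chi_ev {Ω : Type*} [MeasurableSpace Ω] (P : Measure Ω) (n : ℕ) (K : ℝ)
    (hK : ∀ (n : ℕ), 0 < n → ∀ δ : ℝ, 0 < δ →
      stdGaussN n {z | δ * n ≤ |∑ i, z i ^ 2 - n|} ≤ ENNReal.ofReal (K / (n * δ ^ 2)))
    (hn : 0 < n) (δ : ℝ) (hδ : 0 < δ) (X : Ω → Fin n → ℝ) (hX : MeasurePreserving X P (stdGaussN n)) :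
    P {ω | δ * n ≤ |∑ i, X ω i ^ 2 - n|} ≤ ENNReal.ofReal (K / (n * δ ^ 2)) := by
  refine le_trans (le_of_eq ?_) (hK n hn δ hδ)
  refine hX.measure_preimage (s := {z | δ * n ≤ |∑ i, z i ^ 2 - n|}) (MeasurableSet.nullMeasurableSet ?_)
  exact measurableSet_le measurable_const (by fun_prop)

lemma gD_typ {Ω : Type*} [MeasurableSpace Ω] (P : Measure Ω) (n : ℕ) (K : ℝ)
    (hK : ∀ (n : ℕ), 0 < n → ∀ δ : ℝ, 0 < δ →
      stdGaussN n {z | δ * n ≤ |∑ i, z i ^ 2 - n|} ≤ ENNReal.ofReal (K / (n * δ ^ 2)))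
    (hn : 0 < n) (δ : ℝ) (hδ : 0 < δ) (X Y Ξ : Ω → Fin n → ℝ) (hX : MeasurePreserving X P (stdGaussN n))
    (hΞ : MeasurePreserving Ξ P (stdGaussN n)) (k τ : ℝ) (hτ : 0 < τ)
    (h : ∀ ω i, X ω i - k * Y ω i = Real.sqrt τ * Ξ ω i) :
    P {ω | ¬ (ENNReal.ofReal (Real.exp (n * (-(1/2) * Real.log τ - δ))) ≤ gD n k τ (X ω) (Y ω) ∧
      gD n k τ (X ω) (Y ω) ≤ ENNReal.ofReal (Real.exp (n * (-(1/2) * Real.log τ + δ))))}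
      ≤ 2 * ENNReal.ofReal (K / (n * δ ^ 2)) := by
  have hsub : {ω | ¬ (ENNReal.ofReal (Real.exp (n * (-(1/2) * Real.log τ - δ))) ≤ gD n k τ (X ω) (Y ω) ∧
      gD n k τ (X ω) (Y ω) ≤ ENNReal.ofReal (Real.exp (n * (-(1/2) * Real.log τ + δ))))}
      ⊆ {ω | δ * n ≤ |∑ i, X ω i ^ 2 - n|} ∪ {ω | δ * n ≤ |∑ i, Ξ ω i ^ 2 - n|} := by
    intro ω hω
    by_contra hc
    rw [Set.mem_union, not_or] at hc
    obtain ⟨h1, h2⟩ := hc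
    have h1 : ¬ (δ * n ≤ |∑ i, X ω i ^ 2 - n|) := h1
    have h2 : ¬ (δ * n ≤ |∑ i, Ξ ω i ^ 2 - n|) := h2
    have h1 := abs_lt.1 (not_le.1 h1)
    have h2 := abs_lt.1 (not_le.1 h2)
    apply hω
    have e : (∑ i, (X ω i - k * Y ω i) ^ 2) / (2 * τ) = (∑ i, Ξ ω i ^ 2) / 2 := by
      have : ∀ i, (X ω i - k * Y ω i) ^ 2 = τ * Ξ ω i ^ 2 := fun i => by
        rw [h, mul_pow, Real.sq_sqrt hτ.le]
      simp_rw [this, ← Finset.mul_sum]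
      field_simp
    rw [gD_eq, e]
    constructor <;> apply ENNReal.ofReal_le_ofReal <;> apply Real.exp_le_exp.2 <;> nlinarith
  refine (measure_mono hsub).trans ((measure_union_le _ _).trans ?_)
  rw [two_mul]
  exact add_le_add (chi_ev P n K hK hn δ hδ X hX) (chi_ev P n K hK hn δ hδ Ξ hΞ)

lemma pow_typ {Ω : Type*} [MeasurableSpace Ω] (P : Measure Ω) (n : ℕ) (K : ℝ)
    (hK : ∀ (n : ℕ), 0 < n → ∀ δ : ℝ, 0 < δ →
      stdGaussN n {z | δ * n ≤ |∑ i, z i ^ 2 - n|} ≤ ENNReal.ofReal (K / (n * δ ^ 2)))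
    (hn : 0 < n) (δ : ℝ) (hδ : 0 < δ) (t Pw : ℝ) (ht : 0 < t) (htδ : t ≤ 1 - δ) (hP : 0 ≤ Pw)
    (W x : Ω → Fin n → ℝ) (hW : MeasurePreserving W P (stdGaussN n))
    (h : ∀ ω i, x ω i = Real.sqrt (t * Pw) * W ω i) :
    P {ω | n * Pw < ∑ i, x ω i ^ 2} ≤ ENNReal.ofReal (K / (n * δ ^ 2)) := by
  refine le_trans (measure_mono ?_) (chi_ev P n K hK hn δ hδ W hW)
  intro ω hω
  have e : ∑ i, x ω i ^ 2 = t * Pw * ∑ i, W ω i ^ 2 := by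
    simp_rw [h, mul_pow, Real.sq_sqrt (mul_nonneg ht.le hP), ← Finset.mul_sum]
  have h1 : (n:ℝ) * Pw < t * Pw * ∑ i, W ω i ^ 2 := by rw [← e]; exact hω
  have hn' : (0:ℝ) < n := by exact_mod_cast hn
  have hP' : 0 < Pw := by
    rcases hP.eq_or_lt with h0 | h0
    · rw [← h0] at h1; simp at h1
    · exact h0
  have h2 : (n:ℝ) < t * ∑ i, W ω i ^ 2 := by
    have : Pw * n < Pw * (t * ∑ i, W ω i ^ 2) := by nlinarith
    exact lt_of_mul_lt_mul_left this hP
  show δ * n ≤ |∑ i, W ω i ^ 2 - n|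
  refine le_trans ?_ (le_abs_self _)
  set A := ∑ i, W ω i ^ 2
  have h3 : (n:ℝ) < (1 - δ) * A := lt_of_lt_of_le h2 (by
    have : 0 ≤ A := Finset.sum_nonneg fun i _ => sq_nonneg _
    nlinarith)
  have hd : δ < 1 := by linarith
  nlinarith [sq_nonneg δ, mul_pos hn' (show (0:ℝ) < δ ^ 2 by positivity)]

lemma lint_g3 (n : ℕ) (A : Set ((Fin n → ℝ) × (Fin n → ℝ) × (Fin n → ℝ))) (hA : MeasurableSet A) :
    ∫⁻ s, ∫⁻ g, stdGaussN n {z | (s, g, z) ∈ A} ∂(stdGaussN n) ∂(stdGaussN n) = g3 n A := by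
  unfold g3
  rw [Measure.prod_apply hA]
  refine lintegral_congr fun s => ?_
  rw [Measure.prod_apply (measurable_prodMk_left hA)]
  rfl

lemma ideal_abs (n : ℕ) (Y1 Y2 : (Fin n → ℝ) → (Fin n → ℝ) → (Fin n → ℝ) → (Fin n → ℝ))
    (q1 q2 r : (Fin n → ℝ) → (Fin n → ℝ) → ℝ≥0∞) (B : Set ((Fin n → ℝ) × (Fin n → ℝ))) (t1 t2 T δ e : ℝ≥0∞)
    (u : (Fin n → ℝ) → (Fin n → ℝ) → (Fin n → ℝ))
    (mER : MeasurableSet {p : (Fin n → ℝ) × (Fin n → ℝ) × (Fin n → ℝ) | T < r (u p.1 p.2.1) p.1})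
    (mEB : MeasurableSet {p : (Fin n → ℝ) × (Fin n → ℝ) × (Fin n → ℝ) | (p.1, u p.1 p.2.1) ∈ B})
    (mE1 : MeasurableSet {p : (Fin n → ℝ) × (Fin n → ℝ) × (Fin n → ℝ) | q1 p.1 (Y1 p.1 (u p.1 p.2.1) p.2.2) < t1})
    (mE2 : MeasurableSet {p : (Fin n → ℝ) × (Fin n → ℝ) × (Fin n → ℝ) | q2 (u p.1 p.2.1) (Y2 p.1 (u p.1 p.2.1) p.2.2) < t2})
    (bR : g3 n {p : (Fin n → ℝ) × (Fin n → ℝ) × (Fin n → ℝ) | T < r (u p.1 p.2.1) p.1} ≤ 2 * e)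
    (bB : g3 n {p : (Fin n → ℝ) × (Fin n → ℝ) × (Fin n → ℝ) | (p.1, u p.1 p.2.1) ∈ B} ≤ 2 * e)
    (b1 : g3 n {p : (Fin n → ℝ) × (Fin n → ℝ) × (Fin n → ℝ) | q1 p.1 (Y1 p.1 (u p.1 p.2.1) p.2.2) < t1} ≤ 2 * e)
    (b2 : g3 n {p : (Fin n → ℝ) × (Fin n → ℝ) × (Fin n → ℝ) | q2 (u p.1 p.2.1) (Y2 p.1 (u p.1 p.2.1) p.2.2) < t2} ≤ 2 * e) :
    ∫⁻ s, ∫⁻ g, ({p : (Fin n → ℝ) × (Fin n → ℝ) | T < r p.2 p.1}.indicator 1 (s, u s g)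
      + δ⁻¹ * osA (stdGaussN n) Y1 Y2 q1 q2 B t1 t2 s (u s g)) ∂(stdGaussN n) ∂(stdGaussN n) ≤ (2 + δ⁻¹ * 6) * e := by
  set ER : Set ((Fin n → ℝ) × (Fin n → ℝ) × (Fin n → ℝ)) := {p | T < r (u p.1 p.2.1) p.1} with hER
  set EB : Set ((Fin n → ℝ) × (Fin n → ℝ) × (Fin n → ℝ)) := {p | (p.1, u p.1 p.2.1) ∈ B} with hEB
  set E1 : Set ((Fin n → ℝ) × (Fin n → ℝ) × (Fin n → ℝ)) := {p | q1 p.1 (Y1 p.1 (u p.1 p.2.1) p.2.2) < t1} with hE1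
  set E2 : Set ((Fin n → ℝ) × (Fin n → ℝ) × (Fin n → ℝ)) := {p | q2 (u p.1 p.2.1) (Y2 p.1 (u p.1 p.2.1) p.2.2) < t2} with hE2
  have mm : ∀ A : Set ((Fin n → ℝ) × (Fin n → ℝ) × (Fin n → ℝ)), MeasurableSet A →
        Measurable fun p : (Fin n → ℝ) × (Fin n → ℝ) => stdGaussN n {z | (p.1, p.2, z) ∈ A} := by
    intro A hA
    have : MeasurableSet {q : ((Fin n → ℝ) × (Fin n → ℝ)) × (Fin n → ℝ) | (q.1.1, q.1.2, q.2) ∈ A} :=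
      (show Measurable fun q : ((Fin n → ℝ) × (Fin n → ℝ)) × (Fin n → ℝ) => (q.1.1, q.1.2, q.2) by fun_prop) hA
    exact measurable_measure_prodMk_left this
  have m4 : Measurable fun p : (Fin n → ℝ) × (Fin n → ℝ) => stdGaussN n {z | (p.1, p.2, z) ∈ EB}
          + stdGaussN n {z | (p.1, p.2, z) ∈ E1} := (mm _ mEB).add (mm _ mE1)
  have m5 : Measurable fun p : (Fin n → ℝ) × (Fin n → ℝ) => stdGaussN n {z | (p.1, p.2, z) ∈ EB}
          + stdGaussN n {z | (p.1, p.2, z) ∈ E1} + stdGaussN n {z | (p.1, p.2, z) ∈ E2} := m4.add (mm _ mE2)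
  have m6 : Measurable fun p : (Fin n → ℝ) × (Fin n → ℝ) => stdGaussN n {z | (p.1, p.2, z) ∈ ER} + δ⁻¹ * (stdGaussN n {z | (p.1, p.2, z) ∈ EB}
          + stdGaussN n {z | (p.1, p.2, z) ∈ E1} + stdGaussN n {z | (p.1, p.2, z) ∈ E2}) := (mm _ mER).add (m5.const_mul _)
  have fin : ∫⁻ s, ∫⁻ g, ({p : (Fin n → ℝ) × (Fin n → ℝ) | T < r p.2 p.1}.indicator 1 (s, u s g)
      + δ⁻¹ * osA (stdGaussN n) Y1 Y2 q1 q2 B t1 t2 s (u s g)) ∂(stdGaussN n) ∂(stdGaussN n)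
      = ∫⁻ p, (stdGaussN n {z | (p.1, p.2, z) ∈ ER} + δ⁻¹ * (stdGaussN n {z | (p.1, p.2, z) ∈ EB}
          + stdGaussN n {z | (p.1, p.2, z) ∈ E1} + stdGaussN n {z | (p.1, p.2, z) ∈ E2})) ∂((stdGaussN n).prod (stdGaussN n)) := by
    rw [lintegral_prod _ m6.aemeasurable]
    refine lintegral_congr fun s => lintegral_congr fun g => ?_
    refine congrArg₂ (· + ·) ?_ ?_
    · by_cases hA : T < r (u s g) s
      · rw [Set.indicator_of_mem (by exact hA)]
        have : {z : Fin n → ℝ | (s, g, z) ∈ ER} = Set.univ := Set.eq_univ_of_forall fun z => hA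
        rw [this]; simp
      · rw [Set.indicator_of_notMem (by exact hA)]
        have : {z : Fin n → ℝ | (s, g, z) ∈ ER} = ∅ := Set.eq_empty_of_forall_notMem fun z => hA
        rw [this]; simp
    · refine congrArg (δ⁻¹ * ·) ?_
      unfold osA
      refine congrArg₂ (· + ·) (congrArg₂ (· + ·) ?_ rfl) rfl
      by_cases hA : (s, u s g) ∈ B
      · rw [Set.indicator_of_mem hA]
        have : {z : Fin n → ℝ | (s, g, z) ∈ EB} = Set.univ := Set.eq_univ_of_forall fun z => hA
        rw [this]; simp
      · rw [Set.indicator_of_notMem hA]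
        have : {z : Fin n → ℝ | (s, g, z) ∈ EB} = ∅ := Set.eq_empty_of_forall_notMem fun z => hA
        rw [this]; simp
  have l3 : ∀ A : Set ((Fin n → ℝ) × (Fin n → ℝ) × (Fin n → ℝ)), MeasurableSet A →
      ∫⁻ p, stdGaussN n {z | (p.1, p.2, z) ∈ A} ∂((stdGaussN n).prod (stdGaussN n)) = g3 n A := by
    intro A hA
    rw [lintegral_prod _ (mm A hA).aemeasurable, lint_g3 n A hA]
  rw [fin, lintegral_add_left (mm _ mER), lintegral_const_mul _ m5, lintegral_add_left m4, lintegral_add_left (mm _ mEB),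
    l3 _ mER, l3 _ mEB, l3 _ mE1, l3 _ mE2]
  calc _ ≤ 2 * e + δ⁻¹ * (2 * e + 2 * e + 2 * e) := by gcongr
    _ = _ := by ring

set_option maxHeartbeats 400000 in
lemma gd_ideal (n : ℕ) (K : ℝ)
    (hK : ∀ (n : ℕ), 0 < n → ∀ δ : ℝ, 0 < δ →
      stdGaussN n {z | δ * n ≤ |∑ i, z i ^ 2 - n|} ≤ ENNReal.ofReal (K / (n * δ ^ 2)))
    (hn : 0 < n) (ε : ℝ) (hε : 0 < ε) (δ : ℝ≥0∞)
    (a b P1 P2 t α p0 sQ d1 d2 η v κ ν c : ℝ) (hP1 : 0 ≤ P1) (hP2 : 0 ≤ P2)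
    (ht : 0 < t) (htε : t ≤ 1 - ε) (hα : α = Real.sqrt (t * P1)) (hp0 : p0 = Real.sqrt (t * P2) * d1)
    (hsQ : sQ = Real.sqrt (t * P2) * d2) (hd : d1 ^ 2 + d2 ^ 2 = 1)
    (hv : v = 1 + η ^ 2) (hν : ν = 1 + a ^ 2 * sQ ^ 2) (hκ : κ = α + a * p0) (hc : c = b * α + p0)
    (hη : η = c * sQ / (1 + sQ ^ 2))
    (x1 : (Fin n → ℝ) → Fin n → ℝ) (x2 : (Fin n → ℝ) → (Fin n → ℝ) → Fin n → ℝ)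
    (hx1 : x1 = fun s i => α * s i) (hx2 : x2 = fun s u i => (p0 - sQ * η) * s i + sQ * Real.sqrt v * u i)
    (q1 q2 r : (Fin n → ℝ) → (Fin n → ℝ) → ℝ≥0∞) (Y1 Y2 : (Fin n → ℝ) → (Fin n → ℝ) → (Fin n → ℝ) → (Fin n → ℝ))
    (B : Set ((Fin n → ℝ) × (Fin n → ℝ))) (T t1 t2 : ℝ≥0∞)
    (hr : r = gD n (η / Real.sqrt v) (1 / v)) (hq1 : q1 = gD n (κ / (κ ^ 2 + ν)) (ν / (κ ^ 2 + ν)))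
    (hq2 : q2 = gD n (sQ / (1 + sQ ^ 2) / Real.sqrt v) (1 / (v * (1 + sQ ^ 2))))
    (hY1 : Y1 = (fun s u z i => x1 s i + a * x2 s u i + z i)) (hY2 : Y2 = (fun s u z i => b * x1 s i + x2 s u i + z i))
    (hB : B = {p | n * P1 < ∑ i, (x1 p.1 i) ^ 2 ∨ n * P2 < ∑ i, (x2 p.1 p.2 i) ^ 2})
    (hT : T = ENNReal.ofReal (Real.exp (n * (-(1/2) * Real.log (1 / v) + ε))))
    (ht1 : t1 = (ENNReal.ofReal (Real.exp (n * (-(1/2) * Real.log (ν / (κ ^ 2 + ν)) - ε)))))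
    (ht2 : t2 = (ENNReal.ofReal (Real.exp (n * (-(1/2) * Real.log (1 / (v * (1 + sQ ^ 2))) - ε))))) :
    (∫⁻ s, ∫⁻ u, r u s * ({p : (Fin n → ℝ) × (Fin n → ℝ) | T < r p.2 p.1}.indicator 1 (s, u)
    + δ⁻¹ * osA (stdGaussN n) Y1 Y2 q1 q2 B t1 t2 s u) ∂(stdGaussN n) ∂(stdGaussN n))
      ≤ (2 + δ⁻¹ * 6) * ENNReal.ofReal (K / (n * ε ^ 2)) := by
  set e := ENNReal.ofReal (K / (n * ε ^ 2)) with he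
  have hv0 : 0 < v := by rw [hv]; positivity
  have hsv := Real.sqrt_pos.2 hv0
  have hsv2 := Real.sq_sqrt hv0.le
  have hν0 : 0 < ν := by rw [hν]; positivity
  have hκν : 0 < κ ^ 2 + ν := by positivity
  have hQ : 0 < 1 + sQ ^ 2 := by positivity
  have mY1 : Measurable fun p : (Fin n → ℝ) × (Fin n → ℝ) × (Fin n → ℝ) => Y1 p.1 p.2.1 p.2.2 := by
    simp only [hY1, hx1, hx2]; fun_prop
  have mY2 : Measurable fun p : (Fin n → ℝ) × (Fin n → ℝ) × (Fin n → ℝ) => Y2 p.1 p.2.1 p.2.2 := by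
    simp only [hY2, hx1, hx2]; fun_prop
  have mq1 : Measurable fun p : (Fin n → ℝ) × (Fin n → ℝ) => q1 p.1 p.2 := by rw [hq1]; exact measurable_gD n _ _
  have mq2 : Measurable fun p : (Fin n → ℝ) × (Fin n → ℝ) => q2 p.1 p.2 := by rw [hq2]; exact measurable_gD n _ _
  have mr : Measurable fun p : (Fin n → ℝ) × (Fin n → ℝ) => r p.1 p.2 := by rw [hr]; exact measurable_gD n _ _
  have mr' : Measurable fun p : (Fin n → ℝ) × (Fin n → ℝ) => r p.2 p.1 := mr.comp measurable_swap
  have mB : MeasurableSet B := by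
    have h1 : MeasurableSet {p : (Fin n → ℝ) × (Fin n → ℝ) | n * P1 < ∑ i, (x1 p.1 i) ^ 2} :=
      measurableSet_lt measurable_const (by simp only [hx1]; fun_prop)
    have h2 : MeasurableSet {p : (Fin n → ℝ) × (Fin n → ℝ) | n * P2 < ∑ i, (x2 p.1 p.2 i) ^ 2} :=
      measurableSet_lt measurable_const (by simp only [hx2]; fun_prop)
    rw [hB]; exact h1.union h2
  have mA := measurable_osA (stdGaussN n) Y1 Y2 q1 q2 B t1 t2 mY1 mY2 mq1 mq2 mB
  have mI : MeasurableSet {p : (Fin n → ℝ) × (Fin n → ℝ) | T < r p.2 p.1} := measurableSet_lt measurable_const mr'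
  set u : (Fin n → ℝ) → (Fin n → ℝ) → (Fin n → ℝ) := fun s g => (η / Real.sqrt v) • s + Real.sqrt (1 / v) • g with hu
  have mu : Measurable fun p : (Fin n → ℝ) × (Fin n → ℝ) => u p.1 p.2 := by simp only [hu]; fun_prop
  -- change of measure
  have step : ∀ s, ∫⁻ x, r x s * ({p : (Fin n → ℝ) × (Fin n → ℝ) | T < r p.2 p.1}.indicator 1 (s, x)
      + δ⁻¹ * osA (stdGaussN n) Y1 Y2 q1 q2 B t1 t2 s x) ∂(stdGaussN n)
      = ∫⁻ g, ({p : (Fin n → ℝ) × (Fin n → ℝ) | T < r p.2 p.1}.indicator 1 (s, u s g)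
      + δ⁻¹ * osA (stdGaussN n) Y1 Y2 q1 q2 B t1 t2 s (u s g)) ∂(stdGaussN n) := by
    intro s
    have key := gD_lintegral_mul n (η / Real.sqrt v) (1 / v) s (by positivity)
      (fun x => {p : (Fin n → ℝ) × (Fin n → ℝ) | T < r p.2 p.1}.indicator 1 (s, x)
      + δ⁻¹ * osA (stdGaussN n) Y1 Y2 q1 q2 B t1 t2 s x) (by
    refine Measurable.add ?_ (Measurable.const_mul ?_ _)
    · exact (measurable_one.indicator mI).comp (g := ({p : (Fin n → ℝ) × (Fin n → ℝ) | T < r p.2 p.1}.indicator 1))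
        (f := fun x => (s, x)) (by fun_prop)
    · exact mA.comp (f := fun x => (s, x)) (by fun_prop))
    rw [← hr] at key
    exact key
  simp_rw [step]
  -- events
  set ER : Set ((Fin n → ℝ) × (Fin n → ℝ) × (Fin n → ℝ)) := {p | T < r (u p.1 p.2.1) p.1} with hER
  set EB : Set ((Fin n → ℝ) × (Fin n → ℝ) × (Fin n → ℝ)) := {p | (p.1, u p.1 p.2.1) ∈ B} with hEB
  set E1 : Set ((Fin n → ℝ) × (Fin n → ℝ) × (Fin n → ℝ)) := {p | q1 p.1 (Y1 p.1 (u p.1 p.2.1) p.2.2) < t1} with hE1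
  set E2 : Set ((Fin n → ℝ) × (Fin n → ℝ) × (Fin n → ℝ)) := {p | q2 (u p.1 p.2.1) (Y2 p.1 (u p.1 p.2.1) p.2.2) < t2} with hE2
  have mu3 : Measurable fun p : (Fin n → ℝ) × (Fin n → ℝ) × (Fin n → ℝ) => u p.1 p.2.1 :=
    mu.comp (f := fun p : (Fin n → ℝ) × (Fin n → ℝ) × (Fin n → ℝ) => (p.1, p.2.1)) (by fun_prop)
  have mtr : Measurable fun p : (Fin n → ℝ) × (Fin n → ℝ) × (Fin n → ℝ) => (p.1, u p.1 p.2.1, p.2.2) :=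
    measurable_fst.prodMk (mu3.prodMk measurable_snd.snd)
  have mER : MeasurableSet ER := measurableSet_lt measurable_const
    (mr.comp (f := fun p : (Fin n → ℝ) × (Fin n → ℝ) × (Fin n → ℝ) => (u p.1 p.2.1, p.1)) (mu3.prodMk measurable_fst))
  have mEB : MeasurableSet EB := (measurable_fst.prodMk mu3) mB
  have mE1 : MeasurableSet E1 := measurableSet_lt
    (mq1.comp (f := fun p : (Fin n → ℝ) × (Fin n → ℝ) × (Fin n → ℝ) => (p.1, Y1 p.1 (u p.1 p.2.1) p.2.2))
      (measurable_fst.prodMk (mY1.comp mtr))) measurable_const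
  have mE2 : MeasurableSet E2 := measurableSet_lt
    (mq2.comp (f := fun p : (Fin n → ℝ) × (Fin n → ℝ) × (Fin n → ℝ) => (u p.1 p.2.1, Y2 p.1 (u p.1 p.2.1) p.2.2))
      (mu3.prodMk (mY2.comp mtr))) measurable_const
  -- formulas
  have hsv1 : Real.sqrt (1 / v) = 1 / Real.sqrt v := by rw [Real.sqrt_div zero_le_one, Real.sqrt_one]
  have ui : ∀ s g i, u s g i = (η * s i + g i) / Real.sqrt v := by
    intro s g i
    simp only [hu, hsv1, Pi.add_apply, Pi.smul_apply, smul_eq_mul]; ring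
  have x2i : ∀ s g i, x2 s (u s g) i = p0 * s i + sQ * g i := by
    intro s g i
    simp only [hx2, ui]
    field_simp; ring
  have PS : MeasurePreserving (fun p : (Fin n → ℝ) × (Fin n → ℝ) × (Fin n → ℝ) => p.1) (g3 n) (stdGaussN n) := measurePreserving_fst
  have PG : MeasurePreserving (fun p : (Fin n → ℝ) × (Fin n → ℝ) × (Fin n → ℝ) => p.2.1) (g3 n) (stdGaussN n) :=
    measurePreserving_fst.comp measurePreserving_snd
  have PU : MeasurePreserving (fun p : (Fin n → ℝ) × (Fin n → ℝ) × (Fin n → ℝ) => u p.1 p.2.1) (g3 n) (stdGaussN n) := by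
    convert g3_lc n (η / Real.sqrt v) (Real.sqrt (1 / v)) 0 (by
      rw [hsv1, div_pow, div_pow, hsv2, hv]; field_simp; ring) using 2
    simp [hu]
  have bR : g3 n ER ≤ 2 * e := by
    refine le_trans (measure_mono ?_) (gD_typ (g3 n) n K hK hn ε hε (fun p => u p.1 p.2.1) (fun p => p.1) (fun p => p.2.1)
      PU PG (η / Real.sqrt v) (1 / v) (by positivity) ?_)
    · intro p hp hc
      rw [← hT, ← hr] at hc; exact absurd hc.2 (not_le.2 hp)
    · intro p i; simp only [ui, hsv1]; ring
  have b1 : g3 n E1 ≤ 2 * e := by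
    have hsν := Real.sq_sqrt hν0.le
    have hsκν := Real.sq_sqrt hκν.le
    have h0 := Real.sqrt_pos.2 hν0
    have h0' := Real.sqrt_pos.2 hκν
    refine le_trans (measure_mono ?_) (gD_typ (g3 n) n K hK hn ε hε (fun p => p.1) (fun p => Y1 p.1 (u p.1 p.2.1) p.2.2)
      (fun p => (ν / (Real.sqrt ν * Real.sqrt (κ ^ 2 + ν))) • p.1 + ((-(κ * a * sQ) / (Real.sqrt ν * Real.sqrt (κ ^ 2 + ν))) • p.2.1
        + (-κ / (Real.sqrt ν * Real.sqrt (κ ^ 2 + ν))) • p.2.2))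
      PS (g3_lc n _ _ _ ?_) (κ / (κ ^ 2 + ν)) (ν / (κ ^ 2 + ν)) (by positivity) ?_)
    · intro p hp hc
      rw [← ht1, ← hq1] at hc; exact absurd hc.1 (not_le.2 hp)
    · simp only [div_pow, mul_pow, hsν, hsκν]
      rw [← add_div, ← add_div, div_eq_one_iff_eq (by positivity)]
      have : ν = 1 + a ^ 2 * sQ ^ 2 := hν
      linear_combination (-κ^2) * this
    · intro p i
      simp only [hY1, x2i, hx1, Pi.add_apply, Pi.smul_apply, smul_eq_mul, Real.sqrt_div hν0.le]
      set A := Real.sqrt ν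
      set D := Real.sqrt (κ ^ 2 + ν)
      rw [← hsκν]
      field_simp
      have e1 : D ^ 2 - κ * (α + a * p0) = ν := by rw [hsκν, ← hκ]; ring
      linear_combination p.1 i * e1
  have b2 : g3 n E2 ≤ 2 * e := by
    have hsD := Real.sq_sqrt hQ.le
    have h0' := Real.sqrt_pos.2 hQ
    refine le_trans (measure_mono ?_) (gD_typ (g3 n) n K hK hn ε hε (fun p => u p.1 p.2.1) (fun p => Y2 p.1 (u p.1 p.2.1) p.2.2)
      (fun p => (0:ℝ) • p.1 + ((1 / Real.sqrt (1 + sQ ^ 2)) • p.2.1 + (-sQ / Real.sqrt (1 + sQ ^ 2)) • p.2.2))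
      PU (g3_lc n _ _ _ ?_) (sQ / (1 + sQ ^ 2) / Real.sqrt v) (1 / (v * (1 + sQ ^ 2))) (by positivity) ?_)
    · intro p hp hc
      rw [← ht2, ← hq2] at hc; exact absurd hc.1 (not_le.2 hp)
    · simp only [div_pow, hsD]
      field_simp; ring
    · intro p i
      have e2 : Real.sqrt (1 / (v * (1 + sQ ^ 2))) = 1 / (Real.sqrt v * Real.sqrt (1 + sQ ^ 2)) := by
        rw [Real.sqrt_div zero_le_one, Real.sqrt_one, Real.sqrt_mul hv0.le]
      have e1 : η * (1 + sQ ^ 2) = c * sQ := by rw [hη]; field_simp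
      simp only [hY2, x2i, hx1, Pi.add_apply, Pi.smul_apply, smul_eq_mul, e2, ui]
      set D := Real.sqrt (1 + sQ ^ 2)
      rw [← hsD]
      rw [← hsD] at e1
      field_simp
      rw [hc] at e1
      linear_combination p.1 i * e1 + p.2.1 i * hsD
  have bB : g3 n EB ≤ 2 * e := by
    have hsub : EB ⊆ {p | n * P1 < ∑ i, (x1 p.1 i) ^ 2} ∪ {p | n * P2 < ∑ i, (x2 p.1 (u p.1 p.2.1) i) ^ 2} := by
      intro p hp; rw [hEB, hB] at hp; exact hp
    refine (measure_mono hsub).trans ((measure_union_le _ _).trans ?_)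
    rw [two_mul]
    refine add_le_add ?_ ?_
    · refine pow_typ (g3 n) n K hK hn ε hε t P1 ht htε hP1 (fun p => p.1) (fun p => x1 p.1) PS ?_
      intro p i; simp only [hx1, hα]
    · refine pow_typ (g3 n) n K hK hn ε hε t P2 ht htε hP2 (fun p => d1 • p.1 + (d2 • p.2.1 + (0:ℝ) • p.2.2))
        (fun p => x2 p.1 (u p.1 p.2.1)) (g3_lc n _ _ _ (by linarith)) ?_
      intro p i; simp only [x2i, Pi.add_apply, Pi.smul_apply, smul_eq_mul]; rw [hp0, hsQ]; ring
  exact ideal_abs n Y1 Y2 q1 q2 r B t1 t2 T δ e u mER mEB mE1 mE2 bR bB b1 b2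
end
end

section
open scoped BigOperators ENNReal
open MeasureTheory ProbabilityTheory
noncomputable section

lemma ceil_exp (x : ℝ) : 0 < ⌈Real.exp x⌉₊ ∧ ((⌈Real.exp x⌉₊ - 1 : ℕ) : ℝ) ≤ Real.exp x ∧ x ≤ Real.log ⌈Real.exp x⌉₊ := by
  have h0 : 0 < ⌈Real.exp x⌉₊ := Nat.ceil_pos.2 (Real.exp_pos x)
  refine ⟨h0, ?_, ?_⟩
  · rw [Nat.cast_sub h0]
    have := Nat.ceil_lt_add_one (Real.exp_pos x).le
    push_cast; linarith
  · rw [Real.le_log_iff_exp_le (by exact_mod_cast h0)]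
    exact Nat.le_ceil _

lemma exp_neg_le_inv (x : ℝ) (hx : 0 < x) : Real.exp (-x) ≤ 1 / x := by
  rw [Real.exp_neg, ← one_div]
  apply one_div_le_one_div_of_le hx
  linarith [Real.add_one_le_exp x]

lemma ach_num (n : ℕ) (hn : 0 < n) (ε : ℝ) (hε : 0 < ε) (δ : ℝ) (hδ : 0 < δ) (K : ℝ) (hK : 0 ≤ K) (C1 Iv C2 : ℝ) (hIv : 0 ≤ Iv)
    (M1 M2 L : ℕ) (hM1 : M1 = ⌈Real.exp (n * (C1 - 2 * ε))⌉₊) (hM2 : M2 = ⌈Real.exp (n * (C2 - 4 * ε))⌉₊)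
    (hL : L = ⌈Real.exp (n * (Iv + 2 * ε))⌉₊) :
    (2 + (ENNReal.ofReal δ)⁻¹ * 6) * ENNReal.ofReal (K / (n * ε ^ 2))
      + (ENNReal.ofReal δ)⁻¹ * (((M1 - 1 : ℕ) : ℝ≥0∞) * (ENNReal.ofReal (Real.exp (n * (C1 - ε))))⁻¹
        + ((M2 - 1 : ℕ) : ℝ≥0∞) * (L * (ENNReal.ofReal (Real.exp (n * (Iv + C2 - ε))))⁻¹))
      + ENNReal.ofReal (Real.exp (-(L / Real.exp (n * (Iv + ε)))))
      ≤ ENNReal.ofReal (((2 + δ⁻¹ * 6) * (K / ε ^ 2) + δ⁻¹ * (3 / ε) + 1 / ε) / n) := by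
  have hn' : (0:ℝ) < n := by exact_mod_cast hn
  have hnε : 0 < n * ε := by positivity
  have c1 : ((M1 - 1 : ℕ) : ℝ) * (Real.exp (n * (C1 - ε)))⁻¹ ≤ 1 / (n * ε) := by
    rw [hM1]
    calc _ ≤ Real.exp (n * (C1 - 2 * ε)) * (Real.exp (n * (C1 - ε)))⁻¹ := by
          gcongr; exact (ceil_exp _).2.1
      _ = Real.exp (-(n * ε)) := by rw [← Real.exp_neg, ← Real.exp_add]; congr 1; ring
      _ ≤ _ := exp_neg_le_inv _ hnε
  have hL2 : (L : ℝ) ≤ 2 * Real.exp (n * (Iv + 2 * ε)) := by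
    have h1 := Nat.ceil_lt_add_one (Real.exp_pos (n * (Iv + 2 * ε))).le
    have h2 : 1 ≤ Real.exp (n * (Iv + 2 * ε)) := Real.one_le_exp (by positivity)
    rw [hL]; linarith
  have c2 : ((M2 - 1 : ℕ) : ℝ) * (L * (Real.exp (n * (Iv + C2 - ε)))⁻¹) ≤ 2 / (n * ε) := by
    calc _ ≤ Real.exp (n * (C2 - 4 * ε)) * (2 * Real.exp (n * (Iv + 2 * ε)) * (Real.exp (n * (Iv + C2 - ε)))⁻¹) := by
          gcongr; rw [hM2]; exact (ceil_exp _).2.1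
      _ = 2 * (Real.exp (n * (C2 - 4 * ε)) * (Real.exp (n * (Iv + 2 * ε)) * (Real.exp (n * (Iv + C2 - ε)))⁻¹)) := by ring
      _ = 2 * Real.exp (-(n * ε)) := by
          rw [← Real.exp_neg, ← Real.exp_add, ← Real.exp_add]; congr 2; ring
      _ ≤ 2 * (1 / (n * ε)) := by gcongr; exact exp_neg_le_inv _ hnε
      _ = _ := by ring
  have c3 : Real.exp (-(L / Real.exp (n * (Iv + ε)))) ≤ 1 / (n * ε) := by
    have : n * ε ≤ L / Real.exp (n * (Iv + ε)) := by
      rw [le_div_iff₀ (Real.exp_pos _)]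
      calc n * ε * Real.exp (n * (Iv + ε)) ≤ Real.exp (n * ε) * Real.exp (n * (Iv + ε)) := by
            gcongr; linarith [Real.add_one_le_exp (n * ε)]
        _ = Real.exp (n * (Iv + 2 * ε)) := by rw [← Real.exp_add]; congr 1; ring
        _ ≤ L := by rw [hL]; exact Nat.le_ceil _
    calc _ ≤ Real.exp (-(n * ε)) := Real.exp_le_exp.2 (by linarith)
      _ ≤ _ := exp_neg_le_inv _ hnε
  rw [← ENNReal.ofReal_inv_of_pos hδ, ← ENNReal.ofReal_inv_of_pos (Real.exp_pos _), ← ENNReal.ofReal_inv_of_pos (Real.exp_pos _),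
    ← ENNReal.ofReal_natCast (M1 - 1), ← ENNReal.ofReal_natCast (M2 - 1), ← ENNReal.ofReal_natCast L,
    show (2:ℝ≥0∞) = ENNReal.ofReal 2 by simp, show (6:ℝ≥0∞) = ENNReal.ofReal 6 by simp,
    ← ENNReal.ofReal_mul (by positivity), ← ENNReal.ofReal_mul (by positivity), ← ENNReal.ofReal_mul (by positivity),
    ← ENNReal.ofReal_mul (by positivity), ← ENNReal.ofReal_add (by positivity) (by positivity),
    ← ENNReal.ofReal_add (by positivity) (by positivity),
    ← ENNReal.ofReal_mul (by positivity), ← ENNReal.ofReal_mul (by positivity),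
    ← ENNReal.ofReal_add (by positivity) (by positivity), ← ENNReal.ofReal_add (by positivity) (by positivity)]
  apply ENNReal.ofReal_le_ofReal
  calc _ ≤ (2 + δ⁻¹ * 6) * (K / (n * ε ^ 2)) + δ⁻¹ * (1 / (n * ε) + 2 / (n * ε)) + 1 / (n * ε) := by gcongr
    _ = _ := by field_simp; ring

lemma ach_core (a b P1 P2 t ε e' α p0 sQ d1 d2 κ ν : ℝ) (hP1 : 0 ≤ P1) (hP2 : 0 ≤ P2)
    (ht : 0 < t) (hε : 0 < ε) (htε : t ≤ 1 - ε) (he' : 0 < e')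
    (hα : α = Real.sqrt (t * P1)) (hp0 : p0 = Real.sqrt (t * P2) * d1)
    (hsQ : sQ = Real.sqrt (t * P2) * d2) (hd : d1 ^ 2 + d2 ^ 2 = 1)
    (hν : ν = 1 + a ^ 2 * sQ ^ 2) (hκ : κ = α + a * p0) :
    ∃ (n M1 M2 : ℕ) (f1 : Fin M1 → Fin n → ℝ)
    (f2 : Fin M1 → Fin M2 → Fin n → ℝ) (g1 : (Fin n → ℝ) → Fin M1)
    (g2 : (Fin n → ℝ) → Fin M2),
    0 < n ∧ 0 < M1 ∧ 0 < M2 ∧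
    (1 / M1 : ℝ) * ∑ w1 : Fin M1, ((1 / n : ℝ) * ∑ i, (f1 w1 i) ^ 2) ≤ P1 ∧
    (1 / (M1 * M2) : ℝ) * ∑ w1 : Fin M1, ∑ w2 : Fin M2,
      ((1 / n : ℝ) * ∑ i, (f2 w1 w2 i) ^ 2) ≤ P2 ∧
    n * ((1/2) * Real.log ((κ ^ 2 + ν) / ν) - 2 * ε) ≤ Real.log M1 ∧
    n * ((1/2) * Real.log (1 + sQ ^ 2) - 4 * ε) ≤ Real.log M2 ∧
    peG1T2 a n M1 M2 f1 f2 g1 ≤ e' ∧ peG2T2 b n M1 M2 f1 f2 g2 ≤ e' := by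
  obtain ⟨K, hK0, hK⟩ := chi_conc
  obtain ⟨c, hc⟩ : ∃ c, c = b * α + p0 := ⟨_, rfl⟩
  obtain ⟨η, hη⟩ : ∃ η, η = c * sQ / (1 + sQ ^ 2) := ⟨_, rfl⟩
  obtain ⟨v, hv⟩ : ∃ v, v = 1 + η ^ 2 := ⟨_, rfl⟩
  have hv0 : 0 < v := by rw [hv]; positivity
  have hν0 : 0 < ν := by rw [hν]; positivity
  have hκν : 0 < κ ^ 2 + ν := by positivity
  have hQ : 0 < 1 + sQ ^ 2 := by positivity
  obtain ⟨δ, hδ⟩ : ∃ δ, δ = min (e' / 2) (1 / 2) := ⟨_, rfl⟩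
  have hδ0 : 0 < δ := by rw [hδ]; positivity
  have hδe : δ ≤ e' / 2 := by rw [hδ]; exact min_le_left _ _
  have hδ1 : δ < 1 := by have := min_le_right (e' / 2) (1 / 2 : ℝ); rw [← hδ] at this; linarith
  set Cc := ((2 + δ⁻¹ * 6) * (K / ε ^ 2) + δ⁻¹ * (3 / ε) + 1 / ε) with hCc
  have hCc0 : 0 < Cc := by positivity
  obtain ⟨n, hn⟩ := exists_nat_gt (Cc / (e' / 2))
  have hn0 : (0:ℝ) < n := lt_trans (by positivity) hn
  have hn0' : 0 < n := by exact_mod_cast hn0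
  have hCn : Cc / n ≤ e' / 2 := by
    rw [div_le_iff₀ hn0]; rw [div_lt_iff₀ (by positivity)] at hn; linarith
  obtain ⟨M1, hM1⟩ : ∃ M, M = ⌈Real.exp (n * ((1/2) * Real.log ((κ ^ 2 + ν) / ν) - 2 * ε))⌉₊ := ⟨_, rfl⟩
  obtain ⟨M2, hM2⟩ : ∃ M, M = ⌈Real.exp (n * ((1/2) * Real.log (1 + sQ ^ 2) - 4 * ε))⌉₊ := ⟨_, rfl⟩
  obtain ⟨L, hL⟩ : ∃ M, M = ⌈Real.exp (n * ((1/2) * Real.log v + 2 * ε))⌉₊ := ⟨_, rfl⟩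
  have hM10 : 0 < M1 := by rw [hM1]; exact (ceil_exp _).1
  have hM20 : 0 < M2 := by rw [hM2]; exact (ceil_exp _).1
  obtain ⟨x1, hx1⟩ : ∃ x1 : (Fin n → ℝ) → Fin n → ℝ, x1 = fun s i => α * s i := ⟨_, rfl⟩
  obtain ⟨x2, hx2⟩ : ∃ x2 : (Fin n → ℝ) → (Fin n → ℝ) → Fin n → ℝ, x2 = fun s u i => (p0 - sQ * η) * s i + sQ * Real.sqrt v * u i := ⟨_, rfl⟩
  obtain ⟨r, hr⟩ : ∃ r, r = gD n (η / Real.sqrt v) (1 / v) := ⟨_, rfl⟩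
  obtain ⟨q1, hq1⟩ : ∃ r, r = gD n (κ / (κ ^ 2 + ν)) (ν / (κ ^ 2 + ν)) := ⟨_, rfl⟩
  obtain ⟨q2, hq2⟩ : ∃ r, r = gD n (sQ / (1 + sQ ^ 2) / Real.sqrt v) (1 / (v * (1 + sQ ^ 2))) := ⟨_, rfl⟩
  obtain ⟨Y1, hY1⟩ : ∃ Y : (Fin n → ℝ) → (Fin n → ℝ) → (Fin n → ℝ) → (Fin n → ℝ), Y = (fun s u z i => x1 s i + a * x2 s u i + z i) := ⟨_, rfl⟩
  obtain ⟨Y2, hY2⟩ : ∃ Y : (Fin n → ℝ) → (Fin n → ℝ) → (Fin n → ℝ) → (Fin n → ℝ), Y = (fun s u z i => b * x1 s i + x2 s u i + z i) := ⟨_, rfl⟩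
  obtain ⟨B, hB⟩ : ∃ B : Set ((Fin n → ℝ) × (Fin n → ℝ)), B = {p | n * P1 < ∑ i, (x1 p.1 i) ^ 2 ∨ n * P2 < ∑ i, (x2 p.1 p.2 i) ^ 2} := ⟨_, rfl⟩
  have l1 : -(1/2) * Real.log (1 / v) = (1/2) * Real.log v := by rw [show (1/v) = v⁻¹ from one_div v, Real.log_inv]; ring
  have l2 : -(1/2) * Real.log (ν / (κ ^ 2 + ν)) = (1/2) * Real.log ((κ ^ 2 + ν) / ν) := by
    rw [← inv_div (κ^2+ν) ν, Real.log_inv]; ring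
  have l3 : -(1/2) * Real.log (1 / (v * (1 + sQ ^ 2))) = (1/2) * Real.log v + (1/2) * Real.log (1 + sQ ^ 2) := by
    rw [show 1/(v*(1+sQ^2)) = (v*(1+sQ^2))⁻¹ from one_div _, Real.log_inv, Real.log_mul hv0.ne' hQ.ne']; ring
  have hid := gd_ideal n K hK hn0' ε hε (ENNReal.ofReal δ) a b P1 P2 t α p0 sQ d1 d2 η v κ ν c hP1 hP2 ht htε hα hp0 hsQ hd hv hν hκ hc hη
    x1 x2 hx1 hx2 q1 q2 r Y1 Y2 B _ _ _ hr hq1 hq2 hY1 hY2 hB rfl rfl rfl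
  rw [l1, l2, l3] at hid
  have hIv : 0 ≤ (1/2) * Real.log v := mul_nonneg (by norm_num) (Real.log_nonneg (by rw [hv]; nlinarith [sq_nonneg η]))
  have hnum := ach_num n hn0' ε hε δ hδ0 K hK0 _ _ _ hIv M1 M2 L hM1 hM2 hL
  have mY1 : Measurable fun p : (Fin n → ℝ) × (Fin n → ℝ) × (Fin n → ℝ) => Y1 p.1 p.2.1 p.2.2 := by
    simp only [hY1, hx1, hx2]; fun_prop
  have mY2 : Measurable fun p : (Fin n → ℝ) × (Fin n → ℝ) × (Fin n → ℝ) => Y2 p.1 p.2.1 p.2.2 := by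
    simp only [hY2, hx1, hx2]; fun_prop
  have mB : MeasurableSet B := by
    have h1 : MeasurableSet {p : (Fin n → ℝ) × (Fin n → ℝ) | n * P1 < ∑ i, (x1 p.1 i) ^ 2} :=
      measurableSet_lt measurable_const (by simp only [hx1]; fun_prop)
    have h2 : MeasurableSet {p : (Fin n → ℝ) × (Fin n → ℝ) | n * P2 < ∑ i, (x2 p.1 p.2 i) ^ 2} :=
      measurableSet_lt measurable_const (by simp only [hx2]; fun_prop)
    rw [hB]; exact h1.union h2
  have hpos : ∀ x : ℝ, ENNReal.ofReal (Real.exp x) ≠ 0 := fun x => by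
    simpa using Real.exp_pos x
  obtain ⟨S, U, hSU⟩ := os_main (stdGaussN n) Y1 Y2 q1 q2 r B
    (ENNReal.ofReal (Real.exp (n * ((1/2) * Real.log ((κ ^ 2 + ν) / ν) - ε))))
    (ENNReal.ofReal (Real.exp (n * ((1/2) * Real.log v + (1/2) * Real.log (1 + sQ ^ 2) - ε))))
    (ENNReal.ofReal δ) (Real.exp (n * ((1/2) * Real.log v + ε))) mY1 mY2
    (by rw [hq1]; exact measurable_gD n _ _) (by rw [hq2]; exact measurable_gD n _ _) (by rw [hr]; exact measurable_gD n _ _)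
    mB (hpos _) ENNReal.ofReal_ne_top (hpos _) ENNReal.ofReal_ne_top (by simpa using hδ0) ENNReal.ofReal_ne_top (Real.exp_pos _)
    (fun y => by rw [hq1]; exact (gD_lintegral n _ _ y (by positivity)).le)
    (fun y => by rw [hq2]; exact (gD_lintegral n _ _ y (by positivity)).le)
    (fun y => by rw [hr]; exact (gD_lintegral n _ _ y (by positivity))) M1 M2 L
  set τ := osTot (stdGaussN n) Y1 Y2 q1 q2 r B
    (ENNReal.ofReal (Real.exp (n * ((1/2) * Real.log ((κ ^ 2 + ν) / ν) - ε))))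
    (ENNReal.ofReal (Real.exp (n * ((1/2) * Real.log v + (1/2) * Real.log (1 + sQ ^ 2) - ε))))
    (ENNReal.ofReal δ) (Real.exp (n * ((1/2) * Real.log v + ε))) M1 M2 L with hτ
  have hτle : τ ≤ ENNReal.ofReal (Cc / n) := by
    refine le_trans ?_ hnum
    rw [hτ]; unfold osTot
    exact add_le_add (add_le_add hid le_rfl) le_rfl
  rw [hY1, hY2, hB] at hSU
  obtain ⟨f1, f2, g1, g2, c1, c2, c3, c4⟩ := os_code a b P1 P2 hP1 hP2 n M1 M2 L hn0' hM10 hM20 x1 x2 q1 q2 _ _ (ENNReal.ofReal δ) τ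
    (by rw [← ENNReal.ofReal_one]; exact (ENNReal.ofReal_lt_ofReal_iff one_pos).2 hδ1)
    (ne_top_of_le_ne_top ENNReal.ofReal_ne_top hτle) S U hSU
  have hfin : (ENNReal.ofReal δ + τ).toReal ≤ e' := by
    refine ENNReal.toReal_le_of_le_ofReal he'.le ?_
    calc ENNReal.ofReal δ + τ ≤ ENNReal.ofReal (e' / 2) + ENNReal.ofReal (e' / 2) := by
          refine add_le_add (ENNReal.ofReal_le_ofReal hδe) (hτle.trans (ENNReal.ofReal_le_ofReal hCn))
      _ = _ := by rw [← ENNReal.ofReal_add (by positivity) (by positivity)]; congr 1; ring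
  exact ⟨n, M1, M2, f1, f2, g1, g2, hn0', hM10, hM20, c1, c2, by rw [hM1]; exact (ceil_exp _).2.2,
    by rw [hM2]; exact (ceil_exp _).2.2, c3.trans hfin, c4.trans hfin⟩
end
end

section
open scoped BigOperators ENNReal
open MeasureTheory ProbabilityTheory
noncomputable section

lemma ach_main (a b P1 P2 R1 R2 β : ℝ) (hP1 : 0 ≤ P1) (hP2 : 0 ≤ P2) (hβ0 : 0 ≤ β) (hβ1 : β ≤ 1)
    (h1 : R1 ≤ (1 / 2) * Real.logb 2
          ((1 + P1 + 2 * |a| * Real.sqrt ((1 - β) * P1 * P2) + a ^ 2 * P2)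
            / (1 + a ^ 2 * β * P2)))
    (h2 : R2 ≤ (1 / 2) * Real.logb 2 (1 + β * P2)) : AchievableGT2 a b P1 P2 R1 R2 := by
  intro ε0 hε0
  have hl2 : 0 < Real.log 2 := Real.log_pos (by norm_num)
  obtain ⟨A, hA⟩ : ∃ A, A = P1 + 2 * |a| * Real.sqrt ((1 - β) * P1 * P2) + a ^ 2 * P2 := ⟨_, rfl⟩
  have hA0 : 0 ≤ A := by rw [hA]; positivity
  have hB0 : 0 ≤ a ^ 2 * β * P2 := by positivity
  have hC0 : 0 ≤ β * P2 := by positivity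
  have t1 : Filter.Tendsto (fun t : ℝ => (1/2) * Real.log ((1 + t * A) / (1 + t * (a ^ 2 * β * P2))) - 2 * (1 - t))
      (nhdsWithin 1 (Set.Iio 1)) (nhds ((1/2) * Real.log ((1 + 1 * A) / (1 + 1 * (a ^ 2 * β * P2))) - 2 * (1 - 1))) := by
    have : ContinuousAt (fun t : ℝ => (1/2) * Real.log ((1 + t * A) / (1 + t * (a ^ 2 * β * P2))) - 2 * (1 - t)) 1 := by
      refine ContinuousAt.sub (ContinuousAt.mul continuousAt_const (ContinuousAt.log (ContinuousAt.div (by fun_prop) (by fun_prop) ?_) ?_)) (by fun_prop)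
      · positivity
      · positivity
    exact this.mono_left nhdsWithin_le_nhds
  have t2 : Filter.Tendsto (fun t : ℝ => (1/2) * Real.log (1 + t * (β * P2)) - 4 * (1 - t))
      (nhdsWithin 1 (Set.Iio 1)) (nhds ((1/2) * Real.log (1 + 1 * (β * P2)) - 4 * (1 - 1))) := by
    have : ContinuousAt (fun t : ℝ => (1/2) * Real.log (1 + t * (β * P2)) - 4 * (1 - t)) 1 := by
      refine ContinuousAt.sub (ContinuousAt.mul continuousAt_const (ContinuousAt.log (by fun_prop) ?_)) (by fun_prop)
      positivity
    exact this.mono_left nhdsWithin_le_nhds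
  have e1 := t1.eventually (lt_mem_nhds (sub_lt_self _ (mul_pos hε0 hl2)))
  have e2 := t2.eventually (lt_mem_nhds (sub_lt_self _ (mul_pos hε0 hl2)))
  have e3 : ∀ᶠ t : ℝ in nhdsWithin 1 (Set.Iio 1), 0 < t := nhdsWithin_le_nhds (lt_mem_nhds one_pos)
  have e4 : ∀ᶠ t : ℝ in nhdsWithin 1 (Set.Iio 1), t < 1 := self_mem_nhdsWithin
  obtain ⟨t, ⟨⟨f1, f2⟩, ht⟩, ht1⟩ := (((e1.and e2).and e3).and e4).exists
  obtain ⟨ς, hς, haς⟩ : ∃ ς : ℝ, ς ^ 2 = 1 ∧ a * ς = |a| := by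
    rcases le_total 0 a with h | h
    · exact ⟨1, by norm_num, by rw [abs_of_nonneg h, mul_one]⟩
    · exact ⟨-1, by norm_num, by rw [abs_of_nonpos h]; ring⟩
  obtain ⟨n, M1, M2, f1', f2', g1, g2, k1, k2, k3, k4, k5, k6, k7, k8, k9⟩ :=
    ach_core a b P1 P2 t (1 - t) ε0 _ _ _ (ς * Real.sqrt (1 - β)) (Real.sqrt β) _ _ hP1 hP2 ht (by linarith) (by linarith) hε0
      rfl rfl rfl (by rw [mul_pow, hς, Real.sq_sqrt (by linarith), Real.sq_sqrt hβ0]; ring) rfl rfl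
  have hsQ : (Real.sqrt (t * P2) * Real.sqrt β) ^ 2 = t * (β * P2) := by
    rw [mul_pow, Real.sq_sqrt (by positivity), Real.sq_sqrt hβ0]; ring
  have hκ : (Real.sqrt (t * P1) + a * (Real.sqrt (t * P2) * (ς * Real.sqrt (1 - β)))) ^ 2 =
      t * (P1 + 2 * |a| * Real.sqrt ((1 - β) * P1 * P2) + a ^ 2 * ((1 - β) * P2)) := by
    have q1 : Real.sqrt ((1 - β) * P1 * P2) = Real.sqrt (1 - β) * Real.sqrt P1 * Real.sqrt P2 := by
      rw [Real.sqrt_mul (mul_nonneg (by linarith) hP1), Real.sqrt_mul (by linarith)]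
    rw [q1, Real.sqrt_mul ht.le, Real.sqrt_mul ht.le]
    have s1 := Real.sq_sqrt ht.le
    have s2 := Real.sq_sqrt hP1
    have s3 := Real.sq_sqrt hP2
    have s4 := Real.sq_sqrt (show 0 ≤ 1 - β by linarith)
    rw [← haς]
    generalize Real.sqrt t = x at *
    generalize Real.sqrt P1 = y at *
    generalize Real.sqrt P2 = z at *
    generalize Real.sqrt (1 - β) = w at *
    rw [← s1, ← s2, ← s3, ← s4]
    linear_combination (a ^ 2 * x ^ 2 * z ^ 2 * w ^ 2) * hς
  rw [hsQ, hκ] at k6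
  rw [hsQ] at k7
  have hn : (0:ℝ) < n := by exact_mod_cast k1
  refine ⟨n, M1, M2, f1', f2', g1, g2, k1, k2, k3, k4, k5, ?_, ?_, k8, k9⟩
  · rw [le_div_iff₀ hn]
    have q : (t * (P1 + 2 * |a| * Real.sqrt ((1 - β) * P1 * P2) + a ^ 2 * ((1 - β) * P2)) + (1 + a ^ 2 * (t * (β * P2))))
      = 1 + t * A := by rw [hA]; ring
    rw [q, show a ^ 2 * (t * (β * P2)) = t * (a ^ 2 * β * P2) by ring] at k6
    rw [show 1 + P1 + 2 * |a| * Real.sqrt ((1 - β) * P1 * P2) + a ^ 2 * P2 = 1 + 1 * A by rw [hA]; ring,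
      show 1 + a ^ 2 * β * P2 = 1 + 1 * (a ^ 2 * β * P2) by ring] at h1
    unfold Real.logb at h1 ⊢
    rw [le_div_iff₀ hl2]
    refine le_trans ?_ k6
    have : (R1 - ε0) * Real.log 2 ≤ (1/2) * Real.log ((1 + t * A) / (1 + t * (a ^ 2 * β * P2))) - 2 * (1 - t) := by
      refine le_trans ?_ f1.le
      rw [← mul_div_assoc, le_div_iff₀ hl2] at h1
      linarith
    nlinarith
  · rw [le_div_iff₀ hn]
    rw [show 1 + β * P2 = 1 + 1 * (β * P2) by ring] at h2
    unfold Real.logb at h2 ⊢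
    rw [le_div_iff₀ hl2]
    refine le_trans ?_ k7
    have : (R2 - ε0) * Real.log 2 ≤ (1/2) * Real.log (1 + t * (β * P2)) - 4 * (1 - t) := by
      refine le_trans ?_ f2.le
      rw [← mul_div_assoc, le_div_iff₀ hl2] at h2
      linarith
    nlinarith
end
end

section
open scoped BigOperators ENNReal
open MeasureTheory ProbabilityTheory
noncomputable section

lemma cdf_facts (f : ℝ → ℝ) (hf : Continuous f) (h0 : ∀ x, 0 < f x) (h1 : ∫⁻ x, ENNReal.ofReal (f x) = 1) :
    ∃ F : ℝ → ℝ, (∀ x, HasDerivAt F (f x) x) ∧ StrictMono F ∧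
      (∀ x, volume.withDensity (fun x => ENNReal.ofReal (f x)) (Set.Iic x) = ENNReal.ofReal (F x)) ∧
      (∀ x, 0 < F x ∧ F x < 1) ∧ (∀ p, 0 < p → p < 1 → ∃ x, F x = p) := by
  set μ : Measure ℝ := volume.withDensity (fun x => ENNReal.ofReal (f x)) with hμ
  have hpr : IsProbabilityMeasure μ := ⟨by rw [hμ, withDensity_apply _ MeasurableSet.univ]; simpa using h1⟩
  have hint : Integrable f := by
    refine ⟨hf.aestronglyMeasurable, ?_⟩
    rw [hasFiniteIntegral_iff_ofReal (Filter.Eventually.of_forall fun x => (h0 x).le), h1]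
    exact ENNReal.one_lt_top
  have hF : ∀ x, cdf μ x = ∫ t in Set.Iic x, f t := by
    intro x
    rw [cdf_eq_real, Measure.real, hμ, withDensity_apply _ measurableSet_Iic,
      integral_eq_lintegral_of_nonneg_ae (Filter.Eventually.of_forall fun x => (h0 x).le) hf.aestronglyMeasurable]
  have hd : ∀ x, HasDerivAt (fun x => cdf μ x) (f x) x := by
    intro x
    have e : (fun x => cdf μ x) = fun y => cdf μ 0 + ∫ t in (0:ℝ)..y, f t := by
      ext y
      have := intervalIntegral.integral_Iic_sub_Iic (a := 0) (b := y) (f := f) (μ := volume) hint.integrableOn hint.integrableOn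
      rw [hF, hF]; linarith
    rw [e]
    exact (hf.integral_hasStrictDerivAt 0 x).hasDerivAt.const_add _
  have hsm : StrictMono (fun x => cdf μ x) := strictMono_of_deriv_pos (fun x => by rw [(hd x).deriv]; exact h0 x)
  refine ⟨fun x => cdf μ x, hd, hsm, ?_, ?_, ?_⟩
  · intro x
    show μ (Set.Iic x) = ENNReal.ofReal (cdf μ x)
    rw [cdf_eq_real]; simp
  · intro x
    exact ⟨lt_of_le_of_lt (cdf_nonneg μ (x-1)) (hsm (by linarith)), lt_of_lt_of_le (hsm (by linarith : x < x+1)) (cdf_le_one μ _)⟩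
  · intro p hp0 hp1
    obtain ⟨x1, hx1⟩ := ((tendsto_cdf_atBot μ).eventually (gt_mem_nhds hp0)).exists
    obtain ⟨x2, hx2⟩ := ((tendsto_cdf_atTop μ).eventually (lt_mem_nhds hp1)).exists
    have hc : Continuous (fun x => cdf μ x) := continuous_iff_continuousAt.2 fun x => (hd x).continuousAt
    exact mem_range_of_exists_le_of_exists_ge hc ⟨x1, hx1.le⟩ ⟨x2, hx2.le⟩

lemma transport (p f : ℝ → ℝ) (hp : Continuous p) (p0 : ∀ x, 0 < p x) (p1 : ∫⁻ x, ENNReal.ofReal (p x) = 1)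
    (hf : Continuous f) (h0 : ∀ x, 0 < f x) (h1 : ∫⁻ x, ENNReal.ofReal (f x) = 1) :
    ∃ T : ℝ → ℝ, (∀ x, HasDerivAt T (p x / f (T x)) x) ∧
      MeasurePreserving T (volume.withDensity (fun x => ENNReal.ofReal (p x)))
        (volume.withDensity (fun x => ENNReal.ofReal (f x))) := by
  obtain ⟨Φ, a1, a2, a3, a4, a5⟩ := cdf_facts p hp p0 p1
  obtain ⟨F, b1, b2, b3, b4, b5⟩ := cdf_facts f hf h0 h1
  choose T hT using fun x => b5 (Φ x) (a4 x).1 (a4 x).2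
  have hTm : StrictMono T := fun x y hxy => b2.lt_iff_lt.1 (by rw [hT, hT]; exact a2 hxy)
  have hTs : Function.Surjective T := by
    intro y
    obtain ⟨x, hx⟩ := a5 (F y) (b4 y).1 (b4 y).2
    exact ⟨x, b2.injective (by rw [hT, hx])⟩
  have hTc : Continuous T := hTm.monotone.continuous_of_surjective hTs
  refine ⟨T, ?_, hTc.measurable, ?_⟩
  · intro x
    rw [hasDerivAt_iff_tendsto_slope]
    have t1 := (a1 x).tendsto_slope
    have t2 := (b1 (T x)).tendsto_slope
    have t3 : Filter.Tendsto T (nhdsWithin x {x}ᶜ) (nhdsWithin (T x) {T x}ᶜ) := by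
      refine tendsto_nhdsWithin_iff.2 ⟨hTc.continuousAt.mono_left nhdsWithin_le_nhds, ?_⟩
      filter_upwards [self_mem_nhdsWithin] with y hy
      exact fun h => hy (hTm.injective h)
    refine (t1.div (t2.comp t3) (h0 _).ne').congr' ?_
    filter_upwards [self_mem_nhdsWithin] with y hy
    have hy' : y - x ≠ 0 := sub_ne_zero.2 hy
    have hty : T y - T x ≠ 0 := sub_ne_zero.2 fun h => hy (hTm.injective h)
    have hfy : Φ y - Φ x ≠ 0 := sub_ne_zero.2 fun h => hy (a2.injective h)
    simp only [slope_def_field, Function.comp, Pi.div_apply, hT]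
    field_simp
  · have : IsFiniteMeasure (volume.withDensity (fun x => ENNReal.ofReal (p x))) :=
      ⟨by rw [withDensity_apply _ MeasurableSet.univ]; simp [p1]⟩
    refine Measure.ext_of_Iic _ _ fun y => ?_
    obtain ⟨x, rfl⟩ := hTs y
    rw [Measure.map_apply hTc.measurable measurableSet_Iic, b3, hT, ← a3]
    congr 1
    ext t; simp [hTm.le_iff_le]
end
end

section
open scoped BigOperators ENNReal
open MeasureTheory ProbabilityTheory
noncomputable section

/-- standard normal density -/
def ph (x : ℝ) : ℝ := gaussianPDFReal 0 1 x

lemma ph_eq (x : ℝ) : ph x = Real.exp (-(1/2) * Real.log (2 * Real.pi) - x ^ 2 / 2) := by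
  unfold ph gaussianPDFReal
  rw [sub_eq_add_neg (-(1/2) * Real.log (2 * Real.pi)), Real.exp_add]
  congr 1
  · rw [Real.sqrt_eq_rpow, ← Real.rpow_neg (by positivity), Real.rpow_def_of_pos (by positivity)]
    congr 1; simp; ring
  · congr 1; simp; ring

lemma ph_pos (x : ℝ) : 0 < ph x := gaussianPDFReal_pos _ _ _ one_ne_zero

lemma log_ph (x : ℝ) : Real.log (ph x) = -(1/2) * Real.log (2 * Real.pi) - x ^ 2 / 2 := by
  rw [ph_eq, Real.log_exp]

lemma log2pi_pos : 0 < Real.log (2 * Real.pi) := Real.log_pos (by linarith [Real.pi_gt_three])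

lemma ph_le_one (x : ℝ) : ph x ≤ 1 := by
  rw [ph_eq, Real.exp_le_one_iff]
  have := log2pi_pos
  nlinarith [sq_nonneg x]

lemma ph_cont : Continuous ph := by
  have : ph = fun x => Real.exp (-(1/2) * Real.log (2 * Real.pi) - x ^ 2 / 2) := funext ph_eq
  rw [this]; fun_prop

lemma gauss_wd : gaussianReal 0 1 = volume.withDensity (fun x => ENNReal.ofReal (ph x)) := by
  rw [gaussianReal_of_var_ne_zero _ one_ne_zero]; rfl

lemma ph_lint : ∫⁻ x, ENNReal.ofReal (ph x) = 1 := by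
  have := measure_univ (μ := gaussianReal 0 1)
  rw [gauss_wd, withDensity_apply _ MeasurableSet.univ] at this
  simpa using this

/-- entropy of a standard normal -/
def H0 : ℝ := (1/2) * Real.log (2 * Real.pi) + 1/2

lemma H0_pos : 0 < H0 := by unfold H0; have := log2pi_pos; positivity

lemma sq_int_gauss : Integrable (fun x : ℝ => x ^ 2) (gaussianReal 0 1) := by
  have := (memLp_id_gaussianReal' (μ := 0) (v := 1) 2 (by simp)).integrable_sq
  simpa using this

lemma int_sq_gauss : ∫ x, x ^ 2 ∂(gaussianReal 0 1) = 1 := by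
  have h := variance_id_gaussianReal (μ := 0) (v := 1)
  rw [variance_eq_integral (by fun_prop)] at h
  simpa [integral_id_gaussianReal] using h

lemma nlogph_int : Integrable (fun x : ℝ => -Real.log (ph x)) (gaussianReal 0 1) := by
  have : (fun x : ℝ => -Real.log (ph x)) = fun x => (1/2) * Real.log (2 * Real.pi) + x ^ 2 / 2 := by
    ext x; rw [log_ph]; ring
  rw [this]
  exact (integrable_const _).add (sq_int_gauss.div_const 2)

lemma int_nlogph : ∫ x, -Real.log (ph x) ∂(gaussianReal 0 1) = H0 := by
  have : (fun x : ℝ => -Real.log (ph x)) = fun x => (1/2) * Real.log (2 * Real.pi) + x ^ 2 / 2 := by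
    ext x; rw [log_ph]; ring
  rw [this, integral_add (integrable_const _) (sq_int_gauss.div_const 2), integral_div, int_sq_gauss]
  simp [H0]

lemma lint_nlogph : ∫⁻ x, ENNReal.ofReal (-Real.log (ph x)) ∂(gaussianReal 0 1) = ENNReal.ofReal H0 := by
  rw [← int_nlogph, ofReal_integral_eq_lintegral_ofReal nlogph_int]
  exact Filter.Eventually.of_forall fun x => by
    have := Real.log_nonpos (ph_pos x).le (ph_le_one x)
    simpa using this

lemma epi_pt (a b l s t : ℝ) (ha : 0 < a) (hb : 0 < b) (hl : 0 < l) (hl1 : l < 1) (hs : s = Real.sqrt l) (ht : t = Real.sqrt (1 - l))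
    (φx φX fT gV : ℝ) (h1 : 0 < φx) (h2 : 0 < φX) (h3 : 0 < fT) (h4 : 0 < gV) :
    l * (-Real.log fT) + (-Real.log φx) + 1 + (l * Real.log (a / s) + (1 - l) * Real.log (b / t))
      ≤ -Real.log gV + l * (-Real.log φX) + gV * (a * s * (φX / fT) + b * t) / φx := by
  have hs0 : 0 < s := by rw [hs]; positivity
  have ht0 : 0 < t := by rw [ht]; exact Real.sqrt_pos.2 (by linarith)
  have hs2 : s ^ 2 = l := by rw [hs, Real.sq_sqrt hl.le]
  have ht2 : t ^ 2 = 1 - l := by rw [ht, Real.sq_sqrt (by linarith)]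
  have e : a * s * (φX / fT) + b * t = l * (a / s * (φX / fT)) + (1 - l) * (b / t) := by
    rw [← hs2, show 1 - s ^ 2 = t ^ 2 by rw [ht2, hs2]]; field_simp
  have c := strictConcaveOn_log_Ioi.concaveOn.2 (x := a / s * (φX / fT)) (y := b / t)
    (by simp only [Set.mem_Ioi]; positivity) (by simp only [Set.mem_Ioi]; positivity) hl.le (by linarith : 0 ≤ 1 - l) (by ring)
  simp only [smul_eq_mul] at c
  rw [← e, Real.log_mul (by positivity) (by positivity), Real.log_div h2.ne' h3.ne'] at c
  have d : 0 < a * s * (φX / fT) + b * t := by positivity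
  have k := Real.log_le_sub_one_of_pos (show 0 < gV * (a * s * (φX / fT) + b * t) / φx by positivity)
  rw [Real.log_div (by positivity) h1.ne', Real.log_mul h4.ne' d.ne'] at k
  nlinarith

lemma ofReal_nlog_add {x y : ℝ} (hx : 0 ≤ x) (hy : 0 ≤ y) : ENNReal.ofReal (x + y) = ENNReal.ofReal x + ENNReal.ofReal y :=
  ENNReal.ofReal_add hx hy

lemma epi_one (a b l : ℝ) (ha : 0 < a) (hb : 0 < b) (hl : 0 < l) (hl1 : l < 1) :
    ∃ c1 c2 : ℝ, 0 ≤ c1 ∧ 0 ≤ c2 ∧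
      c1 - c2 = (1 - l) * H0 + l * Real.log (a / Real.sqrt l) + (1 - l) * Real.log (b / Real.sqrt (1 - l)) ∧
      ∀ f g : ℝ → ℝ, Continuous f → (∀ x, 0 < f x) → (∀ x, f x ≤ 1) → ∫⁻ x, ENNReal.ofReal (f x) = 1 →
        Continuous g → (∀ x, 0 < g x) → (∀ x, g x ≤ 1) → ∫⁻ x, ENNReal.ofReal (g x) = 1 →
        ENNReal.ofReal l * (∫⁻ y, ENNReal.ofReal (f y) * ENNReal.ofReal (-Real.log (f y))) + ENNReal.ofReal c1 ≤
          (∫⁻ y, ∫⁻ z, ENNReal.ofReal (f y) * (ENNReal.ofReal (ph z) * ENNReal.ofReal (-Real.log (g (a * y + b * z))))) + ENNReal.ofReal c2 := by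
  obtain ⟨s, hs⟩ : ∃ s, s = Real.sqrt l := ⟨_, rfl⟩
  obtain ⟨t, ht⟩ : ∃ s, s = Real.sqrt (1 - l) := ⟨_, rfl⟩
  have hs0 : 0 < s := by rw [hs]; positivity
  have ht0 : 0 < t := by rw [ht]; exact Real.sqrt_pos.2 (by linarith)
  have hst : s ^ 2 + (-t) ^ 2 = 1 := by
    rw [neg_sq, hs, ht, Real.sq_sqrt hl.le, Real.sq_sqrt (by linarith)]; ring
  rw [← hs, ← ht]
  obtain ⟨K, hK⟩ : ∃ K, K = l * Real.log (a / s) + (1 - l) * Real.log (b / t) := ⟨_, rfl⟩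
  have hKs : K = max K 0 - max (-K) 0 := by
    rcases le_total 0 K with h | h
    · rw [max_eq_left h, max_eq_right (by linarith)]; ring
    · rw [max_eq_right h, max_eq_left (by linarith)]; ring
  have hH := H0_pos
  have hk1 : 0 ≤ max K 0 := le_max_right _ _
  have hk2 : 0 ≤ max (-K) 0 := le_max_right _ _
  generalize max K 0 = k1 at *
  generalize max (-K) 0 = k2 at *
  refine ⟨H0 + k1, l * H0 + k2, by positivity, by positivity, by linarith, ?_⟩
  intro f g hf f0 f1 fi hg g0 g1 gi
  obtain ⟨T, hT, hTm⟩ := transport ph f ph_cont ph_pos ph_lint hf f0 fi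
  rw [← gauss_wd] at hTm
  have mT := hTm.measurable
  have mf := hf.measurable
  have mg := hg.measurable
  have mph := ph_cont.measurable
  have hrot := gauss_rot s (-t) hst
  have nl : ∀ x : ℝ, 0 < x → x ≤ 1 → 0 ≤ -Real.log x := fun x h h' => by
    have := Real.log_nonpos h.le h'; linarith
  -- pointwise
  set γ := gaussianReal 0 1 with hγ
  have pt : ∀ p : ℝ × ℝ, ENNReal.ofReal l * ENNReal.ofReal (-Real.log (f (T (s * p.1 + (-t) * p.2)))) +
      (ENNReal.ofReal (-Real.log (ph p.1)) + ENNReal.ofReal (1 + k1)) ≤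
      ENNReal.ofReal (-Real.log (g (a * T (s * p.1 + (-t) * p.2) + b * (-(-t) * p.1 + s * p.2)))) +
      (ENNReal.ofReal l * ENNReal.ofReal (-Real.log (ph (s * p.1 + (-t) * p.2))) +
       (ENNReal.ofReal (g (a * T (s * p.1 + (-t) * p.2) + b * (-(-t) * p.1 + s * p.2)) *
        (a * s * (ph (s * p.1 + (-t) * p.2) / f (T (s * p.1 + (-t) * p.2))) + b * t) / ph p.1) + ENNReal.ofReal k2)) := by
    intro p
    have h := epi_pt a b l s t ha hb hl hl1 hs ht (ph p.1) (ph (s * p.1 + (-t) * p.2)) (f (T (s * p.1 + (-t) * p.2)))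
      (g (a * T (s * p.1 + (-t) * p.2) + b * (-(-t) * p.1 + s * p.2))) (ph_pos _) (ph_pos _) (f0 _) (g0 _)
    have n1 := nl _ (ph_pos p.1) (ph_le_one _)
    have n2 := nl _ (ph_pos (s * p.1 + (-t) * p.2)) (ph_le_one _)
    have n3 := nl _ (f0 (T (s * p.1 + (-t) * p.2))) (f1 _)
    have n4 := nl _ (g0 (a * T (s * p.1 + (-t) * p.2) + b * (-(-t) * p.1 + s * p.2))) (g1 _)
    have n5 : 0 ≤ g (a * T (s * p.1 + (-t) * p.2) + b * (-(-t) * p.1 + s * p.2)) *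
        (a * s * (ph (s * p.1 + (-t) * p.2) / f (T (s * p.1 + (-t) * p.2))) + b * t) / ph p.1 := by
      have := ph_pos p.1
      have := ph_pos (s * p.1 + (-t) * p.2)
      have := f0 (T (s * p.1 + (-t) * p.2))
      have := g0 (a * T (s * p.1 + (-t) * p.2) + b * (-(-t) * p.1 + s * p.2))
      positivity
    rw [← ENNReal.ofReal_mul hl.le, ← ENNReal.ofReal_mul hl.le, ← ENNReal.ofReal_add n1 (by positivity),
      ← ENNReal.ofReal_add (by positivity) (by positivity), ← ENNReal.ofReal_add n5 hk2,
      ← ENNReal.ofReal_add (by positivity) (by positivity), ← ENNReal.ofReal_add n4 (by positivity)]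
    apply ENNReal.ofReal_le_ofReal
    linarith
  have mA : Measurable fun p : ℝ × ℝ => ENNReal.ofReal (-Real.log (f (T (s * p.1 + (-t) * p.2)))) := by fun_prop
  have mB : Measurable fun p : ℝ × ℝ => ENNReal.ofReal (-Real.log (g (a * T (s * p.1 + (-t) * p.2) + b * (-(-t) * p.1 + s * p.2)))) := by fun_prop
  have mC : Measurable fun p : ℝ × ℝ => ENNReal.ofReal (-Real.log (ph (s * p.1 + (-t) * p.2))) := by fun_prop
  have mD : Measurable fun p : ℝ × ℝ => ENNReal.ofReal (-Real.log (ph p.1)) := by fun_prop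
  have mR : Measurable fun p : ℝ × ℝ => ENNReal.ofReal (g (a * T (s * p.1 + (-t) * p.2) + b * (-(-t) * p.1 + s * p.2)) *
        (a * s * (ph (s * p.1 + (-t) * p.2) / f (T (s * p.1 + (-t) * p.2))) + b * t) / ph p.1) := by fun_prop
  have I := lintegral_mono (μ := γ.prod γ) pt
  rw [lintegral_add_left (mA.const_mul _), lintegral_add_left mD, lintegral_const_mul _ mA,
    lintegral_add_left mB, lintegral_add_left (mC.const_mul _), lintegral_add_left mR, lintegral_const_mul _ mC,
    lintegral_const, lintegral_const, measure_univ, mul_one, mul_one] at I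
  have iA : ∫⁻ p : ℝ × ℝ, ENNReal.ofReal (-Real.log (f (T (s * p.1 + (-t) * p.2)))) ∂(γ.prod γ)
      = ∫⁻ y, ENNReal.ofReal (f y) * ENNReal.ofReal (-Real.log (f y)) := by
    have m1 : Measurable fun p : ℝ × ℝ => ENNReal.ofReal (-Real.log (f (T p.1))) := by fun_prop
    have m2 : Measurable fun y : ℝ => ENNReal.ofReal (-Real.log (f y)) := by fun_prop
    rw [hrot.lintegral_comp m1, (measurePreserving_fst (μ := γ) (ν := γ)).lintegral_comp
      (f := fun x => ENNReal.ofReal (-Real.log (f (T x)))) (by fun_prop), hTm.lintegral_comp m2,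
      lintegral_withDensity_eq_lintegral_mul _ (by fun_prop) m2]
    rfl
  have iC : ∫⁻ p : ℝ × ℝ, ENNReal.ofReal (-Real.log (ph (s * p.1 + (-t) * p.2))) ∂(γ.prod γ) = ENNReal.ofReal H0 := by
    have m1 : Measurable fun p : ℝ × ℝ => ENNReal.ofReal (-Real.log (ph p.1)) := by fun_prop
    rw [hrot.lintegral_comp m1, (measurePreserving_fst (μ := γ) (ν := γ)).lintegral_comp
      (f := fun x => ENNReal.ofReal (-Real.log (ph x))) (by fun_prop), lint_nlogph]
  have iD : ∫⁻ p : ℝ × ℝ, ENNReal.ofReal (-Real.log (ph p.1)) ∂(γ.prod γ) = ENNReal.ofReal H0 := by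
    rw [(measurePreserving_fst (μ := γ) (ν := γ)).lintegral_comp
      (f := fun x => ENNReal.ofReal (-Real.log (ph x))) (by fun_prop), lint_nlogph]
  have iB : ∫⁻ p : ℝ × ℝ, ENNReal.ofReal (-Real.log (g (a * T (s * p.1 + (-t) * p.2) + b * (-(-t) * p.1 + s * p.2)))) ∂(γ.prod γ)
      = ∫⁻ y, ∫⁻ z, ENNReal.ofReal (f y) * (ENNReal.ofReal (ph z) * ENNReal.ofReal (-Real.log (g (a * y + b * z)))) := by
    have m1 : Measurable fun p : ℝ × ℝ => ENNReal.ofReal (-Real.log (g (a * T p.1 + b * p.2))) := by fun_prop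
    have m3 : Measurable fun p : ℝ × ℝ => ENNReal.ofReal (-Real.log (g (a * p.1 + b * p.2))) := by fun_prop
    have m2 : Measurable fun y : ℝ => ∫⁻ z, ENNReal.ofReal (-Real.log (g (a * y + b * z))) ∂γ :=
      m3.lintegral_prod_right'
    rw [hrot.lintegral_comp m1, lintegral_prod _ m1.aemeasurable]
    rw [hTm.lintegral_comp m2, lintegral_withDensity_eq_lintegral_mul _ (by fun_prop) m2]
    refine lintegral_congr fun y => ?_
    have m4 : Measurable fun z : ℝ => ENNReal.ofReal (-Real.log (g (a * y + b * z))) := by fun_prop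
    rw [lintegral_const_mul _ (by fun_prop), hγ, gauss_wd]
    simp only [Pi.mul_apply]
    rw [lintegral_withDensity_eq_lintegral_mul _ (by fun_prop) m4]
    rfl
  have iR : ∫⁻ p : ℝ × ℝ, ENNReal.ofReal (g (a * T (s * p.1 + (-t) * p.2) + b * (-(-t) * p.1 + s * p.2)) *
        (a * s * (ph (s * p.1 + (-t) * p.2) / f (T (s * p.1 + (-t) * p.2))) + b * t) / ph p.1) ∂(γ.prod γ) ≤ 1 := by
    rw [lintegral_prod_symm _ mR.aemeasurable]
    calc _ ≤ ∫⁻ _ : ℝ, 1 ∂γ := ?_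
      _ = 1 := by simp
    refine lintegral_mono fun z => ?_
    have m5 : Measurable fun x : ℝ => ENNReal.ofReal (g (a * T (s * x + (-t) * z) + b * (-(-t) * x + s * z)) *
        (a * s * (ph (s * x + (-t) * z) / f (T (s * x + (-t) * z))) + b * t) / ph x) := by fun_prop
    simp only
    rw [hγ, gauss_wd, lintegral_withDensity_eq_lintegral_mul _ (by fun_prop) m5]
    have dp : ∀ x : ℝ, 0 < a * s * (ph (s * x + (-t) * z) / f (T (s * x + (-t) * z))) + b * t := by
      intro x
      have := ph_pos (s * x + (-t) * z)
      have := f0 (T (s * x + (-t) * z))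
      positivity
    have hd : ∀ x : ℝ, HasDerivAt (fun x => a * T (s * x + (-t) * z) + b * (-(-t) * x + s * z))
        (a * s * (ph (s * x + (-t) * z) / f (T (s * x + (-t) * z))) + b * t) x := by
      intro x
      have i1 : HasDerivAt (fun x => s * x + (-t) * z) s x := by
        simpa using ((hasDerivAt_id x).const_mul s).add_const ((-t) * z)
      have i2 : HasDerivAt (fun x => -(-t) * x + s * z) t x := by
        simpa using ((hasDerivAt_id x).const_mul (-(-t))).add_const (s * z)
      have i3 := ((hT (s * x + (-t) * z)).comp x i1).const_mul a
      have i4 := i3.add (i2.const_mul b)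
      exact i4.congr_deriv (by ring)
    have inj : Function.Injective (fun x => a * T (s * x + (-t) * z) + b * (-(-t) * x + s * z)) :=
      (strictMono_of_deriv_pos fun x => by rw [(hd x).deriv]; exact dp x).injective
    have key := lintegral_image_eq_lintegral_abs_deriv_mul MeasurableSet.univ
      (fun x _ => (hd x).hasDerivWithinAt) inj.injOn (fun y => ENNReal.ofReal (g y))
    rw [Measure.restrict_univ] at key
    calc _ = ∫⁻ x, ENNReal.ofReal |a * s * (ph (s * x + (-t) * z) / f (T (s * x + (-t) * z))) + b * t| *
            ENNReal.ofReal (g (a * T (s * x + (-t) * z) + b * (-(-t) * x + s * z))) := by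
          refine lintegral_congr fun x => ?_
          simp only [Pi.mul_apply]
          rw [abs_of_pos (dp x), ← ENNReal.ofReal_mul (ph_pos x).le, ← ENNReal.ofReal_mul (dp x).le]
          congr 1
          have := (ph_pos x).ne'
          field_simp
      _ = _ := key.symm
      _ ≤ _ := (setLIntegral_le_lintegral _ _).trans gi.le
  rw [iA, iB, iC, iD] at I
  have I2 := I.trans (add_le_add_right (add_le_add_right (add_le_add_left iR _) _) _)
  rw [← ENNReal.ofReal_mul hl.le, ← ENNReal.ofReal_one, ← ENNReal.ofReal_add (by positivity) (by positivity),
    ← ENNReal.ofReal_add (by positivity) (by positivity), ← ENNReal.ofReal_add (by positivity) (by positivity),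
    show H0 + (1 + k1) = (H0 + k1) + 1 by ring, show l * H0 + (1 + k2) = (l * H0 + k2) + 1 by ring,
    ENNReal.ofReal_add (p := H0 + k1) (by positivity) (by positivity), ENNReal.ofReal_add (p := l * H0 + k2) (by positivity) (by positivity),
    ← add_assoc, ← add_assoc, ENNReal.add_le_add_iff_right ENNReal.ofReal_ne_top] at I2
  exact I2
end
end

section
open scoped BigOperators ENNReal
open MeasureTheory ProbabilityTheory
noncomputable section

/-- standard normal density in dimension `n` -/
def phn {n : ℕ} (x : Fin n → ℝ) : ℝ := ∏ i, ph (x i)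
/-- mixture density -/
def mixD {ι : Type} [Fintype ι] {n : ℕ} (w : ι → ℝ) (m : ι → Fin n → ℝ) (x : Fin n → ℝ) : ℝ :=
  ∑ k, w k * phn (x - m k)
/-- one-dimensional mixture density -/
def mix1 {ι : Type} [Fintype ι] (w : ι → ℝ) (m : ι → ℝ) (x : ℝ) : ℝ := ∑ k, w k * ph (x - m k)
/-- probability weights -/
def PW {ι : Type} [Fintype ι] (w : ι → ℝ) : Prop := (∀ k, 0 ≤ w k) ∧ ∑ k, w k = 1

lemma PW.ex {ι : Type} [Fintype ι] {w : ι → ℝ} (h : PW w) : ∃ k, 0 < w k := by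
  by_contra hc
  push Not at hc
  have := Finset.sum_nonpos (s := Finset.univ) (fun k _ => hc k)
  rw [h.2] at this; linarith

lemma PW.pos {ι : Type} [Fintype ι] {w : ι → ℝ} (h : PW w) {p : ι → ℝ} (hp : ∀ k, 0 < p k) : 0 < ∑ k, w k * p k := by
  obtain ⟨k, hk⟩ := h.ex
  exact Finset.sum_pos' (fun k _ => mul_nonneg (h.1 k) (hp k).le) ⟨k, Finset.mem_univ _, mul_pos hk (hp k)⟩

lemma PW.le_one {ι : Type} [Fintype ι] {w : ι → ℝ} (h : PW w) {p : ι → ℝ} (hp : ∀ k, p k ≤ 1) : ∑ k, w k * p k ≤ 1 := by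
  rw [← h.2]
  exact Finset.sum_le_sum fun k _ => mul_le_of_le_one_right (h.1 k) (hp k)

lemma phn_pos {n : ℕ} (x : Fin n → ℝ) : 0 < phn x := Finset.prod_pos fun i _ => ph_pos _
lemma phn_le_one {n : ℕ} (x : Fin n → ℝ) : phn x ≤ 1 :=
  Finset.prod_le_one (fun i _ => (ph_pos _).le) fun i _ => ph_le_one _
lemma phn_cont {n : ℕ} : Continuous (phn (n := n)) := by
  have := ph_cont
  unfold phn; fun_prop
lemma phn_cons {n : ℕ} (x : ℝ) (y : Fin n → ℝ) : phn (Fin.cons x y : Fin (n+1) → ℝ) = ph x * phn y := by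
  unfold phn; rw [Fin.prod_univ_succ]; simp

lemma mixD_pos {ι : Type} [Fintype ι] {n : ℕ} {w : ι → ℝ} (h : PW w) (m : ι → Fin n → ℝ) (x) : 0 < mixD w m x :=
  h.pos fun k => phn_pos _
lemma mixD_le {ι : Type} [Fintype ι] {n : ℕ} {w : ι → ℝ} (h : PW w) (m : ι → Fin n → ℝ) (x) : mixD w m x ≤ 1 :=
  h.le_one fun k => phn_le_one _
lemma mixD_cont {ι : Type} [Fintype ι] {n : ℕ} (w : ι → ℝ) (m : ι → Fin n → ℝ) : Continuous (mixD w m) := by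
  have := phn_cont (n := n)
  unfold mixD; fun_prop
lemma mix1_pos {ι : Type} [Fintype ι] {w : ι → ℝ} (h : PW w) (m : ι → ℝ) (x) : 0 < mix1 w m x :=
  h.pos fun k => ph_pos _
lemma mix1_le {ι : Type} [Fintype ι] {w : ι → ℝ} (h : PW w) (m : ι → ℝ) (x) : mix1 w m x ≤ 1 :=
  h.le_one fun k => ph_le_one _
lemma mix1_cont {ι : Type} [Fintype ι] (w : ι → ℝ) (m : ι → ℝ) : Continuous (mix1 w m) := by
  have := ph_cont
  unfold mix1; fun_prop

lemma PW.lint {ι X : Type} [Fintype ι] [MeasurableSpace X] {μ : Measure X} {w : ι → ℝ} (h : PW w) (p : ι → X → ℝ) (hp : ∀ k x, 0 ≤ p k x)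
    (hm : ∀ k, Measurable (p k)) (h1 : ∀ k, ∫⁻ x, ENNReal.ofReal (p k x) ∂μ = 1) :
    ∫⁻ x, ENNReal.ofReal (∑ k, w k * p k x) ∂μ = 1 := by
  have e : ∀ x, ENNReal.ofReal (∑ k, w k * p k x) = ∑ k, ENNReal.ofReal (w k) * ENNReal.ofReal (p k x) := by
    intro x
    rw [ENNReal.ofReal_sum_of_nonneg (fun k _ => mul_nonneg (h.1 k) (hp k x))]
    exact Finset.sum_congr rfl fun k _ => ENNReal.ofReal_mul (h.1 k)
  simp_rw [e]
  rw [lintegral_finsetSum _ (fun k _ => ((hm k).ennreal_ofReal).const_mul _)]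
  simp_rw [lintegral_const_mul _ ((hm _).ennreal_ofReal), h1, mul_one]
  rw [← ENNReal.ofReal_sum_of_nonneg (fun k _ => h.1 k), h.2, ENNReal.ofReal_one]

lemma mix1_lint {ι : Type} [Fintype ι] {w : ι → ℝ} (h : PW w) (m : ι → ℝ) : ∫⁻ x, ENNReal.ofReal (mix1 w m x) = 1 := by
  have hc := ph_cont
  refine h.lint (fun k x => ph (x - m k)) (fun k x => (ph_pos _).le) (fun k => by fun_prop) fun k => ?_
  rw [lintegral_sub_right_eq_self (fun x => ENNReal.ofReal (ph x)), ph_lint]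

lemma pfs {n : ℕ} (p : ℝ × (Fin n → ℝ)) :
    (MeasurableEquiv.piFinSuccAbove (fun _ : Fin (n+1) => ℝ) 0).symm p = Fin.cons p.1 p.2 := by
  change Fin.insertNth (α := fun _ => ℝ) 0 p.1 p.2 = _
  rw [Fin.insertNth_zero']

lemma lint_cons {n : ℕ} (h : (Fin (n+1) → ℝ) → ℝ≥0∞) (hh : Measurable h) :
    ∫⁻ x, h x = ∫⁻ y : Fin n → ℝ, ∫⁻ t : ℝ, h (Fin.cons t y) := by
  have e := (volume_preserving_piFinSuccAbove (fun _ : Fin (n+1) => ℝ) 0).symm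
  rw [← e.lintegral_comp hh]
  have m : Measurable fun p : ℝ × (Fin n → ℝ) => h ((MeasurableEquiv.piFinSuccAbove (fun _ : Fin (n+1) => ℝ) 0).symm p) :=
    hh.comp (MeasurableEquiv.measurable _)
  rw [show (volume : Measure (ℝ × (Fin n → ℝ))) = volume.prod volume from rfl, lintegral_prod_symm _ m.aemeasurable]
  simp_rw [pfs]

lemma meas_cons {n : ℕ} : Measurable fun p : ℝ × (Fin n → ℝ) => (Fin.cons p.1 p.2 : Fin (n+1) → ℝ) := by
  have := (MeasurableEquiv.piFinSuccAbove (fun _ : Fin (n+1) => ℝ) 0).symm.measurable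
  simpa only [← pfs] using this

lemma phn_lint (n : ℕ) : ∫⁻ x : Fin n → ℝ, ENNReal.ofReal (phn x) = 1 := by
  induction n with
  | zero => simp [phn, volume_pi, Measure.pi_empty_univ]
  | succ n ih =>
    have hm := (phn_cont (n := n+1)).measurable
    rw [lint_cons _ (by fun_prop)]
    have hp := ph_cont.measurable
    have hpn := (phn_cont (n := n)).measurable
    simp_rw [phn_cons, ENNReal.ofReal_mul (ph_pos _).le]
    simp_rw [lintegral_mul_const _ (hp.ennreal_ofReal), ph_lint, one_mul, ih]

lemma mixD_lint {ι : Type} [Fintype ι] {n : ℕ} {w : ι → ℝ} (h : PW w) (m : ι → Fin n → ℝ) :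
    ∫⁻ x, ENNReal.ofReal (mixD w m x) = 1 := by
  have hc := phn_cont (n := n)
  refine h.lint (fun k x => phn (x - m k)) (fun k x => (phn_pos _).le) (fun k => by fun_prop) fun k => ?_
  rw [lintegral_sub_right_eq_self (fun x => ENNReal.ofReal (phn x)), phn_lint]

/-- conditional weights -/
def cw {ι : Type} [Fintype ι] {n : ℕ} (w : ι → ℝ) (m : ι → Fin n → ℝ) (y : Fin n → ℝ) (k : ι) : ℝ :=
  w k * phn (y - m k) / mixD w m y

lemma cw_PW {ι : Type} [Fintype ι] {n : ℕ} {w : ι → ℝ} (h : PW w) (m : ι → Fin n → ℝ) (y : Fin n → ℝ) : PW (cw w m y) := by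
  refine ⟨fun k => div_nonneg (mul_nonneg (h.1 k) (phn_pos _).le) (mixD_pos h m y).le, ?_⟩
  unfold cw
  rw [← Finset.sum_div]
  exact div_self (mixD_pos h m y).ne'

lemma mixD_cons {ι : Type} [Fintype ι] {n : ℕ} {w : ι → ℝ} (h : PW w) (m : ι → Fin (n+1) → ℝ) (x : ℝ) (y : Fin n → ℝ) :
    mixD w m (Fin.cons x y) = mixD w (fun k => Fin.tail (m k)) y * mix1 (cw w (fun k => Fin.tail (m k)) y) (fun k => m k 0) x := by
  unfold mix1 cw
  rw [Finset.mul_sum]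
  conv_lhs => unfold mixD
  refine Finset.sum_congr rfl fun k _ => ?_
  have : (Fin.cons x y : Fin (n+1) → ℝ) - m k = Fin.cons (x - m k 0) (y - Fin.tail (m k)) := by
    ext i; refine Fin.cases ?_ (fun i => ?_) i <;> simp [Fin.tail]
  rw [this, phn_cons]
  have := (mixD_pos h (fun k => Fin.tail (m k)) y).ne'
  field_simp

lemma mix1_cw_meas {ι : Type} [Fintype ι] {n : ℕ} (w : ι → ℝ) (m : ι → Fin n → ℝ) (m0 : ι → ℝ) :
    Measurable fun p : ℝ × (Fin n → ℝ) => mix1 (cw w m p.2) m0 p.1 := by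
  have h1 := (phn_cont (n := n)).measurable
  have h2 := (mixD_cont w m).measurable
  have h3 := ph_cont.measurable
  unfold mix1 cw; fun_prop

/-- entropy functional -/
def entA {n : ℕ} (f : (Fin n → ℝ) → ℝ) : ℝ≥0∞ := ∫⁻ y, ENNReal.ofReal (f y) * ENNReal.ofReal (-Real.log (f y))
/-- cross entropy functional -/
def entB {n : ℕ} (a b : ℝ) (f g : (Fin n → ℝ) → ℝ) : ℝ≥0∞ :=
  ∫⁻ y, ∫⁻ z, ENNReal.ofReal (f y) * (ENNReal.ofReal (phn z) * ENNReal.ofReal (-Real.log (g (a • y + b • z))))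
/-- entropy functional, dimension one -/
def entA1 (f : ℝ → ℝ) : ℝ≥0∞ := ∫⁻ y, ENNReal.ofReal (f y) * ENNReal.ofReal (-Real.log (f y))
/-- cross entropy functional, dimension one -/
def entB1 (a b : ℝ) (f g : ℝ → ℝ) : ℝ≥0∞ :=
  ∫⁻ y, ∫⁻ z, ENNReal.ofReal (f y) * (ENNReal.ofReal (ph z) * ENNReal.ofReal (-Real.log (g (a * y + b * z))))

lemma nlog_mul {x y : ℝ} (hx : 0 < x) (hx1 : x ≤ 1) (hy : 0 < y) (hy1 : y ≤ 1) :
    ENNReal.ofReal (-Real.log (x * y)) = ENNReal.ofReal (-Real.log x) + ENNReal.ofReal (-Real.log y) := by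
  rw [Real.log_mul hx.ne' hy.ne', neg_add, ENNReal.ofReal_add]
  · have := Real.log_nonpos hx.le hx1; linarith
  · have := Real.log_nonpos hy.le hy1; linarith

lemma entA_succ {ι : Type} [Fintype ι] {n : ℕ} {w : ι → ℝ} (h : PW w) (m : ι → Fin (n+1) → ℝ) :
    entA (mixD w m) = ∫⁻ y, ENNReal.ofReal (mixD w (fun k => Fin.tail (m k)) y) *
      (ENNReal.ofReal (-Real.log (mixD w (fun k => Fin.tail (m k)) y)) +
        entA1 (mix1 (cw w (fun k => Fin.tail (m k)) y) (fun k => m k 0))) := by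
  have h2 := (mixD_cont w m).measurable
  unfold entA
  rw [lint_cons _ (by fun_prop)]
  refine lintegral_congr fun y => ?_
  have hw := cw_PW h (fun k => Fin.tail (m k)) y
  have h3 := (mix1_cont (cw w (fun k => Fin.tail (m k)) y) (fun k => m k 0)).measurable
  simp_rw [mixD_cons h, nlog_mul (mixD_pos h _ _) (mixD_le h _ _) (mix1_pos hw _ _) (mix1_le hw _ _),
    ENNReal.ofReal_mul (mixD_pos h _ _).le, mul_assoc]
  rw [lintegral_const_mul _ (by fun_prop)]
  congr 1
  simp_rw [mul_add]
  rw [lintegral_add_left (by fun_prop), lintegral_mul_const _ (by fun_prop), mix1_lint hw, one_mul]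
  rfl

lemma entB_succ {ι κ : Type} [Fintype ι] [Fintype κ] {n : ℕ} (a b : ℝ) {w : ι → ℝ} (h : PW w) (m : ι → Fin (n+1) → ℝ)
    {v : κ → ℝ} (hv : PW v) (μ : κ → Fin (n+1) → ℝ) :
    entB a b (mixD w m) (mixD v μ) = ∫⁻ y, ∫⁻ z, ENNReal.ofReal (mixD w (fun k => Fin.tail (m k)) y) * (ENNReal.ofReal (phn z) *
      (ENNReal.ofReal (-Real.log (mixD v (fun k => Fin.tail (μ k)) (a • y + b • z))) +
        entB1 a b (mix1 (cw w (fun k => Fin.tail (m k)) y) (fun k => m k 0))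
          (mix1 (cw v (fun k => Fin.tail (μ k)) (a • y + b • z)) (fun k => μ k 0)))) := by
  have h2 := (mixD_cont w m).measurable
  have h3 := (mixD_cont v μ).measurable
  have h4 := (phn_cont (n := n+1)).measurable
  have h5 := ph_cont.measurable
  unfold entB
  have mm : Measurable fun p : (Fin (n+1) → ℝ) × (Fin (n+1) → ℝ) =>
      ENNReal.ofReal (mixD w m p.1) * (ENNReal.ofReal (phn p.2) * ENNReal.ofReal (-Real.log (mixD v μ (a • p.1 + b • p.2)))) := by
    fun_prop
  rw [lint_cons _ mm.lintegral_prod_right']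
  refine lintegral_congr fun y => ?_
  have hh : ∀ t : ℝ, ∫⁻ z : Fin (n+1) → ℝ, ENNReal.ofReal (mixD w m (Fin.cons t y)) * (ENNReal.ofReal (phn z) *
      ENNReal.ofReal (-Real.log (mixD v μ (a • (Fin.cons t y : Fin (n+1) → ℝ) + b • z)))) =
      ∫⁻ z : Fin n → ℝ, ∫⁻ s : ℝ, ENNReal.ofReal (mixD w m (Fin.cons t y)) * (ENNReal.ofReal (phn (Fin.cons s z : Fin (n+1) → ℝ)) *
      ENNReal.ofReal (-Real.log (mixD v μ (a • (Fin.cons t y : Fin (n+1) → ℝ) + b • (Fin.cons s z : Fin (n+1) → ℝ))))) := by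
    intro t
    rw [lint_cons _ (by fun_prop)]
  simp_rw [hh]
  rw [lintegral_lintegral_swap]
  · refine lintegral_congr fun z => ?_
    have hw := cw_PW h (fun k => Fin.tail (m k)) y
    have hw' := cw_PW hv (fun k => Fin.tail (μ k)) (a • y + b • z)
    have h6 := (mix1_cont (cw w (fun k => Fin.tail (m k)) y) (fun k => m k 0)).measurable
    have h7 := (mix1_cont (cw v (fun k => Fin.tail (μ k)) (a • y + b • z)) (fun k => μ k 0)).measurable
    have e : ∀ t s : ℝ, a • (Fin.cons t y : Fin (n+1) → ℝ) + b • (Fin.cons s z : Fin (n+1) → ℝ) = Fin.cons (a * t + b * s) (a • y + b • z) := by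
      intro t s
      ext i; refine Fin.cases ?_ (fun i => ?_) i <;> simp
    simp_rw [e, mixD_cons h, mixD_cons hv, phn_cons, nlog_mul (mixD_pos hv _ _) (mixD_le hv _ _) (mix1_pos hw' _ _) (mix1_le hw' _ _),
      ENNReal.ofReal_mul (mixD_pos h _ _).le, ENNReal.ofReal_mul (ph_pos _).le]
    generalize ENNReal.ofReal (mixD w (fun k => Fin.tail (m k)) y) = A
    generalize ENNReal.ofReal (phn z) = B
    generalize ENNReal.ofReal (-Real.log (mixD v (fun k => Fin.tail (μ k)) (a • y + b • z))) = D
    unfold entB1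
    set F := mix1 (cw w (fun k => Fin.tail (m k)) y) (fun k => m k 0) with hF
    set G := mix1 (cw v (fun k => Fin.tail (μ k)) (a • y + b • z)) (fun k => μ k 0) with hG
    have e2 : ∀ t s : ℝ, A * ENNReal.ofReal (F t) * (ENNReal.ofReal (ph s) * B * (D + ENNReal.ofReal (-Real.log (G (a * t + b * s)))))
      = A * (B * (ENNReal.ofReal (F t) * (ENNReal.ofReal (ph s) * D) + ENNReal.ofReal (F t) * (ENNReal.ofReal (ph s) * ENNReal.ofReal (-Real.log (G (a * t + b * s)))))) := by
      intro t s; ring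
    simp_rw [e2]
    have mG : Measurable fun p : ℝ × ℝ => ENNReal.ofReal (F p.1) * (ENNReal.ofReal (ph p.2) * D) + ENNReal.ofReal (F p.1) * (ENNReal.ofReal (ph p.2) * ENNReal.ofReal (-Real.log (G (a * p.1 + b * p.2)))) := by
      fun_prop
    have i1 : ∀ t : ℝ, ∫⁻ s : ℝ, A * (B * (ENNReal.ofReal (F t) * (ENNReal.ofReal (ph s) * D) + ENNReal.ofReal (F t) * (ENNReal.ofReal (ph s) * ENNReal.ofReal (-Real.log (G (a * t + b * s))))))
       = A * (B * (ENNReal.ofReal (F t) * D + ∫⁻ s, ENNReal.ofReal (F t) * (ENNReal.ofReal (ph s) * ENNReal.ofReal (-Real.log (G (a * t + b * s)))))) := by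
      intro t
      rw [lintegral_const_mul _ (by fun_prop), lintegral_const_mul _ (by fun_prop), lintegral_add_left (by fun_prop),
        lintegral_const_mul _ (by fun_prop), lintegral_mul_const _ (by fun_prop), ph_lint, one_mul]
    simp_rw [i1]
    have mI : Measurable fun t : ℝ => ∫⁻ s, ENNReal.ofReal (F t) * (ENNReal.ofReal (ph s) * ENNReal.ofReal (-Real.log (G (a * t + b * s)))) := by
      have mG2 : Measurable fun p : ℝ × ℝ => ENNReal.ofReal (F p.1) * (ENNReal.ofReal (ph p.2) * ENNReal.ofReal (-Real.log (G (a * p.1 + b * p.2)))) := by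
        fun_prop
      exact mG2.lintegral_prod_right'
    rw [lintegral_const_mul _ (by fun_prop), lintegral_const_mul _ (by fun_prop), lintegral_add_left (by fun_prop),
      lintegral_mul_const _ (by fun_prop), hF, mix1_lint hw, one_mul]
  · have c1 : Measurable fun p : (ℝ × (Fin n → ℝ)) × ℝ => (Fin.cons p.1.1 y : Fin (n+1) → ℝ) :=
      meas_cons.comp (f := fun p : (ℝ × (Fin n → ℝ)) × ℝ => (p.1.1, y)) (by fun_prop)
    have c2 : Measurable fun p : (ℝ × (Fin n → ℝ)) × ℝ => (Fin.cons p.2 p.1.2 : Fin (n+1) → ℝ) :=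
      meas_cons.comp (f := fun p : (ℝ × (Fin n → ℝ)) × ℝ => (p.2, p.1.2)) (by fun_prop)
    have c3 := (mm.comp (c1.prodMk c2)).lintegral_prod_right' (ν := (volume : Measure ℝ))
    simp only [Function.comp] at c3
    exact c3.aemeasurable
end
end

section
open scoped BigOperators ENNReal
open MeasureTheory ProbabilityTheory
noncomputable section

lemma entA1_meas {ι : Type} [Fintype ι] {n : ℕ} (w : ι → ℝ) (m : ι → Fin n → ℝ) (m0 : ι → ℝ) :
    Measurable fun y => entA1 (mix1 (cw w m y) m0) := by
  have h := mix1_cw_meas w m m0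
  have h2 : Measurable fun p : ℝ × (Fin n → ℝ) => ENNReal.ofReal (mix1 (cw w m p.2) m0 p.1) *
    ENNReal.ofReal (-Real.log (mix1 (cw w m p.2) m0 p.1)) := by fun_prop
  exact h2.lintegral_prod_left'

lemma epi_n (a b l c1 c2 : ℝ)
    (H : ∀ f g : ℝ → ℝ, Continuous f → (∀ x, 0 < f x) → (∀ x, f x ≤ 1) → ∫⁻ x, ENNReal.ofReal (f x) = 1 →
        Continuous g → (∀ x, 0 < g x) → (∀ x, g x ≤ 1) → ∫⁻ x, ENNReal.ofReal (g x) = 1 →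
        ENNReal.ofReal l * entA1 f + ENNReal.ofReal c1 ≤ entB1 a b f g + ENNReal.ofReal c2)
    {ι κ : Type} [Fintype ι] [Fintype κ] {w : ι → ℝ} (hw : PW w) {v : κ → ℝ} (hv : PW v) (n : ℕ)
    (m : ι → Fin n → ℝ) (μ : κ → Fin n → ℝ) :
    ENNReal.ofReal l * entA (mixD w m) + n * ENNReal.ofReal c1 ≤ entB a b (mixD w m) (mixD v μ) + n * ENNReal.ofReal c2 := by
  induction n with
  | zero =>
    have : entA (mixD w m) = 0 := by
      unfold entA mixD phn
      simp [hw.2]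
    simp [this]
  | succ n ih =>
    have IH := ih (fun k => Fin.tail (m k)) (fun k => Fin.tail (μ k))
    rw [entA_succ hw, entB_succ a b hw m hv μ]
    have mA := entA1_meas w (fun k => Fin.tail (m k)) (fun k => m k 0)
    have mf := (mixD_cont w (fun k => Fin.tail (m k))).measurable
    have mg := (mixD_cont v (fun k => Fin.tail (μ k))).measurable
    have mp := (phn_cont (n := n)).measurable
    set f := mixD w (fun k => Fin.tail (m k)) with hf
    set g := mixD v (fun k => Fin.tail (μ k)) with hg
    set A : (Fin n → ℝ) → ℝ≥0∞ := fun y => entA1 (mix1 (cw w (fun k => Fin.tail (m k)) y) (fun k => m k 0)) with hA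
    set B : (Fin n → ℝ) → (Fin n → ℝ) → ℝ≥0∞ := fun y z => entB1 a b (mix1 (cw w (fun k => Fin.tail (m k)) y) (fun k => m k 0))
          (mix1 (cw v (fun k => Fin.tail (μ k)) (a • y + b • z)) (fun k => μ k 0)) with hB
    have hAB : ∀ y z, ENNReal.ofReal l * A y + ENNReal.ofReal c1 ≤ B y z + ENNReal.ofReal c2 := fun y z =>
      H _ _ (mix1_cont _ _) (mix1_pos (cw_PW hw _ _) _) (mix1_le (cw_PW hw _ _) _) (mix1_lint (cw_PW hw _ _) _)
        (mix1_cont _ _) (mix1_pos (cw_PW hv _ _) _) (mix1_le (cw_PW hv _ _) _) (mix1_lint (cw_PW hv _ _) _)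
    have fi : ∫⁻ y, ENNReal.ofReal (f y) = 1 := mixD_lint hw _
    have pI := phn_lint n
    have e1 : ∫⁻ y, ENNReal.ofReal (f y) * (ENNReal.ofReal (-Real.log (f y)) + A y) = entA f + ∫⁻ y, ENNReal.ofReal (f y) * A y := by
      simp_rw [mul_add]
      rw [lintegral_add_left (by fun_prop)]
      rfl
    have e2 : (∫⁻ y, ∫⁻ z, ENNReal.ofReal (f y) * (ENNReal.ofReal (phn z) * (ENNReal.ofReal (-Real.log (g (a • y + b • z))) + B y z))) + ENNReal.ofReal c2
       = ∫⁻ y, ∫⁻ z, ENNReal.ofReal (f y) * (ENNReal.ofReal (phn z) * (ENNReal.ofReal (-Real.log (g (a • y + b • z))) + (B y z + ENNReal.ofReal c2))) := by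
      have k1 : ∀ y, ∫⁻ z, ENNReal.ofReal (f y) * (ENNReal.ofReal (phn z) * (ENNReal.ofReal (-Real.log (g (a • y + b • z))) + (B y z + ENNReal.ofReal c2)))
        = (∫⁻ z, ENNReal.ofReal (f y) * (ENNReal.ofReal (phn z) * (ENNReal.ofReal (-Real.log (g (a • y + b • z))) + B y z))) + ENNReal.ofReal (f y) * ENNReal.ofReal c2 := by
        intro y
        have : ∀ z, ENNReal.ofReal (f y) * (ENNReal.ofReal (phn z) * (ENNReal.ofReal (-Real.log (g (a • y + b • z))) + (B y z + ENNReal.ofReal c2)))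
          = ENNReal.ofReal (f y) * (ENNReal.ofReal (phn z) * (ENNReal.ofReal (-Real.log (g (a • y + b • z))) + B y z)) + ENNReal.ofReal (phn z) * (ENNReal.ofReal (f y) * ENNReal.ofReal c2) := by
          intro z; ring
        simp_rw [this]
        rw [lintegral_add_right _ (by fun_prop), lintegral_mul_const _ (by fun_prop), pI, one_mul]
      simp_rw [k1]
      rw [lintegral_add_right _ (by fun_prop), lintegral_mul_const _ (by fun_prop), fi, one_mul]
    have e3 : (∫⁻ y, ∫⁻ z, ENNReal.ofReal (f y) * (ENNReal.ofReal (phn z) * (ENNReal.ofReal (-Real.log (g (a • y + b • z))) + (ENNReal.ofReal l * A y + ENNReal.ofReal c1))))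
       = entB a b f g + (ENNReal.ofReal l * (∫⁻ y, ENNReal.ofReal (f y) * A y) + ENNReal.ofReal c1) := by
      have k1 : ∀ y, ∫⁻ z, ENNReal.ofReal (f y) * (ENNReal.ofReal (phn z) * (ENNReal.ofReal (-Real.log (g (a • y + b • z))) + (ENNReal.ofReal l * A y + ENNReal.ofReal c1)))
        = (∫⁻ z, ENNReal.ofReal (f y) * (ENNReal.ofReal (phn z) * (ENNReal.ofReal (-Real.log (g (a • y + b • z)))))) + (ENNReal.ofReal l * (ENNReal.ofReal (f y) * A y) + ENNReal.ofReal (f y) * ENNReal.ofReal c1) := by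
        intro y
        have : ∀ z, ENNReal.ofReal (f y) * (ENNReal.ofReal (phn z) * (ENNReal.ofReal (-Real.log (g (a • y + b • z))) + (ENNReal.ofReal l * A y + ENNReal.ofReal c1)))
          = ENNReal.ofReal (f y) * (ENNReal.ofReal (phn z) * (ENNReal.ofReal (-Real.log (g (a • y + b • z))))) + ENNReal.ofReal (phn z) * (ENNReal.ofReal l * (ENNReal.ofReal (f y) * A y) + ENNReal.ofReal (f y) * ENNReal.ofReal c1) := by
          intro z; ring
        simp_rw [this]
        rw [lintegral_add_right _ (by fun_prop), lintegral_mul_const _ (by fun_prop), pI, one_mul]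
      simp_rw [k1]
      rw [lintegral_add_right _ (by fun_prop), lintegral_add_right _ (by fun_prop), lintegral_const_mul _ (by fun_prop), lintegral_mul_const _ (by fun_prop), fi, one_mul]
      rfl
    have e4 : (∫⁻ y, ∫⁻ z, ENNReal.ofReal (f y) * (ENNReal.ofReal (phn z) * (ENNReal.ofReal (-Real.log (g (a • y + b • z))) + (ENNReal.ofReal l * A y + ENNReal.ofReal c1))))
       ≤ ∫⁻ y, ∫⁻ z, ENNReal.ofReal (f y) * (ENNReal.ofReal (phn z) * (ENNReal.ofReal (-Real.log (g (a • y + b • z))) + (B y z + ENNReal.ofReal c2))) := by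
      refine lintegral_mono fun y => lintegral_mono fun z => ?_
      exact mul_le_mul_right (mul_le_mul_right (add_le_add_right (hAB y z) _) _) _
    rw [e1]
    push_cast
    calc ENNReal.ofReal l * (entA f + ∫⁻ y, ENNReal.ofReal (f y) * A y) + (n + 1) * ENNReal.ofReal c1
        = (ENNReal.ofReal l * entA f + n * ENNReal.ofReal c1) + (ENNReal.ofReal l * (∫⁻ y, ENNReal.ofReal (f y) * A y) + ENNReal.ofReal c1) := by ring
      _ ≤ (entB a b f g + n * ENNReal.ofReal c2) + (ENNReal.ofReal l * (∫⁻ y, ENNReal.ofReal (f y) * A y) + ENNReal.ofReal c1) := add_le_add IH le_rfl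
      _ = n * ENNReal.ofReal c2 + (entB a b f g + (ENNReal.ofReal l * (∫⁻ y, ENNReal.ofReal (f y) * A y) + ENNReal.ofReal c1)) := by ring
      _ ≤ n * ENNReal.ofReal c2 + ((∫⁻ y, ∫⁻ z, ENNReal.ofReal (f y) * (ENNReal.ofReal (phn z) * (ENNReal.ofReal (-Real.log (g (a • y + b • z))) + B y z))) + ENNReal.ofReal c2) := by
          rw [e2, ← e3]; exact add_le_add le_rfl e4
      _ = _ := by ring
end
end

section
open scoped BigOperators ENNReal
open MeasureTheory ProbabilityTheory
noncomputable section

lemma lint_prod_fin (n : ℕ) (f : Fin n → ℝ → ℝ≥0∞) (hf : ∀ i, Measurable (f i)) :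
    ∫⁻ x : Fin n → ℝ, ∏ i, f i (x i) = ∏ i, ∫⁻ t, f i t := by
  induction n with
  | zero => simp [volume_pi, Measure.pi_empty_univ]
  | succ n ih =>
    have mm : Measurable fun x : Fin (n+1) → ℝ => ∏ i, f i (x i) := Finset.measurable_prod _ fun i _ => (hf i).comp (measurable_pi_apply i)
    rw [lint_cons _ mm]
    simp_rw [Fin.prod_univ_succ, Fin.cons_zero, Fin.cons_succ]
    simp_rw [lintegral_mul_const _ (hf 0)]
    rw [lintegral_const_mul, ih _ fun i => hf _]
    exact Finset.measurable_prod _ fun i _ => (hf _).comp (measurable_pi_apply i)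

lemma stdGaussN_wd (n : ℕ) : stdGaussN n = volume.withDensity (fun x : Fin n → ℝ => ENNReal.ofReal (phn x)) := by
  unfold stdGaussN
  refine Measure.pi_eq (μ := fun _ : Fin n => gaussianReal 0 1) fun s hs => ?_
  have hp := ph_cont.measurable
  rw [withDensity_apply _ (MeasurableSet.univ_pi hs), ← lintegral_indicator (MeasurableSet.univ_pi hs)]
  have : ∀ x : Fin n → ℝ, (Set.pi Set.univ s).indicator (fun x : Fin n → ℝ => ENNReal.ofReal (phn x)) x
      = ∏ i, (s i).indicator (fun t => ENNReal.ofReal (ph t)) (x i) := by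
    intro x
    by_cases h : x ∈ Set.pi Set.univ s
    · rw [Set.indicator_of_mem h, phn, ENNReal.ofReal_prod_of_nonneg (fun i _ => (ph_pos _).le)]
      exact Finset.prod_congr rfl fun i _ => (Set.indicator_of_mem (h i (Set.mem_univ i)) (fun t => ENNReal.ofReal (ph t))).symm
    · rw [Set.indicator_of_notMem h]
      simp only [Set.mem_pi, Set.mem_univ, true_implies, not_forall] at h
      obtain ⟨i, hi⟩ := h
      exact (Finset.prod_eq_zero (Finset.mem_univ i) (Set.indicator_of_notMem hi _)).symm
  simp_rw [this]
  rw [lint_prod_fin n (fun i => (s i).indicator (fun t => ENNReal.ofReal (ph t))) fun i => (Measurable.indicator (by fun_prop) (hs i))]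
  refine Finset.prod_congr rfl fun i _ => ?_
  rw [lintegral_indicator (hs i), gauss_wd, withDensity_apply _ (hs i)]

/-- mixture law -/
def mixM {ι : Type} [Fintype ι] {n : ℕ} (w : ι → ℝ) (m : ι → Fin n → ℝ) : Measure (Fin n → ℝ) :=
  volume.withDensity (fun y => ENNReal.ofReal (mixD w m y))

lemma lint_mixM' {ι : Type} [Fintype ι] {n : ℕ} (w : ι → ℝ) (m : ι → Fin n → ℝ) {h : (Fin n → ℝ) → ℝ≥0∞} (hh : Measurable h) :
    ∫⁻ y, h y ∂(mixM w m) = ∫⁻ y, ENNReal.ofReal (mixD w m y) * h y := by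
  have := (mixD_cont w m).measurable
  unfold mixM
  rw [lintegral_withDensity_eq_lintegral_mul _ (by fun_prop) hh]; rfl

lemma lint_gaussN {n : ℕ} {h : (Fin n → ℝ) → ℝ≥0∞} (hh : Measurable h) :
    ∫⁻ z, h z ∂(stdGaussN n) = ∫⁻ z, ENNReal.ofReal (phn z) * h z := by
  have := (phn_cont (n := n)).measurable
  rw [stdGaussN_wd, lintegral_withDensity_eq_lintegral_mul _ (by fun_prop) hh]; rfl

lemma lint_mixM {ι : Type} [Fintype ι] {n : ℕ} {w : ι → ℝ} (hw : PW w) (m : ι → Fin n → ℝ) {h : (Fin n → ℝ) → ℝ≥0∞} (hh : Measurable h) :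
    ∫⁻ y, h y ∂(mixM w m) = ∑ k, ENNReal.ofReal (w k) * ∫⁻ z, h (m k + z) ∂(stdGaussN n) := by
  have hp := (phn_cont (n := n)).measurable
  rw [lint_mixM' w m hh]
  have e : ∀ y, ENNReal.ofReal (mixD w m y) * h y = ∑ k, ENNReal.ofReal (w k) * (ENNReal.ofReal (phn (y - m k)) * h y) := by
    intro y
    unfold mixD
    rw [ENNReal.ofReal_sum_of_nonneg (fun k _ => mul_nonneg (hw.1 k) (phn_pos _).le), Finset.sum_mul]
    refine Finset.sum_congr rfl fun k _ => ?_
    rw [ENNReal.ofReal_mul (hw.1 k), mul_assoc]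
  simp_rw [e]
  rw [lintegral_finsetSum _ fun k _ => by fun_prop]
  refine Finset.sum_congr rfl fun k _ => ?_
  rw [lintegral_const_mul _ (by fun_prop), lint_gaussN (by fun_prop)]
  congr 1
  rw [← lintegral_add_left_eq_self (fun y => ENNReal.ofReal (phn (y - m k)) * h y) (m k)]
  simp

lemma mixM_eq {ι : Type} [Fintype ι] {n : ℕ} {w : ι → ℝ} (hw : PW w) (m : ι → Fin n → ℝ) :
    mixM w m = ∑ k, ENNReal.ofReal (w k) • (stdGaussN n).map (fun z => m k + z) := by
  refine Measure.ext_of_lintegral _ fun h hh => ?_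
  rw [lint_mixM hw m hh, lintegral_finsetSum_measure]
  refine Finset.sum_congr rfl fun k _ => ?_
  rw [lintegral_smul_measure, lintegral_map hh (by fun_prop)]; rfl

lemma mixM_apply {ι : Type} [Fintype ι] {n : ℕ} {w : ι → ℝ} (hw : PW w) (m : ι → Fin n → ℝ) (s : Set (Fin n → ℝ)) :
    (mixM w m s).toReal = ∑ k, w k * (stdGaussN n {z | m k + z ∈ s}).toReal := by
  rw [mixM_eq hw, Measure.finsetSum_apply, ENNReal.toReal_sum]
  · refine Finset.sum_congr rfl fun k _ => ?_
    rw [Measure.smul_apply, smul_eq_mul, ENNReal.toReal_mul, ENNReal.toReal_ofReal (hw.1 k)]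
    congr 2
    exact (MeasurableEquiv.addLeft (m k)).map_apply s
  · intro k _
    have : IsProbabilityMeasure ((stdGaussN n).map (fun z => m k + z)) := Measure.isProbabilityMeasure_map (by fun_prop)
    rw [Measure.smul_apply, smul_eq_mul]
    exact ENNReal.mul_ne_top ENNReal.ofReal_ne_top (measure_ne_top _ _)

lemma mixM_prob {ι : Type} [Fintype ι] {n : ℕ} {w : ι → ℝ} (hw : PW w) (m : ι → Fin n → ℝ) : IsProbabilityMeasure (mixM w m) :=
  ⟨by rw [mixM, withDensity_apply _ MeasurableSet.univ]; simpa using mixD_lint hw m⟩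

lemma mixM_integrable {ι : Type} [Fintype ι] {n : ℕ} {w : ι → ℝ} (hw : PW w) (m : ι → Fin n → ℝ) {h : (Fin n → ℝ) → ℝ}
    (hm : Measurable h) (hi : ∀ k, Integrable (fun z => h (m k + z)) (stdGaussN n)) : Integrable h (mixM w m) := by
  rw [mixM_eq hw, integrable_finsetSum_measure]
  intro k _
  refine Integrable.smul_measure ?_ ENNReal.ofReal_ne_top
  exact (integrable_map_measure hm.aestronglyMeasurable (by fun_prop)).2 (hi k)

lemma mixM_integral {ι : Type} [Fintype ι] {n : ℕ} {w : ι → ℝ} (hw : PW w) (m : ι → Fin n → ℝ) {h : (Fin n → ℝ) → ℝ}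
    (hm : Measurable h) (hi : ∀ k, Integrable (fun z => h (m k + z)) (stdGaussN n)) :
    ∫ y, h y ∂(mixM w m) = ∑ k, w k * ∫ z, h (m k + z) ∂(stdGaussN n) := by
  rw [mixM_eq hw, integral_finsetSum_measure]
  · refine Finset.sum_congr rfl fun k _ => ?_
    rw [integral_smul_measure, integral_map (by fun_prop) hm.aestronglyMeasurable, ENNReal.toReal_ofReal (hw.1 k), smul_eq_mul]
  · intro k _
    refine Integrable.smul_measure ?_ ENNReal.ofReal_ne_top
    exact (integrable_map_measure hm.aestronglyMeasurable (by fun_prop)).2 (hi k)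

lemma gN_coord {n : ℕ} (i : Fin n) {h : ℝ → ℝ} (hi : Integrable h (gaussianReal 0 1)) :
    Integrable (fun z : Fin n → ℝ => h (z i)) (stdGaussN n) ∧ ∫ z : Fin n → ℝ, h (z i) ∂(stdGaussN n) = ∫ x, h x ∂(gaussianReal 0 1) := by
  have e : MeasurePreserving (Function.eval i) (stdGaussN n) (gaussianReal 0 1) := measurePreserving_eval (fun _ : Fin n => gaussianReal 0 1) i
  refine ⟨e.integrable_comp_of_integrable hi, ?_⟩
  have hm : AEStronglyMeasurable h (Measure.map (Function.eval i) (stdGaussN n)) := by rw [e.map_eq]; exact hi.aestronglyMeasurable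
  conv_rhs => rw [← e.map_eq]
  rw [integral_map e.measurable.aemeasurable hm]

lemma int_sq_shift (c : ℝ) : Integrable (fun x : ℝ => (c + x) ^ 2) (gaussianReal 0 1) ∧
    ∫ x, (c + x) ^ 2 ∂(gaussianReal 0 1) = c ^ 2 + 1 := by
  have e : (fun x : ℝ => (c + x) ^ 2) = fun x => (c ^ 2 + 2 * c * x) + x ^ 2 := by ext x; ring
  have i1 : Integrable (fun x : ℝ => x) (gaussianReal 0 1) := (memLp_id_gaussianReal' (μ := 0) (v := 1) 1 (by simp)).integrable le_rfl
  have i2 : Integrable (fun x : ℝ => c ^ 2 + 2 * c * x) (gaussianReal 0 1) := (integrable_const _).add (i1.const_mul _)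
  rw [e]
  refine ⟨i2.add sq_int_gauss, ?_⟩
  rw [integral_add i2 sq_int_gauss, int_sq_gauss, integral_add (integrable_const _) (i1.const_mul _), integral_const_mul, integral_id_gaussianReal]
  simp

lemma int_sqN {n : ℕ} (c : Fin n → ℝ) : Integrable (fun z : Fin n → ℝ => ∑ i, (c i + z i) ^ 2) (stdGaussN n) ∧
    ∫ z : Fin n → ℝ, ∑ i, (c i + z i) ^ 2 ∂(stdGaussN n) = ∑ i, c i ^ 2 + n := by
  have h := fun i => gN_coord (n := n) i (int_sq_shift (c i)).1
  refine ⟨integrable_finsetSum _ fun i _ => (h i).1, ?_⟩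
  rw [integral_finsetSum _ fun i _ => (h i).1]
  simp_rw [(h _).2, (int_sq_shift _).2, Finset.sum_add_distrib]
  simp

lemma mixM_sq {ι : Type} [Fintype ι] {n : ℕ} {w : ι → ℝ} (hw : PW w) (m : ι → Fin n → ℝ) (c : Fin n → ℝ) :
    Integrable (fun y : Fin n → ℝ => ∑ i, (y i - c i) ^ 2) (mixM w m) ∧
    ∫ y : Fin n → ℝ, ∑ i, (y i - c i) ^ 2 ∂(mixM w m) = ∑ k, w k * ∑ i, (m k i - c i) ^ 2 + n := by
  have hm : Measurable fun y : Fin n → ℝ => ∑ i, (y i - c i) ^ 2 := by fun_prop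
  have e : ∀ k, (fun z : Fin n → ℝ => ∑ i, ((m k + z) i - c i) ^ 2) = fun z => ∑ i, ((m k i - c i) + z i) ^ 2 := by
    intro k; ext z; refine Finset.sum_congr rfl fun i _ => ?_
    simp only [Pi.add_apply]; ring
  have hi : ∀ k, Integrable (fun z : Fin n → ℝ => ∑ i, ((m k + z) i - c i) ^ 2) (stdGaussN n) := by
    intro k; rw [e]; exact (int_sqN fun i => m k i - c i).1
  refine ⟨mixM_integrable hw m hm hi, ?_⟩
  rw [mixM_integral hw m hm hi]
  simp_rw [e, (int_sqN _).2, mul_add, Finset.sum_add_distrib, ← Finset.sum_mul, hw.2, one_mul]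

lemma log_phn {n : ℕ} (x : Fin n → ℝ) : Real.log (phn x) = -(n / 2) * Real.log (2 * Real.pi) - (∑ i, x i ^ 2) / 2 := by
  unfold phn
  rw [Real.log_prod (fun i _ => (ph_pos _).ne')]
  simp_rw [log_ph, Finset.sum_sub_distrib, Finset.sum_div]
  simp; ring

lemma nlog_mix_nonneg {ι : Type} [Fintype ι] {n : ℕ} {w : ι → ℝ} (hw : PW w) (m : ι → Fin n → ℝ) (x) : 0 ≤ -Real.log (mixD w m x) := by
  have := Real.log_nonpos (mixD_pos hw m x).le (mixD_le hw m x); linarith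

lemma nlog_mix_int {ι κ : Type} [Fintype ι] [Fintype κ] {n : ℕ} {w : ι → ℝ} (hw : PW w) (m : ι → Fin n → ℝ) {v : κ → ℝ} (hv : PW v) (μ : κ → Fin n → ℝ) :
    Integrable (fun y => -Real.log (mixD v μ y)) (mixM w m) := by
  have := mixM_prob hw m
  have hm := (mixD_cont v μ).measurable
  obtain ⟨k, hk⟩ := hv.ex
  refine Integrable.mono' (g := fun y => (-Real.log (v k) + (n / 2) * Real.log (2 * Real.pi)) + (∑ i, (y i - μ k i) ^ 2) / 2) ?_ (Measurable.aestronglyMeasurable (by fun_prop)) ?_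
  · exact (integrable_const _).add ((mixM_sq hw m (μ k)).1.div_const 2)
  · refine Filter.Eventually.of_forall fun y => ?_
    rw [Real.norm_of_nonneg (nlog_mix_nonneg hv μ y)]
    have h1 : v k * phn (y - μ k) ≤ mixD v μ y :=
      Finset.single_le_sum (f := fun k => v k * phn (y - μ k)) (fun j _ => mul_nonneg (hv.1 j) (phn_pos _).le) (Finset.mem_univ k)
    have h2 := Real.log_le_log (mul_pos hk (phn_pos _)) h1
    rw [Real.log_mul hk.ne' (phn_pos _).ne', log_phn] at h2
    simp only [Pi.sub_apply] at h2
    linarith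

/-- mixture entropy -/
def hm {ι : Type} [Fintype ι] {n : ℕ} (w : ι → ℝ) (m : ι → Fin n → ℝ) : ℝ := ∫ y, -Real.log (mixD w m y) ∂(mixM w m)

lemma hm_lint {ι κ : Type} [Fintype ι] [Fintype κ] {n : ℕ} {w : ι → ℝ} (hw : PW w) (m : ι → Fin n → ℝ) {v : κ → ℝ} (hv : PW v) (μ : κ → Fin n → ℝ) :
    ∫⁻ y, ENNReal.ofReal (-Real.log (mixD v μ y)) ∂(mixM w m) = ENNReal.ofReal (∫ y, -Real.log (mixD v μ y) ∂(mixM w m)) :=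
  (ofReal_integral_eq_lintegral_ofReal (nlog_mix_int hw m hv μ) (Filter.Eventually.of_forall fun y => nlog_mix_nonneg hv μ y)).symm

lemma hm_nonneg {ι : Type} [Fintype ι] {n : ℕ} {w : ι → ℝ} (hw : PW w) (m : ι → Fin n → ℝ) : 0 ≤ hm w m :=
  integral_nonneg fun y => nlog_mix_nonneg hw m y

lemma entA_eq {ι : Type} [Fintype ι] {n : ℕ} {w : ι → ℝ} (hw : PW w) (m : ι → Fin n → ℝ) : entA (mixD w m) = ENNReal.ofReal (hm w m) := by
  have := (mixD_cont w m).measurable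
  unfold hm
  rw [← hm_lint hw m hw m, lint_mixM' w m (by fun_prop)]; rfl

lemma entB_eq {ι : Type} [Fintype ι] {n : ℕ} (a b : ℝ) (hab : a ^ 2 + b ^ 2 = 1) {w : ι → ℝ} (hw : PW w) (m : ι → Fin n → ℝ) :
    entB a b (mixD w m) (mixD w fun k => a • m k) = ENNReal.ofReal (hm w fun k => a • m k) := by
  have hg := (mixD_cont w fun k => a • m k).measurable
  have hf := (mixD_cont w m).measurable
  have hp := (phn_cont (n := n)).measurable
  unfold hm
  rw [← hm_lint hw _ hw]
  obtain ⟨g, hgd⟩ : ∃ g : (Fin n → ℝ) → ℝ≥0∞, g = fun y => ENNReal.ofReal (-Real.log (mixD w (fun k => a • m k) y)) := ⟨_, rfl⟩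
  have mg : Measurable g := by rw [hgd]; fun_prop
  have e1 : entB a b (mixD w m) (mixD w fun k => a • m k) = ∫⁻ y, ∫⁻ z, g (a • y + b • z) ∂(stdGaussN n) ∂(mixM w m) := by
    have mI : Measurable fun y => ∫⁻ z, g (a • y + b • z) ∂(stdGaussN n) := by
      have : Measurable fun p : (Fin n → ℝ) × (Fin n → ℝ) => g (a • p.1 + b • p.2) := by fun_prop
      exact this.lintegral_prod_right'
    rw [lint_mixM' w m mI]
    unfold entB
    refine lintegral_congr fun y => ?_
    rw [lint_gaussN (by fun_prop), ← lintegral_const_mul _ (by fun_prop), hgd]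
  rw [e1]
  have mI : Measurable fun y => ∫⁻ z, g (a • y + b • z) ∂(stdGaussN n) := by
    have : Measurable fun p : (Fin n → ℝ) × (Fin n → ℝ) => g (a • p.1 + b • p.2) := by fun_prop
    exact this.lintegral_prod_right'
  rw [lint_mixM hw m mI]
  change _ = ∫⁻ y, (fun y => ENNReal.ofReal (-Real.log (mixD w (fun k => a • m k) y))) y ∂(mixM w fun k => a • m k)
  rw [← hgd, lint_mixM hw _ mg]
  refine Finset.sum_congr rfl fun k _ => ?_
  congr 1
  have m3 : Measurable fun z : Fin n → ℝ => g (a • m k + z) := by fun_prop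
  rw [← (stdGaussN_lc n a b hab).lintegral_comp m3]
  have m4 : Measurable fun p : (Fin n → ℝ) × (Fin n → ℝ) => g (a • m k + (a • p.1 + b • p.2)) := by fun_prop
  rw [lintegral_prod _ m4.aemeasurable]
  simp_rw [smul_add, add_assoc]

lemma epi_real (a l : ℝ) (ha : 0 < a) (ha1 : a < 1) (hl : 0 < l) (hl1 : l < 1) {ι : Type} [Fintype ι] {n : ℕ} {w : ι → ℝ} (hw : PW w) (m : ι → Fin n → ℝ) :
    l * hm w m + n * ((1 - l) * H0 + l * Real.log (a / Real.sqrt l) + (1 - l) * Real.log (Real.sqrt (1 - a ^ 2) / Real.sqrt (1 - l))) ≤ hm w fun k => a • m k := by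
  have h1 : 0 < 1 - a ^ 2 := by nlinarith
  obtain ⟨c1, c2, hc1, hc2, hc, H⟩ := epi_one a (Real.sqrt (1 - a ^ 2)) l ha (Real.sqrt_pos.2 h1) hl hl1
  have k := epi_n a (Real.sqrt (1 - a ^ 2)) l c1 c2 H hw hw n m (fun k => a • m k)
  rw [entA_eq hw, entB_eq _ _ (by rw [Real.sq_sqrt h1.le]; ring) hw, ← ENNReal.ofReal_natCast, ← ENNReal.ofReal_mul hl.le,
    ← ENNReal.ofReal_mul (by positivity), ← ENNReal.ofReal_mul (by positivity), ← ENNReal.ofReal_add (mul_nonneg hl.le (hm_nonneg hw m)) (by positivity),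
    ← ENNReal.ofReal_add (hm_nonneg hw _) (by positivity), ENNReal.ofReal_le_ofReal_iff (add_nonneg (hm_nonneg hw _) (by positivity))] at k
  rw [← hc]; linarith
end
end

section
open scoped BigOperators ENNReal
open MeasureTheory ProbabilityTheory
noncomputable section

lemma fano_one {Ω : Type} [MeasurableSpace Ω] (P Q : Measure Ω) [IsProbabilityMeasure P] [IsProbabilityMeasure Q] (r : Ω → ℝ)
    (hr : Measurable r) (hi : Integrable r P) (hQ : P.withDensity (fun y => ENNReal.ofReal (Real.exp (-r y))) = Q)
    (D : Set Ω) (hD : MeasurableSet D) (c1 c2 : ℝ) :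
    c1 * P.real D + c2 * P.real Dᶜ + 1 - Real.exp c1 * Q.real D - Real.exp c2 * Q.real Dᶜ ≤ ∫ y, r y ∂P := by
  have hme : Measurable fun y => Real.exp (-r y) := by fun_prop
  have hie : Integrable (fun y => Real.exp (-r y)) P := by
    refine ⟨hme.aestronglyMeasurable, ?_⟩
    rw [hasFiniteIntegral_iff_ofReal (Filter.Eventually.of_forall fun y => (Real.exp_pos _).le)]
    have : ∫⁻ y, ENNReal.ofReal (Real.exp (-r y)) ∂P = Q Set.univ := by
      rw [← hQ, withDensity_apply _ MeasurableSet.univ]; simp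
    rw [this, measure_univ]; simp
  have hint : ∀ E, MeasurableSet E → ∫ y, E.indicator (fun y => Real.exp (-r y)) y ∂P = Q.real E := by
    intro E hE
    rw [integral_indicator hE, integral_eq_lintegral_of_nonneg_ae (Filter.Eventually.of_forall fun y => (Real.exp_pos _).le) hme.aestronglyMeasurable,
      ← withDensity_apply _ hE, hQ]; rfl
  have hc : ∀ E, MeasurableSet E → ∀ c : ℝ, ∫ y, E.indicator (fun _ => c) y ∂P = c * P.real E := by
    intro E hE c
    rw [integral_indicator_const _ hE, smul_eq_mul, mul_comm]
  have i1 := (integrable_const (μ := P) c1).indicator hD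
  have i2 := (integrable_const (μ := P) c2).indicator hD.compl
  have i3 := hie.indicator hD
  have i4 := hie.indicator hD.compl
  have i12 : Integrable (fun y => D.indicator (fun _ => c1) y + Dᶜ.indicator (fun _ => c2) y) P := i1.add i2
  have ii : Integrable (fun y => D.indicator (fun _ => c1) y + Dᶜ.indicator (fun _ => c2) y + 1) P := (i1.add i2).add (integrable_const 1)
  have ii3 : Integrable (fun y => D.indicator (fun _ => c1) y + Dᶜ.indicator (fun _ => c2) y + 1 - Real.exp c1 * D.indicator (fun y => Real.exp (-r y)) y) P := ii.sub (i3.const_mul _)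
  have key := integral_mono (μ := P) (f := fun y => D.indicator (fun _ => c1) y + Dᶜ.indicator (fun _ => c2) y + 1 - Real.exp c1 * D.indicator (fun y => Real.exp (-r y)) y - Real.exp c2 * Dᶜ.indicator (fun y => Real.exp (-r y)) y) (ii3.sub (i4.const_mul _)) hi (by
    intro y
    by_cases h : y ∈ D
    · have h' : y ∉ Dᶜ := fun k => k h
      simp only [Set.indicator_of_mem h, Set.indicator_of_notMem h', ← Real.exp_add]
      have := Real.add_one_le_exp (c1 + -r y); linarith
    · have h' : y ∈ Dᶜ := h
      simp only [Set.indicator_of_mem h', Set.indicator_of_notMem h, ← Real.exp_add]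
      have := Real.add_one_le_exp (c2 + -r y); linarith)
  rw [integral_sub ii3 (i4.const_mul _), integral_sub ii (i3.const_mul _), integral_add i12 (integrable_const 1), integral_add i1 i2,
    integral_const_mul, integral_const_mul, hint _ hD, hint _ hD.compl, hc _ hD, hc _ hD.compl] at key
  simpa using key

lemma gibbs {Ω : Type} [MeasurableSpace Ω] (P Q : Measure Ω) [IsProbabilityMeasure P] [IsProbabilityMeasure Q] (r : Ω → ℝ)
    (hr : Measurable r) (hi : Integrable r P) (hQ : P.withDensity (fun y => ENNReal.ofReal (Real.exp (-r y))) = Q) : 0 ≤ ∫ y, r y ∂P := by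
  simpa using fano_one P Q r hr hi hQ Set.univ MeasurableSet.univ 0 0

lemma fano_avg {Ω : Type} [MeasurableSpace Ω] {M : ℕ} (hM : 0 < M) (P : Fin M → Measure Ω) (Q : Measure Ω) (hP : ∀ w, IsProbabilityMeasure (P w)) [IsProbabilityMeasure Q]
    (r : Fin M → Ω → ℝ) (hr : ∀ w, Measurable (r w)) (hi : ∀ w, Integrable (r w) (P w))
    (hQ : ∀ w, (P w).withDensity (fun y => ENNReal.ofReal (Real.exp (-r w y))) = Q) (g : Ω → Fin M) (δ : ℝ) (hδ : 0 < δ) (hδ1 : δ < 1) :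
    (M - ∑ w, (P w {y | g y ≠ w}).toReal) * (Real.log M + Real.log (1 - δ)) + (∑ w, (P w {y | g y ≠ w}).toReal) * Real.log δ ≤ ∑ w, ∫ y, r w y ∂(P w) := by
  have hM' : (0:ℝ) < M := by exact_mod_cast hM
  obtain ⟨D, hDd⟩ : ∃ D : Fin M → Set Ω, D = fun w => (toMeasurable (P w) {y | g y ≠ w})ᶜ := ⟨_, rfl⟩
  have hD : ∀ w, MeasurableSet (D w) := fun w => by rw [hDd]; exact (measurableSet_toMeasurable _ _).compl
  have hDc : ∀ w, (P w).real (D w)ᶜ = (P w {y | g y ≠ w}).toReal := by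
    intro w; rw [hDd, compl_compl, Measure.real, measure_toMeasurable]
  have hDg : ∀ w, ∀ y ∈ D w, g y = w := by
    intro w y hy
    by_contra h
    rw [hDd] at hy
    exact hy (subset_toMeasurable _ _ h)
  have hS : ∑ w, Q.real (D w) ≤ 1 := by
    rw [← measureReal_iUnion_fintype ?_ hD]
    · exact measureReal_le_one
    · intro i j hij
      refine Set.disjoint_left.2 fun y h1 h2 => hij ?_
      rw [← hDg i y h1, ← hDg j y h2]
  have hS0 : 0 ≤ ∑ w, Q.real (D w) := Finset.sum_nonneg fun w _ => measureReal_nonneg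
  have k : ∀ w, _ := fun w => fano_one (P w) Q (r w) (hr w) (hi w) (hQ w) (D w) (hD w) (Real.log (M * (1 - δ))) (Real.log δ)
  have h1 : 0 < 1 - δ := by linarith
  rw [Real.exp_log (by positivity), Real.exp_log hδ, Real.log_mul hM'.ne' h1.ne'] at k
  have k2 := Finset.sum_le_sum fun w (_ : w ∈ Finset.univ) => k w
  have eP : ∀ w, (P w).real (D w) = 1 - (P w {y | g y ≠ w}).toReal := by
    intro w; rw [← hDc, probReal_compl_eq_one_sub (hD w)]; ring
  simp only [probReal_compl_eq_one_sub (hD _)] at k2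
  simp only [eP, sub_sub_cancel] at k2
  simp only [Finset.sum_sub_distrib, Finset.sum_add_distrib, ← Finset.mul_sum, Finset.sum_const, Finset.card_univ, Fintype.card_fin, nsmul_eq_mul, mul_one] at k2
  have : 0 ≤ (M * (1 - δ)) * (1 - ∑ w, Q.real (D w)) + δ * ∑ w, Q.real (D w) := by
    have := mul_nonneg (mul_nonneg hM'.le h1.le) (sub_nonneg.2 hS)
    positivity
  linarith
end
end

section
open scoped BigOperators ENNReal
open MeasureTheory ProbabilityTheory
noncomputable section

/-- Gaussian reference density -/
def gq {n : ℕ} (s : ℝ) (c : Fin n → ℝ) (y : Fin n → ℝ) : ℝ := ∏ i, gaussianPDFReal (c i) s.toNNReal (y i)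

lemma gq_pos {n : ℕ} {s : ℝ} (hs : 0 < s) (c y : Fin n → ℝ) : 0 < gq s c y :=
  Finset.prod_pos fun i _ => gaussianPDFReal_pos _ _ _ (by simpa using hs)

lemma gq_meas {n : ℕ} (s : ℝ) (c : Fin n → ℝ) : Measurable (gq s c) := by
  unfold gq
  exact Finset.measurable_prod _ fun i _ => (measurable_gaussianPDFReal _ _).comp (measurable_pi_apply i)

lemma gq_lint {n : ℕ} {s : ℝ} (hs : 0 < s) (c : Fin n → ℝ) : ∫⁻ y, ENNReal.ofReal (gq s c y) = 1 := by
  unfold gq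
  simp_rw [ENNReal.ofReal_prod_of_nonneg (fun i _ => gaussianPDFReal_nonneg (c i) s.toNNReal _)]
  rw [lint_prod_fin n (fun i t => ENNReal.ofReal (gaussianPDFReal (c i) s.toNNReal t)) (fun i => (measurable_gaussianPDFReal _ _).ennreal_ofReal)]
  refine Finset.prod_eq_one fun i _ => lintegral_gaussianPDFReal_eq_one _ (by simpa using hs)

lemma log_gq {n : ℕ} {s : ℝ} (hs : 0 < s) (c y : Fin n → ℝ) :
    Real.log (gq s c y) = -(n / 2) * Real.log (2 * Real.pi * s) - (∑ i, (y i - c i) ^ 2) / (2 * s) := by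
  unfold gq
  rw [Real.log_prod (fun i _ => (gaussianPDFReal_pos _ _ _ (by simpa using hs)).ne')]
  have : ∀ i, Real.log (gaussianPDFReal (c i) s.toNNReal (y i)) = -(1/2) * Real.log (2 * Real.pi * s) - (y i - c i) ^ 2 / (2 * s) := by
    intro i
    have hp : 0 < 2 * Real.pi * s := by positivity
    rw [gaussianPDFReal, Real.log_mul (by rw [Real.coe_toNNReal _ hs.le]; positivity) (Real.exp_pos _).ne', Real.log_exp, Real.log_inv, Real.coe_toNNReal _ hs.le, Real.log_sqrt hp.le]
    ring
  simp_rw [this, Finset.sum_sub_distrib, Finset.sum_div]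
  simp; ring

lemma wd_ratio {ι : Type} [Fintype ι] {n : ℕ} {w : ι → ℝ} (hw : PW w) (m : ι → Fin n → ℝ) {q : (Fin n → ℝ) → ℝ} (hq : Measurable q) (hq0 : ∀ y, 0 < q y) :
    (mixM w m).withDensity (fun y => ENNReal.ofReal (Real.exp (-(-Real.log (q y) - -Real.log (mixD w m y))))) = volume.withDensity (fun y => ENNReal.ofReal (q y)) := by
  have hd := (mixD_cont w m).measurable
  unfold mixM
  rw [← withDensity_mul _ (by fun_prop) (by fun_prop)]
  congr 1
  ext y
  have := mixD_pos hw m y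
  rw [Pi.mul_apply, ← ENNReal.ofReal_mul this.le]
  congr 1
  rw [neg_sub, sub_neg_eq_add, Real.exp_add, Real.exp_neg, Real.exp_log this, Real.exp_log (hq0 y)]
  field_simp

lemma gq_int {ι : Type} [Fintype ι] {n : ℕ} {w : ι → ℝ} (hw : PW w) (m : ι → Fin n → ℝ) {s : ℝ} (hs : 0 < s) (c : Fin n → ℝ) :
    Integrable (fun y => -Real.log (gq s c y)) (mixM w m) ∧
    ∫ y, -Real.log (gq s c y) ∂(mixM w m) = n / 2 * Real.log (2 * Real.pi * s) + (∑ k, w k * ∑ i, (m k i - c i) ^ 2 + n) / (2 * s) := by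
  have hp := mixM_prob hw m
  obtain ⟨h1, h2⟩ := mixM_sq hw m c
  have e : (fun y => -Real.log (gq s c y)) = fun y => n / 2 * Real.log (2 * Real.pi * s) + (∑ i, (y i - c i) ^ 2) / (2 * s) := by
    ext y; rw [log_gq hs]; ring
  rw [e]
  refine ⟨(integrable_const _).add (h1.div_const _), ?_⟩
  rw [integral_add (integrable_const _) (h1.div_const _), integral_div, h2]
  simp

lemma gq_prob {n : ℕ} {s : ℝ} (hs : 0 < s) (c : Fin n → ℝ) : IsProbabilityMeasure (volume.withDensity (fun y => ENNReal.ofReal (gq s c y))) :=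
  ⟨by rw [withDensity_apply _ MeasurableSet.univ]; simpa using gq_lint hs c⟩

lemma hm_le {ι : Type} [Fintype ι] {n : ℕ} {w : ι → ℝ} (hw : PW w) (m : ι → Fin n → ℝ) {s : ℝ} (hs : 0 < s) (c : Fin n → ℝ) :
    hm w m ≤ n / 2 * Real.log (2 * Real.pi * s) + (∑ k, w k * ∑ i, (m k i - c i) ^ 2 + n) / (2 * s) := by
  have hp := mixM_prob hw m
  have hp2 := gq_prob hs c
  have hd := (mixD_cont w m).measurable
  have hg := gq_meas s c
  have h := gibbs _ _ _ (by fun_prop) ((gq_int hw m hs c).1.sub (nlog_mix_int hw m hw m)) (wd_ratio hw m (gq_meas s c) (gq_pos hs c))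
  rw [integral_sub' (gq_int hw m hs c).1 (nlog_mix_int hw m hw m), (gq_int hw m hs c).2] at h
  unfold hm; linarith

/-- uniform weights -/
def uw (M : ℕ) : Fin M → ℝ := fun _ => 1 / M
lemma uw_PW {M : ℕ} (hM : 0 < M) : PW (uw M) := by
  have : (0:ℝ) < M := by exact_mod_cast hM
  refine ⟨fun k => by unfold uw; positivity, ?_⟩
  unfold uw; simp; field_simp

def u1 : Unit → ℝ := fun _ => 1
lemma u1_PW : PW u1 := ⟨fun _ => zero_le_one, by simp [u1]⟩

lemma hm_single {n : ℕ} (m : Fin n → ℝ) : hm u1 (fun _ => m) = n * H0 := by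
  unfold hm
  have e : (fun y => -Real.log (mixD u1 (fun _ => m) y)) = fun y => n / 2 * Real.log (2 * Real.pi) + (∑ i, (y i - m i) ^ 2) / 2 := by
    ext y; unfold mixD u1
    simp only [Finset.univ_unique, Finset.sum_const, Finset.card_singleton, one_smul, one_mul]
    rw [log_phn]; simp only [Pi.sub_apply]; ring
  have hp := mixM_prob u1_PW (fun _ => m)
  obtain ⟨h1, h2⟩ := mixM_sq u1_PW (fun _ => m) m
  rw [e, integral_add (integrable_const _) (h1.div_const _), integral_div, h2]
  simp [H0]; ring

lemma cross_avg {ι κ : Type} [Fintype ι] [Fintype κ] {n : ℕ} {w : ι → ℝ} (hw : PW w) (m : ι → Fin n → ℝ) {v : κ → ℝ} (hv : PW v) (μ : κ → Fin n → ℝ) :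
    ∑ k, w k * ∫ y, -Real.log (mixD v μ y) ∂(mixM u1 (fun _ => m k)) = ∫ y, -Real.log (mixD v μ y) ∂(mixM w m) := by
  have hd := (mixD_cont v μ).measurable
  have hM : Measurable fun y => -Real.log (mixD v μ y) := by fun_prop
  have hi : ∀ c : Fin n → ℝ, Integrable (fun z => (fun y => -Real.log (mixD v μ y)) (c + z)) (stdGaussN n) := by
    intro c
    have := nlog_mix_int u1_PW (fun _ => c) hv μ
    rw [mixM_eq u1_PW] at this
    simp only [u1, ENNReal.ofReal_one, one_smul, Finset.univ_unique, Finset.sum_singleton] at this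
    exact (integrable_map_measure hM.aestronglyMeasurable (by fun_prop)).1 this
  rw [mixM_integral hw m hM fun k => hi _]
  refine Finset.sum_congr rfl fun k _ => ?_
  rw [mixM_integral u1_PW _ hM fun k => hi _]
  simp [u1]

lemma hm_ge {ι : Type} [Fintype ι] {n : ℕ} {w : ι → ℝ} (hw : PW w) (m : ι → Fin n → ℝ) : n * H0 ≤ hm w m := by
  have hd := (mixD_cont w m).measurable
  have hp2 := mixM_prob hw m
  have h : ∀ k, n * H0 ≤ ∫ y, -Real.log (mixD w m y) ∂(mixM u1 (fun _ => m k)) := by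
    intro k
    have hp := mixM_prob u1_PW (fun _ => m k)
    have hd' := (mixD_cont u1 (fun _ => m k)).measurable
    have h := gibbs _ (mixM w m) _ (by fun_prop) ((nlog_mix_int u1_PW (fun _ => m k) hw m).sub (nlog_mix_int u1_PW (fun _ => m k) u1_PW (fun _ => m k))) (wd_ratio u1_PW (fun _ => m k) hd (mixD_pos hw m))
    rw [integral_sub' (nlog_mix_int u1_PW (fun _ => m k) hw m) (nlog_mix_int u1_PW (fun _ => m k) u1_PW (fun _ => m k))] at h
    have := hm_single (m k)
    unfold hm at this
    linarith
  unfold hm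
  rw [← cross_avg hw m hw m]
  calc n * H0 = ∑ k, w k * (n * H0) := by rw [← Finset.sum_mul, hw.2, one_mul]
    _ ≤ _ := Finset.sum_le_sum fun k _ => mul_le_mul_of_nonneg_left (h k) (hw.1 k)

lemma fano_rx2 {n M : ℕ} (hM : 0 < M) (m : Fin M → Fin n → ℝ) (g : (Fin n → ℝ) → Fin M) (δ : ℝ) (hδ : 0 < δ) (hδ1 : δ < 1) (e : ℝ)
    (he : e = (1 / M) * ∑ w, (stdGaussN n {z | g (m w + z) ≠ w}).toReal) :
    (1 - e) * (Real.log M + Real.log (1 - δ)) + e * Real.log δ ≤ hm (uw M) m - n * H0 := by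
  have hM' : (0:ℝ) < M := by exact_mod_cast hM
  have hd := (mixD_cont (uw M) m).measurable
  have hw := uw_PW hM
  have hp2 := mixM_prob hw m
  have I1 : ∀ w, _ := fun w => nlog_mix_int u1_PW (fun _ => m w) hw m
  have I2 : ∀ w, _ := fun w => nlog_mix_int u1_PW (fun _ => m w) u1_PW (fun _ => m w)
  have hd' : ∀ w, _ := fun w => (mixD_cont u1 (fun _ => m w)).measurable
  have h := fano_avg hM (fun w => mixM u1 (fun _ => m w)) (mixM (uw M) m) (fun w => mixM_prob u1_PW _)
    (fun w y => -Real.log (mixD (uw M) m y) - -Real.log (mixD u1 (fun _ => m w) y)) (fun w => by have := hd' w; fun_prop)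
    (fun w => (I1 w).sub (I2 w)) (fun w => wd_ratio u1_PW (fun _ => m w) hd (mixD_pos hw m)) g δ hδ hδ1
  simp only [integral_sub (I1 _) (I2 _), Finset.sum_sub_distrib] at h
  have e1 : ∀ w, ∫ y, -Real.log (mixD u1 (fun _ => m w) y) ∂(mixM u1 (fun _ => m w)) = n * H0 := fun w => hm_single (m w)
  have e2 := cross_avg hw m hw m
  have e3 : ∀ w, (mixM u1 (fun _ => m w) {y | g y ≠ w}).toReal = (stdGaussN n {z | g (m w + z) ≠ w}).toReal := by
    intro w; rw [mixM_apply u1_PW]; simp [u1]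
  simp only [e1, e3] at h
  change _ = hm (uw M) m at e2
  rw [← e2]
  simp only [uw, ← Finset.mul_sum]
  have e4 : ∑ w, (stdGaussN n {z | g (m w + z) ≠ w}).toReal = M * e := by rw [he]; field_simp
  rw [e4] at h
  simp only [Finset.sum_const, Finset.card_univ, Fintype.card_fin, nsmul_eq_mul] at h
  refine le_of_mul_le_mul_left ?_ hM'
  simp only [mul_sub, ← mul_assoc, mul_one_div_cancel hM'.ne', one_mul]
  linarith

lemma fano_rx1 {n M1 M2 : ℕ} (hM1 : 0 < M1) (hM2 : 0 < M2) (m : Fin M1 → Fin M2 → Fin n → ℝ) (g : (Fin n → ℝ) → Fin M1) (δ : ℝ) (hδ : 0 < δ) (hδ1 : δ < 1) (e : ℝ)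
    (he : e = (1 / (M1 * M2)) * ∑ w1, ∑ w2, (stdGaussN n {z | g (m w1 w2 + z) ≠ w1}).toReal) (s : ℝ) (hs : 0 < s) :
    (1 - e) * (Real.log M1 + Real.log (1 - δ)) + e * Real.log δ ≤
      n / 2 * Real.log (2 * Real.pi * s) + ((1 / (M1 * M2)) * (∑ w1, ∑ w2, ∑ i, (m w1 w2 i) ^ 2) + n) / (2 * s) - (1 / M1) * ∑ w1, hm (uw M2) (m w1) := by
  have hM1' : (0:ℝ) < M1 := by exact_mod_cast hM1
  have hM2' : (0:ℝ) < M2 := by exact_mod_cast hM2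
  have hd : ∀ w, _ := fun w => (mixD_cont (uw M2) (m w)).measurable
  have hw := uw_PW hM2
  have hg := gq_meas s (0 : Fin n → ℝ)
  have hp2 := gq_prob hs (0 : Fin n → ℝ)
  have I1 : ∀ w, _ := fun w => gq_int hw (m w) hs 0
  have I2 : ∀ w, _ := fun w => nlog_mix_int hw (m w) hw (m w)
  have h := fano_avg hM1 (fun w => mixM (uw M2) (m w)) _ (fun w => mixM_prob hw _)
    (fun w y => -Real.log (gq s 0 y) - -Real.log (mixD (uw M2) (m w) y)) (fun w => by have := hd w; fun_prop)
    (fun w => (I1 w).1.sub (I2 w)) (fun w => wd_ratio hw (m w) hg (gq_pos hs 0)) g δ hδ hδ1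
  simp only [integral_sub (I1 _).1 (I2 _), Finset.sum_sub_distrib, (I1 _).2] at h
  have e3 : ∀ w, (mixM (uw M2) (m w) {y | g y ≠ w}).toReal = (1 / M2) * ∑ w2, (stdGaussN n {z | g (m w w2 + z) ≠ w}).toReal := by
    intro w; rw [mixM_apply hw, Finset.mul_sum]; rfl
  simp only [e3, ← Finset.mul_sum] at h
  have e4 : ∑ w1, ∑ w2, (stdGaussN n {z | g (m w1 w2 + z) ≠ w1}).toReal = M1 * M2 * e := by rw [he]; field_simp
  rw [e4] at h
  change _ ≤ _ - ∑ w1, hm (uw M2) (m w1) at h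
  simp only [uw, Pi.zero_apply, sub_zero, ← Finset.mul_sum, ← Finset.sum_div, Finset.sum_add_distrib, Finset.sum_const, Finset.card_univ, Fintype.card_fin, nsmul_eq_mul] at h
  refine le_of_mul_le_mul_left ?_ hM1'
  have a1 : 1 / (M2:ℝ) * (M1 * M2 * e) = M1 * e := by field_simp
  rw [a1] at h
  refine le_trans (le_of_eq ?_) (h.trans (le_of_eq ?_))
  · ring
  · unfold uw; field_simp
end
end

section
open scoped BigOperators ENNReal
open MeasureTheory ProbabilityTheory
noncomputable section

lemma phn_neg {n : ℕ} (x : Fin n → ℝ) : phn (-x) = phn x := by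
  unfold phn
  refine Finset.prod_congr rfl fun i _ => ?_
  have : Real.log (ph ((-x) i)) = Real.log (ph (x i)) := by rw [log_ph, log_ph]; simp
  exact Real.log_injOn_pos (ph_pos _) (ph_pos _) this

lemma hm_of_ent {ι κ : Type} [Fintype ι] [Fintype κ] {n : ℕ} {w : ι → ℝ} (hw : PW w) (m : ι → Fin n → ℝ) {v : κ → ℝ} (hv : PW v) (μ : κ → Fin n → ℝ)
    (h : entA (mixD w m) = entA (mixD v μ)) : hm w m = hm v μ := by
  rw [entA_eq hw, entA_eq hv] at h
  exact (ENNReal.ofReal_eq_ofReal_iff (hm_nonneg hw m) (hm_nonneg hv μ)).1 h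

lemma hm_shift {ι : Type} [Fintype ι] {n : ℕ} {w : ι → ℝ} (hw : PW w) (m : ι → Fin n → ℝ) (c : Fin n → ℝ) :
    hm w (fun k => c + m k) = hm w m := by
  refine hm_of_ent hw _ hw _ ?_
  unfold entA
  rw [← lintegral_add_left_eq_self _ c]
  refine lintegral_congr fun y => ?_
  have : mixD w (fun k => c + m k) (c + y) = mixD w m y := by
    unfold mixD; simp
  rw [this]

lemma hm_neg {ι : Type} [Fintype ι] {n : ℕ} {w : ι → ℝ} (hw : PW w) (m : ι → Fin n → ℝ) :
    hm w (fun k => -m k) = hm w m := by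
  refine hm_of_ent hw _ hw _ ?_
  unfold entA
  rw [← lintegral_neg_eq_self]
  refine lintegral_congr fun y => ?_
  have : mixD w (fun k => -m k) (-y) = mixD w m y := by
    unfold mixD
    refine Finset.sum_congr rfl fun k _ => ?_
    have e : -y - -m k = -(y - m k) := by abel
    rw [e, phn_neg]
  rw [this]

lemma hm_abs {ι : Type} [Fintype ι] {n : ℕ} {w : ι → ℝ} (hw : PW w) (m : ι → Fin n → ℝ) (a : ℝ) (c : Fin n → ℝ) :
    hm w (fun k => c + a • m k) = hm w (fun k => |a| • m k) := by
  rw [hm_shift hw (fun k => a • m k) c]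
  rcases abs_cases a with ⟨h, _⟩ | ⟨h, _⟩
  · rw [h]
  · rw [h, ← hm_neg hw]; simp

lemma kbar_ge {ι κ : Type} [Fintype ι] [Fintype κ] {n : ℕ} {w : ι → ℝ} (hw : PW w) {v : κ → ℝ} (hv : PW v) (m : κ → ι → Fin n → ℝ) (a : ℝ) (ha : |a| ≤ 1) (c : κ → Fin n → ℝ)
    (S : ℝ) (hS : 1 ≤ S) (h : ∑ k, v k * hm w (m k) = n * (H0 + 1 / 2 * Real.log S)) :
    n * (H0 + 1 / 2 * Real.log (1 + a ^ 2 * (S - 1))) ≤ ∑ k, v k * hm w (fun j => c k + a • m k j) := by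
  simp only [hm_abs hw]
  have hm1 : ∀ x : ℝ, x = ∑ k, v k * x := fun x => by rw [← Finset.sum_mul, hv.2, one_mul]
  rcases eq_or_lt_of_le (abs_nonneg a) with h0 | h0
  · have : a = 0 := abs_eq_zero.1 h0.symm
    subst this
    rw [hm1 (n * _)]
    refine Finset.sum_le_sum fun k _ => mul_le_mul_of_nonneg_left ?_ (hv.1 k)
    simpa using hm_ge hw _
  rcases eq_or_lt_of_le ha with h1 | h1
  · have : a ^ 2 = 1 := by rw [← sq_abs, h1]; norm_num
    simp [h1, this, h]
  obtain ⟨b, hb⟩ : ∃ b, b = |a| := ⟨_, rfl⟩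
  rw [← sq_abs, ← hb]
  rw [← hb] at h0 h1
  have hb2 : b ^ 2 < 1 := by nlinarith
  have hb0 : 0 < b ^ 2 := by positivity
  have hS0 : 0 < S := by linarith
  obtain ⟨N, hN⟩ : ∃ N, N = 1 + b ^ 2 * (S - 1) := ⟨_, rfl⟩
  have hN0 : 0 < N := by rw [hN]; nlinarith
  rw [← hN]
  obtain ⟨l, hl⟩ : ∃ l, l = b ^ 2 * S / N := ⟨_, rfl⟩
  have hl0 : 0 < l := by rw [hl]; positivity
  have hl1 : 1 - l = (1 - b ^ 2) / N := by rw [hl, eq_div_iff hN0.ne', sub_mul, div_mul_cancel₀ _ hN0.ne', hN]; ring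
  have hl1' : 0 < 1 - l := by rw [hl1]; exact div_pos (by linarith) hN0
  have E : ∀ k, _ := fun k => epi_real b l h0 h1 hl0 (by linarith) hw (m k)
  have L1 : Real.log (b / Real.sqrt l) = 1 / 2 * (Real.log N - Real.log S) := by
    rw [Real.log_div h0.ne' (Real.sqrt_pos.2 hl0).ne', Real.log_sqrt hl0.le, hl, Real.log_div (by positivity) hN0.ne', Real.log_mul (by positivity) hS0.ne', Real.log_pow]
    push_cast; ring
  have L2 : Real.log (Real.sqrt (1 - b ^ 2) / Real.sqrt (1 - l)) = 1 / 2 * Real.log N := by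
    rw [Real.log_div (Real.sqrt_pos.2 (by linarith)).ne' (Real.sqrt_pos.2 hl1').ne', Real.log_sqrt hl1'.le, Real.log_sqrt (by linarith), hl1, Real.log_div (by linarith) hN0.ne']
    ring
  rw [L1, L2] at E
  refine le_trans (le_of_eq ?_) (Finset.sum_le_sum fun k _ => mul_le_mul_of_nonneg_left (E k) (hv.1 k))
  simp only [mul_add (v _), Finset.sum_add_distrib, ← mul_assoc (v _)]
  simp only [mul_comm (v _) l, mul_assoc, ← Finset.mul_sum, h, ← Finset.sum_mul, hv.2]
  ring
end
end

section
open scoped BigOperators ENNReal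
open MeasureTheory ProbabilityTheory
noncomputable section

def mn {n M : ℕ} (x : Fin M → Fin n → ℝ) (i : Fin n) : ℝ := (1 / M) * ∑ k, x k i

lemma var_id {n M : ℕ} (hM : 0 < M) (x : Fin M → Fin n → ℝ) :
    (1 / M) * ∑ k, ∑ i, (x k i - mn x i) ^ 2 = (1 / M) * ∑ k, ∑ i, x k i ^ 2 - ∑ i, mn x i ^ 2 := by
  have hM' : (M:ℝ) ≠ 0 := by exact_mod_cast hM.ne'
  rw [Finset.sum_comm, Finset.sum_comm (f := fun k i => x k i ^ 2), Finset.mul_sum, Finset.mul_sum, ← Finset.sum_sub_distrib]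
  refine Finset.sum_congr rfl fun i _ => ?_
  have e : ∀ k, (x k i - mn x i) ^ 2 = x k i ^ 2 - 2 * mn x i * x k i + mn x i ^ 2 := fun k => by ring
  simp only [e, Finset.sum_add_distrib, Finset.sum_sub_distrib, ← Finset.mul_sum, Finset.sum_const, Finset.card_univ, Fintype.card_fin, nsmul_eq_mul]
  have e2 : ∑ k, x k i = M * mn x i := by unfold mn; field_simp
  rw [e2]; field_simp; ring

lemma cross_id {n M : ℕ} (hM : 0 < M) (x : Fin M → Fin n → ℝ) (f : Fin n → ℝ) (a : ℝ) :
    (1 / M) * ∑ k, ∑ i, (f i + a * x k i) ^ 2 = ∑ i, f i ^ 2 + 2 * a * ∑ i, f i * mn x i + a ^ 2 * ((1 / M) * ∑ k, ∑ i, x k i ^ 2) := by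
  have hM' : (M:ℝ) ≠ 0 := by exact_mod_cast hM.ne'
  rw [Finset.sum_comm, Finset.sum_comm (f := fun k i => x k i ^ 2), Finset.mul_sum, Finset.mul_sum, Finset.mul_sum, Finset.mul_sum, ← Finset.sum_add_distrib, ← Finset.sum_add_distrib]
  refine Finset.sum_congr rfl fun i _ => ?_
  have e : ∀ k, (f i + a * x k i) ^ 2 = f i ^ 2 + 2 * a * f i * x k i + a ^ 2 * x k i ^ 2 := fun k => by ring
  simp only [e, Finset.sum_add_distrib, ← Finset.mul_sum, Finset.sum_const, Finset.card_univ, Fintype.card_fin, nsmul_eq_mul]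
  have e2 : ∑ k, x k i = M * mn x i := by unfold mn; field_simp
  rw [e2]; field_simp

lemma cs_avg {n M : ℕ} (f g : Fin M → Fin n → ℝ) :
    ((1 / M : ℝ) * ∑ k, ∑ i, f k i * g k i) ^ 2 ≤ ((1 / M) * ∑ k, ∑ i, f k i ^ 2) * ((1 / M) * ∑ k, ∑ i, g k i ^ 2) := by
  have := Finset.sum_mul_sq_le_sq_mul_sq Finset.univ (fun p : Fin M × Fin n => f p.1 p.2) (fun p => g p.1 p.2)
  simp only [Fintype.sum_prod_type] at this
  have h2 := mul_le_mul_of_nonneg_left this (sq_nonneg (1 / M : ℝ))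
  nlinarith [h2]

lemma fano_fin (e ε L X : ℝ) (he0 : 0 ≤ e) (he : e ≤ ε) (h0 : 0 < ε) (h1 : ε < 1) (hL : 0 ≤ L)
    (h : (1 - e) * (L + Real.log (1 - ε)) + e * Real.log ε ≤ X) : (1 - ε) * L ≤ X + (-Real.log (1 - ε) - ε * Real.log ε) := by
  have a1 : Real.log (1 - ε) ≤ 0 := Real.log_nonpos (by linarith) (by linarith)
  have a2 : Real.log ε ≤ 0 := Real.log_nonpos h0.le h1.le
  nlinarith [mul_nonneg (sub_nonneg.2 he) hL, mul_nonneg (sub_nonneg.2 he) (neg_nonneg.2 a2), mul_nonneg he0 (neg_nonneg.2 a1)]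

set_option maxHeartbeats 1000000 in
lemma conv_code (a b P1 P2 : ℝ) (ha : |a| ≤ 1) (hP1 : 0 ≤ P1) (hP2 : 0 ≤ P2) (n M1 M2 : ℕ) (f1 : Fin M1 → Fin n → ℝ)
    (f2 : Fin M1 → Fin M2 → Fin n → ℝ) (g1 : (Fin n → ℝ) → Fin M1) (g2 : (Fin n → ℝ) → Fin M2)
    (hn : 0 < n) (hM1 : 0 < M1) (hM2 : 0 < M2)
    (p1 : (1 / M1 : ℝ) * ∑ w1 : Fin M1, ((1 / n : ℝ) * ∑ i, (f1 w1 i) ^ 2) ≤ P1)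
    (p2 : (1 / (M1 * M2) : ℝ) * ∑ w1 : Fin M1, ∑ w2 : Fin M2, ((1 / n : ℝ) * ∑ i, (f2 w1 w2 i) ^ 2) ≤ P2)
    (ε : ℝ) (h0 : 0 < ε) (h1 : ε < 1) (e1 : peG1T2 a n M1 M2 f1 f2 g1 ≤ ε) (e2 : peG2T2 b n M1 M2 f1 f2 g2 ≤ ε) :
    ∃ β : ℝ, 0 ≤ β ∧ β ≤ 1 ∧
      (1 - ε) * Real.log M1 ≤ n * (1 / 2 * Real.log ((1+P1+2*|a| * Real.sqrt ((1-β)*P1*P2)+a^2*P2)/(1+a^2*β*P2))) + (-Real.log (1 - ε) - ε * Real.log ε) ∧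
      (1 - ε) * Real.log M2 ≤ n * (1 / 2 * Real.log (1+β*P2)) + (-Real.log (1 - ε) - ε * Real.log ε) := by
  have hn' : (0:ℝ) < n := by exact_mod_cast hn
  have hM1' : (0:ℝ) < M1 := by exact_mod_cast hM1
  have hM2' : (0:ℝ) < M2 := by exact_mod_cast hM2
  have hw2 := uw_PW hM2
  have hw1 := uw_PW hM1
  -- averages
  obtain ⟨A, hA⟩ : ∃ A, A = (1 / M1 : ℝ) * ∑ w, ∑ i, f1 w i ^ 2 := ⟨_, rfl⟩
  obtain ⟨B, hB⟩ : ∃ B, B = (1 / M1 : ℝ) * ∑ w, ((1 / M2 : ℝ) * ∑ k, ∑ i, f2 w k i ^ 2) := ⟨_, rfl⟩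
  obtain ⟨C, hC⟩ : ∃ C, C = (1 / M1 : ℝ) * ∑ w, ∑ i, f1 w i * mn (f2 w) i := ⟨_, rfl⟩
  obtain ⟨μ, hμ⟩ : ∃ μ, μ = (1 / M1 : ℝ) * ∑ w, ∑ i, mn (f2 w) i ^ 2 := ⟨_, rfl⟩
  obtain ⟨V, hV⟩ : ∃ V, V = (1 / M1 : ℝ) * ∑ w, ((1 / M2 : ℝ) * ∑ k, ∑ i, (f2 w k i - mn (f2 w) i) ^ 2) := ⟨_, rfl⟩
  have hAP : A ≤ n * P1 := by
    rw [← Finset.mul_sum] at p1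
    have : A = n * ((1 / M1 : ℝ) * ((1 / n : ℝ) * ∑ w, ∑ i, f1 w i ^ 2)) := by rw [hA]; field_simp
    rw [this]; gcongr
  have hBP : B ≤ n * P2 := by
    simp only [← Finset.mul_sum] at p2
    have : B = n * ((1 / (M1 * M2) : ℝ) * ((1 / n : ℝ) * ∑ w, ∑ k, ∑ i, f2 w k i ^ 2)) := by rw [hB, ← Finset.mul_sum]; field_simp
    rw [this]; gcongr
  have hA0 : 0 ≤ A := by rw [hA]; positivity
  have hμ0 : 0 ≤ μ := by rw [hμ]; positivity
  have hV0 : 0 ≤ V := by rw [hV]; positivity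
  have hVB : V = B - μ := by
    rw [hV, hB, hμ, ← mul_sub, ← Finset.sum_sub_distrib]
    simp only [var_id hM2]
  have hCS : C ^ 2 ≤ A * μ := by rw [hC, hA, hμ]; exact cs_avg _ _
  have hT : (1 / (M1 * M2) : ℝ) * (∑ w1, ∑ w2, ∑ i, ((f1 w1 + a • f2 w1 w2) i) ^ 2) = A + 2 * a * C + a ^ 2 * B := by
    have : (1 / (M1 * M2) : ℝ) * (∑ w1, ∑ w2, ∑ i, ((f1 w1 + a • f2 w1 w2) i) ^ 2) = (1 / M1 : ℝ) * ∑ w1, ((1 / M2 : ℝ) * ∑ w2, ∑ i, (f1 w1 i + a * f2 w1 w2 i) ^ 2) := by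
      rw [← Finset.mul_sum]; simp only [Pi.add_apply, Pi.smul_apply, smul_eq_mul]; field_simp
    rw [this]
    simp only [cross_id hM2, Finset.sum_add_distrib]
    rw [hA, hB, hC]
    simp only [← Finset.mul_sum]; ring
  -- entropies
  obtain ⟨h, hh⟩ : ∃ h, h = ∑ w, uw M1 w * hm (uw M2) (f2 w) := ⟨_, rfl⟩
  have hge : n * H0 ≤ h := by
    rw [hh]
    calc n * H0 = ∑ w, uw M1 w * (n * H0) := by rw [← Finset.sum_mul, hw1.2, one_mul]
      _ ≤ _ := Finset.sum_le_sum fun k _ => mul_le_mul_of_nonneg_left (hm_ge hw2 _) (hw1.1 k)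
  have hs0 : 0 < 1 + V / n := by positivity
  have hle : h ≤ n * (H0 + 1 / 2 * Real.log (1 + V / n)) := by
    rw [hh]
    have := Finset.sum_le_sum fun w (_ : w ∈ Finset.univ) => mul_le_mul_of_nonneg_left (hm_le hw2 (f2 w) hs0 (mn (f2 w))) (hw1.1 w)
    refine this.trans (le_of_eq ?_)
    have e : ∑ w, uw M1 w * (∑ k, uw M2 k * ∑ i, (f2 w k i - mn (f2 w) i) ^ 2) = V := by
      rw [hV, Finset.mul_sum]
      refine Finset.sum_congr rfl fun w _ => ?_
      rw [Finset.mul_sum (f := fun k => ∑ i, (f2 w k i - mn (f2 w) i) ^ 2)]; rfl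
    have e2 : ∀ w, uw M1 w * (↑n / 2 * Real.log (2 * Real.pi * (1 + V / ↑n)) + (∑ k, uw M2 k * ∑ i, (f2 w k i - mn (f2 w) i) ^ 2 + ↑n) / (2 * (1 + V / ↑n)))
      = uw M1 w * (↑n / 2 * Real.log (2 * Real.pi * (1 + V / ↑n)) + ↑n / (2 * (1 + V / ↑n))) + (uw M1 w * (∑ k, uw M2 k * ∑ i, (f2 w k i - mn (f2 w) i) ^ 2)) / (2 * (1 + V / ↑n)) := fun w => by ring
    simp only [e2, Finset.sum_add_distrib, ← Finset.sum_mul, ← Finset.sum_div, hw1.2, e]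
    rw [Real.log_mul (by positivity) hs0.ne', H0]
    have : (n:ℝ) / (2 * (1 + V / ↑n)) + V / (2 * (1 + V / ↑n)) = n / 2 := by field_simp
    linear_combination this
  obtain ⟨S, hS⟩ : ∃ S, S = Real.exp (2 * (h / n - H0)) := ⟨_, rfl⟩
  have hS1 : 1 ≤ S := by
    rw [hS]; refine Real.one_le_exp ?_
    have : H0 ≤ h / n := by rw [le_div_iff₀ hn']; linarith
    linarith
  have hS0 : 0 < S := by linarith
  have hSV : S ≤ 1 + V / n := by
    rw [hS, ← Real.le_log_iff_exp_le hs0]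
    have : h / n ≤ H0 + 1 / 2 * Real.log (1 + V / n) := by rw [div_le_iff₀ hn']; linarith
    linarith
  have hhS : h = n * (H0 + 1 / 2 * Real.log S) := by
    rw [hS, Real.log_exp]; field_simp; ring
  have hSV2 : n * (S - 1) ≤ n * P2 - μ := by
    have : S - 1 ≤ V / n := by linarith
    rw [le_div_iff₀ hn'] at this
    linarith
  have hSP : S - 1 ≤ P2 := by
    have : n * (S - 1) ≤ n * P2 := by linarith
    exact le_of_mul_le_mul_left this hn'
  obtain ⟨β, hβ0, hβ1, hβ⟩ : ∃ β : ℝ, 0 ≤ β ∧ β ≤ 1 ∧ β * P2 = S - 1 := by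
    rcases eq_or_lt_of_le hP2 with h | h
    · exact ⟨0, le_rfl, zero_le_one, by linarith⟩
    · exact ⟨(S - 1) / P2, div_nonneg (by linarith) h.le, (div_le_one h).2 hSP, by field_simp⟩
  refine ⟨β, hβ0, hβ1, ?_, ?_⟩
  · obtain ⟨T, hTd⟩ : ∃ T, T = 1+P1+2*|a| * Real.sqrt ((1-β)*P1*P2)+a^2*P2 := ⟨_, rfl⟩
    rw [← hTd]
    have hT0 : 0 < T := by rw [hTd]; positivity
    have hTle : A + 2 * a * C + a ^ 2 * B + n ≤ n * T := by
      have hC2 : |C| ≤ n * Real.sqrt ((1-β)*P1*P2) := by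
        rw [← Real.sqrt_sq hn'.le, ← Real.sqrt_mul (sq_nonneg _)]
        refine Real.abs_le_sqrt (hCS.trans ?_)
        calc A * μ ≤ (n * P1) * (n * ((1 - β) * P2)) := by
              refine mul_le_mul hAP ?_ hμ0 (by positivity)
              have : (1 - β) * P2 = P2 - (S - 1) := by rw [← hβ]; ring
              rw [this]; linarith
          _ = _ := by ring
      have : a * C ≤ |a| * |C| := by rw [← abs_mul]; exact le_abs_self _
      have h3 := mul_le_mul_of_nonneg_left hC2 (abs_nonneg a)
      have h4 := mul_le_mul_of_nonneg_left hBP (sq_nonneg a)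
      rw [hTd]; linarith
    have k := kbar_ge hw2 hw1 f2 a ha f1 S hS1 (hh ▸ hhS)
    have F := fano_rx1 hM1 hM2 (fun w1 w2 => f1 w1 + a • f2 w1 w2) g1 ε h0 h1 (peG1T2 a n M1 M2 f1 f2 g1) rfl T hT0
    refine fano_fin _ ε _ _ ?_ e1 h0 h1 (Real.log_nonneg (by exact_mod_cast hM1)) (F.trans ?_)
    · unfold peG1T2; positivity
    rw [hT]
    simp only [uw, ← Finset.mul_sum] at k
    have hN : 1 + a ^ 2 * β * P2 = 1 + a ^ 2 * (S - 1) := by rw [← hβ]; ring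
    have hN0 : 0 < 1 + a ^ 2 * (S - 1) := by
      have := mul_nonneg (sq_nonneg a) (sub_nonneg.2 hS1)
      linarith
    rw [hN, Real.log_div hT0.ne' hN0.ne', Real.log_mul (by positivity) hT0.ne']
    have q : (A + 2 * a * C + a ^ 2 * B + n) / (2 * T) ≤ n / 2 := by
      rw [div_le_iff₀ (by positivity)]; linarith
    have q2 : H0 = 1 / 2 * Real.log (2 * Real.pi) + 1 / 2 := rfl
    rw [q2] at k
    change _ ≤ 1 / (M1:ℝ) * ∑ w, hm (uw M2) _ at k
    linarith
  · have F : ∀ w, _ := fun w => fano_rx2 hM2 (f2 w) (fun y => g2 (fun i => b * f1 w i + y i)) ε h0 h1 _ rfl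
    have e3 : peG2T2 b n M1 M2 f1 f2 g2 = ∑ w, uw M1 w * ((1 / M2) * ∑ w2, (stdGaussN n {z | g2 (fun i => b * f1 w i + (f2 w w2 + z) i) ≠ w2}).toReal) := by
      unfold peG2T2
      simp only [uw, Pi.add_apply, ← Finset.mul_sum, add_assoc]
      field_simp
    have F2 := Finset.sum_le_sum fun w (_ : w ∈ Finset.univ) => mul_le_mul_of_nonneg_left (F w) (hw1.1 w)
    refine fano_fin (peG2T2 b n M1 M2 f1 f2 g2) ε _ _ ?_ e2 h0 h1 (Real.log_nonneg (by exact_mod_cast hM2)) ?_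
    · unfold peG2T2; positivity
    have e4 : 1 + β * P2 = S := by rw [hβ]; ring
    rw [e4]
    have r1 : ∑ w, uw M1 w * (hm (uw M2) (f2 w) - n * H0) = n * (1 / 2 * Real.log S) := by
      simp only [mul_sub, Finset.sum_sub_distrib, ← Finset.sum_mul, hw1.2, ← hh, hhS]; ring
    rw [r1] at F2
    refine le_trans (le_of_eq ?_) F2
    rw [e3]
    have r2 : ∀ x L D : ℝ, ∀ w, uw M1 w * ((1 - x) * L + x * D) = uw M1 w * L + (uw M1 w * x) * (D - L) := fun x L D w => by ring
    simp only [r2, Finset.sum_add_distrib, ← Finset.sum_mul, hw1.2]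
    ring
end
end

section
open scoped BigOperators ENNReal
open MeasureTheory ProbabilityTheory
noncomputable section

lemma conv_eps (a b P1 P2 : ℝ) (ha : |a| ≤ 1) (hP1 : 0 ≤ P1) (hP2 : 0 ≤ P2) (R : ℝ × ℝ) (hR : R ∈ CapacityGT2 a b P1 P2) (ε : ℝ) (h0 : 0 < ε) (h1 : ε < 1) :
    ∃ β : ℝ, β ∈ Set.Icc (0:ℝ) 1 ∧
      (1 - ε) * ((R.1 - 2 * ε) * Real.log 2) ≤ 1 / 2 * Real.log ((1+P1+2 * |a| * Real.sqrt ((1-β)*P1*P2)+a^2*P2)/(1+a^2*β*P2)) + (-Real.log (1 - ε) - ε * Real.log ε) ∧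
      (1 - ε) * ((R.2 - 2 * ε) * Real.log 2) ≤ 1 / 2 * Real.log (1+β*P2) + (-Real.log (1 - ε) - ε * Real.log ε) := by
  obtain ⟨R', hR', hd⟩ := Metric.mem_closure_iff.1 hR ε h0
  obtain ⟨n, M1, M2, f1, f2, g1, g2, hn, hM1, hM2, p1, p2, r1, r2, e1, e2⟩ := hR' ε h0
  obtain ⟨β, b0, b1, k1, k2⟩ := conv_code a b P1 P2 ha hP1 hP2 n M1 M2 f1 f2 g1 g2 hn hM1 hM2 p1 p2 ε h0 h1 e1 e2
  have hn' : (1:ℝ) ≤ n := by exact_mod_cast hn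
  have hn0 : (0:ℝ) < n := by linarith
  have hl2 : 0 < Real.log 2 := Real.log_pos (by norm_num)
  have a1 : Real.log (1 - ε) ≤ 0 := Real.log_nonpos (by linarith) (by linarith)
  have a2 : Real.log ε ≤ 0 := Real.log_nonpos h0.le h1.le
  have d1 : R.1 - R'.1 < ε := by
    have : dist R.1 R'.1 ≤ dist R R' := by rw [Prod.dist_eq]; exact le_max_left _ _
    rw [Real.dist_eq] at this
    have := le_abs_self (R.1 - R'.1); linarith
  have d2 : R.2 - R'.2 < ε := by
    have : dist R.2 R'.2 ≤ dist R R' := by rw [Prod.dist_eq]; exact le_max_right _ _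
    rw [Real.dist_eq] at this
    have := le_abs_self (R.2 - R'.2); linarith
  have G : ∀ (r L X : ℝ), r - ε ≤ L / Real.log 2 / n → (1 - ε) * L ≤ n * X + (-Real.log (1 - ε) - ε * Real.log ε) → ∀ ρ, ρ - r < ε →
      (1 - ε) * ((ρ - 2 * ε) * Real.log 2) ≤ X + (-Real.log (1 - ε) - ε * Real.log ε) := by
    intro r L X h2 h3 ρ h4
    have hC : 0 ≤ -Real.log (1 - ε) - ε * Real.log ε := by nlinarith
    rw [le_div_iff₀ hn0, le_div_iff₀ hl2] at h2
    have h5 : n * ((ρ - 2 * ε) * Real.log 2) ≤ L := by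
      refine le_trans ?_ h2
      have : (ρ - 2 * ε) * (n * Real.log 2) ≤ (r - ε) * (n * Real.log 2) := mul_le_mul_of_nonneg_right (by linarith) (by positivity)
      linarith
    have h6 := mul_le_mul_of_nonneg_left h5 (by linarith : 0 ≤ 1 - ε)
    have h7 := mul_le_mul_of_nonneg_right hn' hC
    refine le_of_mul_le_mul_left ?_ hn0
    linarith
  exact ⟨β, ⟨b0, b1⟩, G _ _ _ r1 k1 _ d1, G _ _ _ r2 k2 _ d2⟩

theorem conv_main (a b P1 P2 : ℝ) (ha : |a| ≤ 1) (hP1 : 0 ≤ P1) (hP2 : 0 ≤ P2) (R : ℝ × ℝ) (hR : R ∈ CapacityGT2 a b P1 P2) :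
    ∃ β : ℝ, 0 ≤ β ∧ β ≤ 1 ∧
        R.1 ≤ (1 / 2) * Real.logb 2
          ((1 + P1 + 2 * |a| * Real.sqrt ((1 - β) * P1 * P2) + a ^ 2 * P2)
            / (1 + a ^ 2 * β * P2)) ∧
        R.2 ≤ (1 / 2) * Real.logb 2 (1 + β * P2) := by
  have hl2 : 0 < Real.log 2 := Real.log_pos (by norm_num)
  obtain ⟨E, hE⟩ : ∃ E : ℕ → ℝ, E = fun k : ℕ => 1 / ((k:ℝ) + 1 + 1) := ⟨_, rfl⟩
  have E0 : ∀ k, 0 < E k := fun k => by rw [hE]; positivity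
  have E1 : ∀ k, E k < 1 := fun k => by
    rw [hE]; simp only; rw [div_lt_one (by positivity)]
    have : (0:ℝ) ≤ k := Nat.cast_nonneg k
    linarith
  have Et : Filter.Tendsto E Filter.atTop (nhds 0) := by
    have := (Filter.tendsto_add_atTop_iff_nat 1).2 (tendsto_one_div_add_atTop_nhds_zero_nat (𝕜 := ℝ))
    rw [hE]; simpa using this
  choose β hβ k1 k2 using fun k => conv_eps a b P1 P2 ha hP1 hP2 R hR (E k) (E0 k) (E1 k)
  obtain ⟨x, hx, φ, hφ, ht⟩ := isCompact_Icc.tendsto_subseq hβ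
  have Et' : Filter.Tendsto (fun k => E (φ k)) Filter.atTop (nhds 0) := Et.comp hφ.tendsto_atTop
  have cC : ContinuousAt (fun ε : ℝ => -Real.log (1 - ε) - ε * Real.log ε) 0 := by
    refine ContinuousAt.sub (ContinuousAt.neg (ContinuousAt.log (by fun_prop) (by norm_num))) Real.continuous_mul_log.continuousAt
  have tC := cC.tendsto.comp Et'
  have tL : ∀ r : ℝ, Filter.Tendsto (fun k => (1 - E (φ k)) * ((r - 2 * E (φ k)) * Real.log 2)) Filter.atTop (nhds ((1 - 0) * ((r - 2 * 0) * Real.log 2))) := fun r =>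
    (tendsto_const_nhds.sub Et').mul ((tendsto_const_nhds.sub (Et'.const_mul 2)).mul_const _)
  have n1 : 0 < 1 + a ^ 2 * x * P2 := by
    have := mul_nonneg (mul_nonneg (sq_nonneg a) hx.1) hP2; linarith
  have n2 : 0 < 1 + x * P2 := by
    have := mul_nonneg hx.1 hP2; linarith
  have n3 : 0 < 1+P1+2 * |a| * Real.sqrt ((1-x)*P1*P2)+a^2*P2 := by positivity
  have c1 : ContinuousAt (fun β : ℝ => 1 / 2 * Real.log ((1+P1+2 * |a| * Real.sqrt ((1-β)*P1*P2)+a^2*P2)/(1+a^2*β*P2))) x := by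
    refine ContinuousAt.mul continuousAt_const (ContinuousAt.log (ContinuousAt.div ?_ ?_ n1.ne') (div_pos n3 n1).ne')
    · exact Continuous.continuousAt (by fun_prop)
    · fun_prop
  have c2 : ContinuousAt (fun β : ℝ => 1 / 2 * Real.log (1+β*P2)) x := by
    refine ContinuousAt.mul continuousAt_const (ContinuousAt.log (by fun_prop) n2.ne')
  have f1 := le_of_tendsto_of_tendsto' (tL R.1) ((c1.tendsto.comp ht).add tC) (fun k => k1 (φ k))
  have f2 := le_of_tendsto_of_tendsto' (tL R.2) ((c2.tendsto.comp ht).add tC) (fun k => k2 (φ k))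
  norm_num at f1 f2
  refine ⟨x, hx.1, hx.2, ?_, ?_⟩
  · rw [Real.logb, ← mul_div_assoc, le_div_iff₀ hl2]; linarith
  · rw [Real.logb, ← mul_div_assoc, le_div_iff₀ hl2]; linarith

theorem fin_main (a b P1 P2 : ℝ) (ha : |a| ≤ 1)
    (hP1 : 0 ≤ P1) (hP2 : 0 ≤ P2) :
    CapacityGT2 a b P1 P2 =
      {R : ℝ × ℝ | ∃ β : ℝ, 0 ≤ β ∧ β ≤ 1 ∧
        R.1 ≤ (1 / 2) * Real.logb 2
          ((1 + P1 + 2 * |a| * Real.sqrt ((1 - β) * P1 * P2) + a ^ 2 * P2)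
            / (1 + a ^ 2 * β * P2)) ∧
        R.2 ≤ (1 / 2) * Real.logb 2 (1 + β * P2)} := by
  refine Set.Subset.antisymm (fun R hR => conv_main a b P1 P2 ha hP1 hP2 R hR) ?_
  rintro R ⟨β, h0, h1, h2, h3⟩
  exact subset_closure (ach_main a b P1 P2 R.1 R.2 β hP1 hP2 h0 h1 h2 h3)
end
end

/-- **Corollary (capacity of the Gaussian weak IFC, transmitter 2 informed).**
If `|a| ≤ 1`, the capacity region `C^{T₂}_{GIFC}` is exactly the set of rate pairs
`(R₁,R₂)` with `R₁ ≤ ½ log((1 + P₁ + 2|a|√((1−β)P₁P₂) + a²P₂)/(1 + a²βP₂))` and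
`R₂ ≤ ½ log(1 + βP₂)` for some `β ∈ [0,1]`. -/
theorem capacityGT2_eq_DPC (a b P1 P2 : ℝ) (ha : |a| ≤ 1)
    (hP1 : 0 ≤ P1) (hP2 : 0 ≤ P2) :
    CapacityGT2 a b P1 P2 =
      {R : ℝ × ℝ | ∃ β : ℝ, 0 ≤ β ∧ β ≤ 1 ∧
        R.1 ≤ (1 / 2) * Real.logb 2
          ((1 + P1 + 2 * |a| * Real.sqrt ((1 - β) * P1 * P2) + a ^ 2 * P2)
            / (1 + a ^ 2 * β * P2)) ∧
        R.2 ≤ (1 / 2) * Real.logb 2 (1 + β * P2)} := by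
  exact fin_main a b P1 P2 ha hP1 hP2
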